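/- Let k be a finite field of odd characteristic p with q = |k| elements, let ℓ be a prime different from p, and let R be an algebraic closure of the field with ℓ elements. Let n = 2u for an integer u ≥ 1, let ϱ : kˣ → Rˣ be a character with ϱ² = 1, and let W be an irreducible subquotient of the n-fold Harish-Chandra induction ϱ × ⋯ × ϱ (n copies of the GL_1(k)-representation ϱ) to GL_n(k) which is generic, cuspidal and isomorphic to its dual representation. Let H = GL_u(k) × GL_u(k), embedded block-diagonally in GL_n(k), and let s ∈ GL_n(k) be the block matrix [[0, Id_u],[Id_u, 0]], which normalizes H. Assume W is H-distinguished. Then every H-invariant R-linear form Λ on W satisfies Λ ∘ W(s) = c·Λ, where c = −1 if ϱ is the trivial character, and c = (−1)^{u(q−1)/2} if ϱ is nontrivial. -/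

import Mathlib

open scoped TensorProduct

noncomputable section

/-- The index in `Fin n` of the `a.2`-th row/column of the `a.1`-th diagonal block, for the
block decomposition of `n` given by the sizes `d 0, …, d (t-1)` (blocks in increasing
order). -/
def blockIdx {t n : ℕ} (d : Fin t → ℕ) (h : ∑ i, d i = n) (a : Σ i : Fin t, Fin (d i)) :
    Fin n :=
  ⟨(∑ j ∈ Finset.univ.filter (fun j => j < a.1), d j) + (a.2 : ℕ), by
    subst h
    calc (∑ j ∈ Finset.univ.filter (fun j => j < a.1), d j) + (a.2 : ℕ)
        < ∑ j ∈ insert a.1 (Finset.univ.filter (fun j => j < a.1)), d j := by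
          rw [Finset.sum_insert (by simp)]
          have := a.2.isLt
          omega
      _ ≤ ∑ j, d j := Finset.sum_le_sum_of_subset (Finset.subset_univ _)⟩

/-- A matrix is block upper triangular for the block decomposition given by `d`; such
matrices form the standard parabolic subgroup attached to `d`.  -/
def IsBlockUpper (k : Type*) [Field k] {t n : ℕ} (d : Fin t → ℕ) (h : ∑ i, d i = n)
    (M : Matrix (Fin n) (Fin n) k) : Prop :=
  ∀ a b : Σ i : Fin t, Fin (d i), b.1 < a.1 → M (blockIdx d h a) (blockIdx d h b) = 0

/-- The `i`-th diagonal block of a matrix, for the block decomposition given by `d`;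
for an element of the standard parabolic subgroup, taking diagonal blocks is the
projection onto the block-diagonal Levi subgroup. -/
def diagBlock (k : Type*) [Field k] {t n : ℕ} (d : Fin t → ℕ) (h : ∑ i, d i = n)
    (M : Matrix (Fin n) (Fin n) k) (i : Fin t) : Matrix (Fin (d i)) (Fin (d i)) k :=
  Matrix.of fun x y => M (blockIdx d h ⟨i, x⟩) (blockIdx d h ⟨i, y⟩)

/-- The space of functions underlying the Harish-Chandra induction `ρ 0 × ⋯ × ρ (t-1)` of
representations `ρ i` of `GL_{d i}(k)`: functions `f : GL_n(k) → V 0 ⊗ ⋯ ⊗ V (t-1)`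
(with `n = d 0 + ⋯ + d (t-1)`) such that `f (P * g) = (ρ 0 (P₀₀) ⊗ ⋯ ⊗ ρ (t-1) (P_{t-1,t-1})) (f g)`
for every element `P` of the standard block upper triangular parabolic subgroup attached
to `d`, with invertible diagonal blocks `Pᵢᵢ`; this realizes the representation induced
from the parabolic subgroup, through which the tensor product of the `ρ i` is inflated
via the projection onto the Levi subgroup. -/
def hcSubmodule (k R : Type*) [Field k] [CommRing R] {t n : ℕ} (d : Fin t → ℕ)
    (h : ∑ i, d i = n) (V : Fin t → Type*) [∀ i, AddCommGroup (V i)] [∀ i, Module R (V i)]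
    (ρ : ∀ i, Representation R (Matrix.GeneralLinearGroup (Fin (d i)) k) (V i)) :
    Submodule R (Matrix.GeneralLinearGroup (Fin n) k → ⨂[R] i, V i) where
  carrier := {f | ∀ P : Matrix.GeneralLinearGroup (Fin n) k,
    IsBlockUpper k d h (P : Matrix (Fin n) (Fin n) k) →
    ∀ δ : ∀ i, Matrix.GeneralLinearGroup (Fin (d i)) k,
      (∀ i, (δ i : Matrix (Fin (d i)) (Fin (d i)) k)
          = diagBlock k d h (P : Matrix (Fin n) (Fin n) k) i) →
      ∀ g : Matrix.GeneralLinearGroup (Fin n) k,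
        f (P * g) = PiTensorProduct.map (fun i => ρ i (δ i)) (f g)}
  zero_mem' := by
    intro P hP δ hδ g
    simp
  add_mem' := by
    intro f₁ f₂ h₁ h₂ P hP δ hδ g
    simp only [Pi.add_apply, h₁ P hP δ hδ g, h₂ P hP δ hδ g, map_add]
  smul_mem' := by
    intro c f hf P hP δ hδ g
    simp only [Pi.smul_apply, hf P hP δ hδ g, map_smul]

/-- The Harish-Chandra induction `ρ 0 × ⋯ × ρ (t-1)` of representations `ρ i` of
`GL_{d i}(k)`: the representation of `GL_n(k)` (with `n = d 0 + ⋯ + d (t-1)`) acting by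
right translation on `hcSubmodule k R d h V ρ`. -/
def hcInd (k R : Type*) [Field k] [CommRing R] {t n : ℕ} (d : Fin t → ℕ)
    (h : ∑ i, d i = n) (V : Fin t → Type*) [∀ i, AddCommGroup (V i)] [∀ i, Module R (V i)]
    (ρ : ∀ i, Representation R (Matrix.GeneralLinearGroup (Fin (d i)) k) (V i)) :
    Representation R (Matrix.GeneralLinearGroup (Fin n) k) (hcSubmodule k R d h V ρ) where
  toFun g :=
    { toFun := fun f =>
        ⟨fun x => (f : Matrix.GeneralLinearGroup (Fin n) k → ⨂[R] i, V i) (x * g), by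
          intro P hP δ hδ y
          simpa only [mul_assoc] using f.2 P hP δ hδ (y * g)⟩
      map_add' := fun f₁ f₂ => by ext x; rfl
      map_smul' := fun c f => by ext x; rfl }
  map_one' := by
    refine LinearMap.ext fun f => Subtype.ext (funext fun x => ?_)
    show (f : Matrix.GeneralLinearGroup (Fin n) k → ⨂[R] i, V i) (x * 1)
      = (f : Matrix.GeneralLinearGroup (Fin n) k → ⨂[R] i, V i) x
    rw [mul_one]
  map_mul' := fun a b => by
    refine LinearMap.ext fun f => Subtype.ext (funext fun x => ?_)
    show (f : Matrix.GeneralLinearGroup (Fin n) k → ⨂[R] i, V i) (x * (a * b))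
      = (f : Matrix.GeneralLinearGroup (Fin n) k → ⨂[R] i, V i) (x * a * b)
    rw [mul_assoc]

/-- A representation is irreducible if the space is nonzero and the only invariant
submodules are `⊥` and `⊤`. -/
def IsIrreducibleRep {R : Type*} [CommRing R] {G V : Type*} [Monoid G] [AddCommGroup V]
    [Module R V] (ρ : Representation R G V) : Prop :=
  (∃ v : V, v ≠ 0) ∧
    ∀ p : Submodule R V, (∀ g : G, ∀ v ∈ p, ρ g v ∈ p) → p = ⊥ ∨ p = ⊤

/-- `π` is (isomorphic to) a subrepresentation of `ρ`. -/
def IsSubrepOf {R : Type*} [CommRing R] {G W V : Type*} [Monoid G] [AddCommGroup W]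
    [Module R W] [AddCommGroup V] [Module R V]
    (π : Representation R G W) (ρ : Representation R G V) : Prop :=
  ∃ φ : W →ₗ[R] V, Function.Injective φ ∧ ∀ (g : G) (w : W), φ (π g w) = ρ g (φ w)

/-- `π` is (isomorphic to) a subquotient of `ρ`, i.e. a quotient of an invariant
submodule of `ρ`. -/
def IsSubquotientOf {R : Type*} [CommRing R] {G W V : Type*} [Monoid G] [AddCommGroup W]
    [Module R W] [AddCommGroup V] [Module R V]
    (π : Representation R G W) (ρ : Representation R G V) : Prop :=
  ∃ (q : Submodule R V) (hq : ∀ g : G, ∀ v ∈ q, ρ g v ∈ q) (φ : q →ₗ[R] W),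
    Function.Surjective φ ∧
      ∀ (g : G) (v : q), φ ⟨ρ g (v : V), hq g (v : V) v.2⟩ = π g (φ v)

/-- An (irreducible) representation of `GL_n(k)` is cuspidal if it is not isomorphic to a
subrepresentation of any Harish-Chandra induction `ρ 1 × ⋯ × ρ t` with `t ≥ 2` blocks of
positive sizes. -/
def IsCuspidal (k R : Type*) [Field k] [CommRing R] {n : ℕ} {V : Type}
    [AddCommGroup V] [Module R V]
    (W : Representation R (Matrix.GeneralLinearGroup (Fin n) k) V) : Prop :=
  IsIrreducibleRep W ∧
    ¬ ∃ (t : ℕ) (_ : 2 ≤ t) (d : Fin t → ℕ) (_ : ∀ i, 0 < d i) (h : ∑ i, d i = n)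
        (M : Fin t → ModuleCat.{0} R)
        (ρ : ∀ i, Representation R (Matrix.GeneralLinearGroup (Fin (d i)) k) (M i)),
        IsSubrepOf W (hcInd k R d h (fun i => M i) ρ)

/-- An (irreducible) representation of `GL_n(k)` is supercuspidal if it is not isomorphic
to a subquotient of any Harish-Chandra induction `ρ 1 × ⋯ × ρ t` with `t ≥ 2` blocks of
positive sizes. -/
def IsSupercuspidal (k R : Type*) [Field k] [CommRing R] {n : ℕ} {V : Type}
    [AddCommGroup V] [Module R V]
    (W : Representation R (Matrix.GeneralLinearGroup (Fin n) k) V) : Prop :=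
  IsIrreducibleRep W ∧
    ¬ ∃ (t : ℕ) (_ : 2 ≤ t) (d : Fin t → ℕ) (_ : ∀ i, 0 < d i) (h : ∑ i, d i = n)
        (M : Fin t → ModuleCat.{0} R)
        (ρ : ∀ i, Representation R (Matrix.GeneralLinearGroup (Fin (d i)) k) (M i)),
        IsSubquotientOf W (hcInd k R d h (fun i => M i) ρ)

/-- A representation of `GL_n(k)` is generic if it admits a Whittaker functional: a
nonzero linear form `Λ` such that `Λ(u·v) = ψ(u_{1,2} + u_{2,3} + ⋯ + u_{n-1,n})·Λ(v)`
for every upper unitriangular `u`, for some nontrivial additive character `ψ` of `k`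
with values in `Rˣ`. -/
def IsGeneric (k R : Type*) [Field k] [CommRing R] {n : ℕ} {V : Type*}
    [AddCommGroup V] [Module R V]
    (W : Representation R (Matrix.GeneralLinearGroup (Fin n) k) V) : Prop :=
  ∃ ψ : AddChar k Rˣ, (∃ a : k, ψ a ≠ 1) ∧
    ∃ Λ : V →ₗ[R] R, Λ ≠ 0 ∧
      ∀ u : Matrix.GeneralLinearGroup (Fin n) k,
        ((∀ i j : Fin n, (j : ℕ) < (i : ℕ) → (u : Matrix (Fin n) (Fin n) k) i j = 0) ∧
          (∀ i : Fin n, (u : Matrix (Fin n) (Fin n) k) i i = 1)) →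
        ∀ v : V, Λ (W u v) =
          (ψ (∑ i : Fin n, ∑ j : Fin n,
              if (i : ℕ) + 1 = (j : ℕ) then (u : Matrix (Fin n) (Fin n) k) i j else 0) : Rˣ)
            • Λ v

/-- A representation of `GL_n(k)` is distinguished by a subset `H` of `GL_n(k)` if it
carries a nonzero `H`-invariant linear form. -/
def IsDistinguishedBy (k R : Type*) [Field k] [CommRing R] {n : ℕ} {V : Type*}
    [AddCommGroup V] [Module R V]
    (W : Representation R (Matrix.GeneralLinearGroup (Fin n) k) V)
    (H : Set (Matrix.GeneralLinearGroup (Fin n) k)) : Prop :=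
  ∃ Λ : V →ₗ[R] R, Λ ≠ 0 ∧ ∀ h ∈ H, ∀ v : V, Λ (W h v) = Λ v

/-- The subgroup `GL_n(k₀)` of `GL_n(k)`, for a subfield `k₀` of `k`: the set of
invertible matrices all of whose entries lie in (the image of) `k₀`. -/
def glSubfieldSet (k : Type*) [Field k] (k₀ : Type*) [Field k₀] [Algebra k₀ k] (n : ℕ) :
    Set (Matrix.GeneralLinearGroup (Fin n) k) :=
  {g | ∀ i j : Fin n, (g : Matrix (Fin n) (Fin n) k) i j ∈ Set.range (algebraMap k₀ k)}

end

noncomputable section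

/-- A character `ϱ : kˣ → Rˣ`, viewed as a representation of `GL_1(k)` on `R` through the
canonical isomorphism `GL_1(k) ≅ kˣ` (given by the determinant), acting by scalar
multiplication. -/
def charRep (k R : Type*) [Field k] [CommRing R] (ϱ : kˣ →* Rˣ) :
    Representation R (Matrix.GeneralLinearGroup (Fin 1) k) R :=
  (Algebra.lmul R R).toRingHom.toMonoidHom.comp
    ((Units.coeHom R).comp (ϱ.comp (Units.map Matrix.detMonoidHom)))

/-- The Levi subgroup `GL_u(k) × GL_u(k)` of `GL_n(k)` (for `n = 2u`), embedded
block-diagonally: the set of invertible matrices whose two off-diagonal `u × u` blocks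
vanish. -/
def blockLeviSet (k : Type*) [Field k] (n u : ℕ) :
    Set (Matrix.GeneralLinearGroup (Fin n) k) :=
  {g | ∀ i j : Fin n, (((i : ℕ) < u ∧ u ≤ (j : ℕ)) ∨ ((j : ℕ) < u ∧ u ≤ (i : ℕ))) →
    (g : Matrix (Fin n) (Fin n) k) i j = 0}

section
open scoped Classical
open scoped TensorProduct

noncomputable section

namespace St14

set_option linter.unusedSectionVars false
set_option linter.unusedSimpArgs false

abbrev GLn (n : ℕ) (k : Type) [Field k] := Matrix.GeneralLinearGroup (Fin n) k

/-- unipotent radical of the maximal parabolic of type (r, n-r) -/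
def IsUR {n : ℕ} {k : Type} [Field k] (r : ℕ) (g : GLn n k) : Prop :=
  ∀ a b : Fin n, ¬ ((a : ℕ) < r ∧ r ≤ (b : ℕ)) → (g : Matrix (Fin n) (Fin n) k) a b = (1 : Matrix (Fin n) (Fin n) k) a b

section cusp

variable {n : ℕ} {k : Type} [Field k] [Fintype k] {R : Type} [Field R]

lemma blockIdx_bij {n : ℕ} (d : Fin 2 → ℕ) (h : ∑ i, d i = n) :
    Function.Bijective (blockIdx d h) := by
  rw [Fintype.bijective_iff_injective_and_card]
  constructor
  · rintro ⟨i, x⟩ ⟨j, y⟩ hxy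
    have h1 := congrArg Fin.val hxy
    simp only [blockIdx] at h1
    have h0 : (∑ j ∈ Finset.univ.filter (fun j : Fin 2 => j < 0), d j) = 0 := by
      simp
    have h2 : (∑ j ∈ Finset.univ.filter (fun j : Fin 2 => j < 1), d j) = d 0 := by
      have : Finset.univ.filter (fun j : Fin 2 => j < 1) = {0} := by decide
      rw [this]; simp
    have e : i = j := by
      fin_cases i <;> fin_cases j <;> simp_all <;> omega
    subst e
    congr 1
    ext; omega
  · simp [h]

lemma blockIdx_val0 {n : ℕ} (d : Fin 2 → ℕ) (h : ∑ i, d i = n) (x : Fin (d 0)) :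
    (blockIdx d h ⟨0, x⟩ : ℕ) = x := by
  simp [blockIdx]

lemma blockIdx_val1 {n : ℕ} (d : Fin 2 → ℕ) (h : ∑ i, d i = n) (x : Fin (d 1)) :
    (blockIdx d h ⟨1, x⟩ : ℕ) = d 0 + x := by
  have h2 : (∑ j ∈ Finset.univ.filter (fun j : Fin 2 => j < 1), d j) = d 0 := by
    have : Finset.univ.filter (fun j : Fin 2 => j < 1) = {0} := by decide
    rw [this]; simp
  simp only [blockIdx, h2]

def bEquiv {n : ℕ} (d : Fin 2 → ℕ) (h : ∑ i, d i = n) : (Σ i : Fin 2, Fin (d i)) ≃ Fin n :=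
  Equiv.ofBijective _ (blockIdx_bij d h)

/-- block diagonal embedding as ring hom -/
def iotaM (k : Type) [Field k] {n : ℕ} (d : Fin 2 → ℕ) (h : ∑ i, d i = n) :
    (∀ i, Matrix (Fin (d i)) (Fin (d i)) k) →+* Matrix (Fin n) (Fin n) k :=
  ((Matrix.reindexAlgEquiv k k (bEquiv d h)).toRingEquiv.toRingHom).comp
    (Matrix.blockDiagonal'RingHom (fun i => Fin (d i)) k)

lemma iotaM_apply {n : ℕ} (d : Fin 2 → ℕ) (h : ∑ i, d i = n)
    (M : ∀ i, Matrix (Fin (d i)) (Fin (d i)) k) (a b : Σ i : Fin 2, Fin (d i)) :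
    iotaM k d h M (blockIdx d h a) (blockIdx d h b) = Matrix.blockDiagonal' M a b := by
  have ha : (bEquiv d h).symm (blockIdx d h a) = a := (bEquiv d h).symm_apply_apply a
  have hb : (bEquiv d h).symm (blockIdx d h b) = b := (bEquiv d h).symm_apply_apply b
  simp [iotaM, Matrix.blockDiagonal'RingHom, ha, hb]
  rfl

def iota (k : Type) [Field k] {n : ℕ} (d : Fin 2 → ℕ) (h : ∑ i, d i = n) :
    (∀ i, GLn (d i) k) →* GLn n k :=
  (Units.map (iotaM k d h).toMonoidHom).comp (MulEquiv.piUnits.symm.toMonoidHom)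

lemma iota_val {n : ℕ} (d : Fin 2 → ℕ) (h : ∑ i, d i = n) (a : ∀ i, GLn (d i) k) :
    (iota k d h a : Matrix (Fin n) (Fin n) k) = iotaM k d h (fun i => (a i : Matrix _ _ k)) := rfl

lemma bd_ne {d : Fin 2 → ℕ} (M : ∀ i, Matrix (Fin (d i)) (Fin (d i)) k) (a b : Σ i : Fin 2, Fin (d i))
    (h : a.1 ≠ b.1) : Matrix.blockDiagonal' M a b = 0 := by
  rw [Matrix.blockDiagonal'_apply, dif_neg h]

/-- key factorization -/
lemma iota_mul_UR {n : ℕ} (d : Fin 2 → ℕ) (h : ∑ i, d i = n) (P : GLn n k)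
    (hP : IsBlockUpper k d h (P : Matrix (Fin n) (Fin n) k))
    (δ a : ∀ i, GLn (d i) k)
    (hδ : ∀ i, (δ i : Matrix (Fin (d i)) (Fin (d i)) k)
          = diagBlock k d h (P : Matrix (Fin n) (Fin n) k) i) :
    IsUR (d 0) (iota k d h a * P * (iota k d h (a * δ))⁻¹) := by
  set Z : Matrix (Fin n) (Fin n) k := P - iota k d h δ with hZ
  have hZ0 : ∀ x y : Σ i : Fin 2, Fin (d i), ¬ (x.1 < y.1) → Z (blockIdx d h x) (blockIdx d h y) = 0 := by
    rintro ⟨i, x⟩ ⟨j, y⟩ hxy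
    simp only [hZ, Matrix.sub_apply, iota_val, iotaM_apply]
    rcases lt_trichotomy i j with hij | hij | hij
    · exact absurd hij hxy
    · subst hij
      rw [Matrix.blockDiagonal'_apply_eq, hδ]
      simp [diagBlock]
    · rw [Matrix.blockDiagonal'_apply_ne _ _ _ (ne_of_gt hij)]
      rw [hP ⟨i, x⟩ ⟨j, y⟩ hij]; simp
  have key : ((iota k d h a * P * (iota k d h (a * δ))⁻¹ : GLn n k) : Matrix (Fin n) (Fin n) k)
      = 1 + iotaM k d h (fun i => (a i : Matrix _ _ k)) * Z *
          iotaM k d h (fun i => (((a * δ)⁻¹ : ∀ i, GLn (d i) k) i : Matrix _ _ k)) := by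
    have hPZ : (P : Matrix (Fin n) (Fin n) k) = iota k d h δ + Z := by simp [hZ]
    rw [← iota_val, ← iota_val, map_inv, Units.val_mul, Units.val_mul, hPZ, mul_add, add_mul]
    congr 1
    rw [← Units.val_mul, ← Units.val_mul, ← map_mul, mul_inv_cancel]; simp
  intro x y hxy
  rw [key]
  obtain ⟨x, rfl⟩ := (blockIdx_bij d h).2 x
  obtain ⟨y, rfl⟩ := (blockIdx_bij d h).2 y
  have hxy' : ¬ (x.1 < y.1) := by
    intro hlt
    obtain ⟨i, x⟩ := x
    obtain ⟨j, y⟩ := y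
    simp only at hlt
    obtain ⟨rfl, rfl⟩ : i = 0 ∧ j = 1 := by
      fin_cases i <;> fin_cases j <;> simp_all
    apply hxy
    rw [blockIdx_val0, blockIdx_val1]
    have := x.2
    omega
  rw [Matrix.add_apply]
  convert add_zero _
  rw [Matrix.mul_apply]
  apply Finset.sum_eq_zero
  intro z _
  obtain ⟨z, rfl⟩ := (blockIdx_bij d h).2 z
  rw [Matrix.mul_apply, Finset.sum_mul]
  apply Finset.sum_eq_zero
  intro w _
  obtain ⟨w, rfl⟩ := (blockIdx_bij d h).2 w
  rw [iotaM_apply, iotaM_apply]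
  by_cases h1 : x.1 = w.1
  · by_cases h2 : z.1 = y.1
    · rw [hZ0 w z (by rw [← h1, h2]; exact hxy')]; simp
    · rw [bd_ne _ z y h2, mul_zero]
  · rw [bd_ne _ x w h1, zero_mul, zero_mul]

/-- right regular representation -/
def regRep (R : Type) [Field R] (G : Type) [Group G] : Representation R G (G → R) where
  toFun g := { toFun := fun f x => f (x * g), map_add' := fun _ _ => rfl, map_smul' := fun _ _ => rfl }
  map_one' := by ext; simp
  map_mul' a b := by ext; simp [mul_assoc]

lemma regRep_apply (G : Type) [Group G] (g : G) (f : G → R) (x : G) :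
    regRep R G g f x = f (x * g) := rfl

lemma regRep_single (G : Type) [Group G] [DecidableEq G] (g a : G) :
    regRep R G g (Pi.single (a * g) (1:R)) = Pi.single a (1:R) := by
  ext x
  simp only [regRep_apply, Pi.single_apply]
  simp

variable {VW : Type} [AddCommGroup VW] [Module R VW]

lemma cusp_lemma (W : Representation R (GLn n k) VW) (hW : IsCuspidal k R W) (r : ℕ) (hr : 0 < r)
    (hrn : r < n) (μ : VW →ₗ[R] R) (hμ : ∀ g, IsUR r g → ∀ v, μ (W g v) = μ v) : μ = 0 := by
  by_contra hne
  obtain ⟨hirr, hno⟩ := hW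
  apply hno
  set d : Fin 2 → ℕ := ![r, n - r] with hd
  have h : ∑ i, d i = n := by simp [hd]; omega
  have hd0 : d 0 = r := rfl
  refine ⟨2, le_refl _, d, ?_, h, fun i => ModuleCat.of R (GLn (d i) k → R), fun i => regRep R (GLn (d i) k), ?_⟩
  · intro i; fin_cases i <;> simp [hd] <;> omega
  let T : (∀ i, GLn (d i) k) → ⨂[R] i, (GLn (d i) k → R) :=
    fun a => PiTensorProduct.tprod R (fun i => Pi.single (a i) (1:R))
  let φ0 : VW →ₗ[R] (GLn n k → ⨂[R] i, (GLn (d i) k → R)) :=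
    LinearMap.pi fun g => ∑ a : ∀ i, GLn (d i) k, (μ ∘ₗ W (iota k d h a * g)).smulRight (T a)
  have hφ0 : ∀ v g, φ0 v g = ∑ a : ∀ i, GLn (d i) k, μ (W (iota k d h a * g) v) • T a := by
    intro v g
    simp [φ0]
  have hmem : ∀ v, φ0 v ∈ hcSubmodule k R d h (fun i => (GLn (d i) k → R)) (fun i => regRep R (GLn (d i) k)) := by
    intro v P hP δ hδ g
    rw [hφ0, hφ0, map_sum]
    rw [← Equiv.sum_comp (Equiv.mulRight δ) (fun a => (PiTensorProduct.map fun i => regRep R (GLn (d i) k) (δ i)) _)]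
    apply Finset.sum_congr rfl
    intro a _
    rw [map_smul]
    simp only [T, PiTensorProduct.map_tprod, Equiv.coe_mulRight, Pi.mul_apply]
    have e : (fun i => (regRep R (GLn (d i) k) (δ i)) (Pi.single (a i * δ i) (1:R)))
        = fun i => Pi.single (a i) (1:R) := funext fun i => regRep_single _ (δ i) (a i)
    refine Eq.trans ?_ (congrArg (fun z => _ • PiTensorProduct.tprod R z) e.symm)
    congr 1
    have := iota_mul_UR d h P hP δ a hδ
    rw [hd0] at this
    have h2 := hμ _ this (W (iota k d h (a * δ) * g) v)
    rw [← h2, ← Module.End.mul_apply, ← map_mul]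
    congr 3
    group
  let φ : VW →ₗ[R] hcSubmodule k R d h (fun i => (GLn (d i) k → R)) (fun i => regRep R (GLn (d i) k)) :=
    φ0.codRestrict _ hmem
  have hequi : ∀ g w, φ (W g w) = hcInd k R d h (fun i => (GLn (d i) k → R)) (fun i => regRep R (GLn (d i) k)) g (φ w) := by
    intro g w
    apply Subtype.ext
    funext x
    change φ0 (W g w) x = φ0 w (x * g)
    rw [hφ0, hφ0]
    apply Finset.sum_congr rfl
    intro a _
    rw [← Module.End.mul_apply, ← map_mul, mul_assoc]
  refine ⟨φ, ?_, hequi⟩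
  rw [← LinearMap.ker_eq_bot]
  rcases hirr.2 (LinearMap.ker φ) (by
    intro g v hv
    rw [LinearMap.mem_ker] at hv ⊢
    rw [hequi, hv, map_zero]) with hk | hk
  · exact hk
  exfalso
  apply hne
  ext v
  have hv : φ0 v = 0 := by
    have : v ∈ LinearMap.ker φ := by rw [hk]; trivial
    rw [LinearMap.mem_ker] at this
    exact congrArg Subtype.val this
  have h1 := hφ0 v 1
  rw [hv] at h1
  let ev : (⨂[R] i, (GLn (d i) k → R)) →ₗ[R] R :=
    PiTensorProduct.lift ((MultilinearMap.mkPiAlgebra R (Fin 2) R).compLinearMap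
      (fun i => LinearMap.proj (R := R) (φ := fun _ : GLn (d i) k => R) 1))
  have h3 := congrArg ev h1
  rw [map_sum, Finset.sum_eq_single 1] at h3
  · simp [ev, T] at h3
    simpa using h3.symm
  · intro a _ ha
    rw [map_smul]
    simp only [T, ev, PiTensorProduct.lift.tprod, MultilinearMap.compLinearMap_apply, MultilinearMap.mkPiAlgebra_apply, LinearMap.proj_apply]
    obtain ⟨i, hi⟩ : ∃ i, a i ≠ 1 := by
      by_contra hcon
      push Not at hcon
      exact ha (funext hcon)
    rw [Finset.prod_eq_zero (Finset.mem_univ i)]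
    · simp
    · rw [Pi.single_apply, if_neg (Ne.symm hi)]
  · simp

end cusp
end St14
end
end

section
open scoped Classical
open scoped TensorProduct

noncomputable section

namespace St14

set_option linter.unusedSectionVars false
set_option linter.unusedSimpArgs false

set_option linter.unusedVariables false

variable {n : ℕ} {k : Type} [Field k] {R : Type} [Field R]
variable {VW : Type} [AddCommGroup VW] [Module R VW]

def subOf {G : Type} [Group G] [Finite G] (p : G → Prop) (h1 : p 1)
    (hm : ∀ a b, p a → p b → p (a * b)) : Subgroup G where
  carrier := {g | p g}
  one_mem' := h1
  mul_mem' := fun {a b} ha hb => hm a b ha hb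
  inv_mem' := by
    intro x hx
    have hpow : ∀ m : ℕ, p (x ^ m) := by
      intro m
      induction m with
      | zero => simpa using h1
      | succ m ih => rw [pow_succ]; exact hm _ _ ih hx
    have : x⁻¹ = x ^ (orderOf x - 1) := by
      rw [inv_eq_iff_mul_eq_one, ← pow_succ', Nat.sub_add_cancel (orderOf_pos x), pow_orderOf_eq_one]
    change p x⁻¹
    rw [this]; exact hpow _

lemma mem_subOf {G : Type} [Group G] [Finite G] (p : G → Prop) (h1 : p 1)
    (hm : ∀ a b, p a → p b → p (a * b)) (g : G) : g ∈ subOf p h1 hm ↔ p g := Iff.rfl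

/-- permutation matrices -/
def PmM (k : Type) [Field k] {n : ℕ} (σ : Equiv.Perm (Fin n)) : Matrix (Fin n) (Fin n) k :=
  Matrix.of fun (i j : Fin n) => (1 : Matrix (Fin n) (Fin n) k) i (σ j)

lemma PmM_apply (σ : Equiv.Perm (Fin n)) (i j : Fin n) :
    PmM k σ i j = (1 : Matrix (Fin n) (Fin n) k) i (σ j) := rfl

lemma mul_PmM_apply (σ : Equiv.Perm (Fin n)) (A : Matrix (Fin n) (Fin n) k) (i j : Fin n) :
    (A * PmM k σ) i j = A i (σ j) := by
  rw [Matrix.mul_apply, Finset.sum_eq_single (σ j)]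
  · rw [PmM_apply, Matrix.one_apply_eq, mul_one]
  · intro c _ hc
    rw [PmM_apply, Matrix.one_apply_ne hc, mul_zero]
  · simp

lemma PmM_mul_apply (σ : Equiv.Perm (Fin n)) (A : Matrix (Fin n) (Fin n) k) (i j : Fin n) :
    (PmM k σ * A) i j = A (σ⁻¹ i) j := by
  rw [Matrix.mul_apply, Finset.sum_eq_single (σ⁻¹ i)]
  · rw [PmM_apply, show σ (σ⁻¹ i) = i by simp, Matrix.one_apply_eq, one_mul]
  · intro c _ hc
    rw [PmM_apply, Matrix.one_apply_ne, zero_mul]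
    rintro rfl
    simp at hc
  · simp

lemma PmM_mul (σ τ : Equiv.Perm (Fin n)) : PmM k (σ * τ) = PmM k σ * PmM k τ := by
  ext i j
  rw [mul_PmM_apply]
  rfl

lemma PmM_one : PmM k (1 : Equiv.Perm (Fin n)) = 1 := by
  ext i j
  rfl

def Pm (k : Type) [Field k] {n : ℕ} (σ : Equiv.Perm (Fin n)) : GLn n k where
  val := PmM k σ
  inv := PmM k σ⁻¹
  val_inv := by rw [← PmM_mul, mul_inv_cancel, PmM_one]
  inv_val := by rw [← PmM_mul, inv_mul_cancel, PmM_one]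

lemma Pm_val (σ : Equiv.Perm (Fin n)) : (Pm k σ : Matrix (Fin n) (Fin n) k) = PmM k σ := rfl

lemma Pm_mul (σ τ : Equiv.Perm (Fin n)) : Pm k (σ * τ) = Pm k σ * Pm k τ := by
  ext1; exact PmM_mul σ τ

lemma Pm_one : Pm k (1 : Equiv.Perm (Fin n)) = 1 := by
  ext1; exact PmM_one

lemma Pm_inv (σ : Equiv.Perm (Fin n)) : (Pm k σ)⁻¹ = Pm k σ⁻¹ := by
  rw [inv_eq_iff_mul_eq_one, ← Pm_mul]; simp [Pm_one]

lemma fB_diag {r m : ℕ} (z : Fin r ⊕ Fin m) :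
    (Matrix.fromBlocks (1 : Matrix (Fin r) (Fin r) k) 0 0 (0 : Matrix (Fin m) (Fin m) k)) z z
      = if (finSumFinEquiv z : ℕ) < r then 1 else 0 := by
  rcases z with x | x <;> simp

variable [Fintype k]

lemma isUR_one (r : ℕ) : IsUR r (1 : GLn n k) := fun a b _ => rfl

lemma isUR_mul (r : ℕ) (g h : GLn n k) (hg : IsUR r g) (hh : IsUR r h) : IsUR r (g * h) := by
  intro a b hab
  rw [Units.val_mul, Matrix.mul_apply]
  by_cases ha : (a : ℕ) < r
  · have hb : (b : ℕ) < r := by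
      by_contra hb; exact hab ⟨ha, by omega⟩
    rw [Finset.sum_eq_single b]
    · rw [hh b b (by omega), hg a b (by omega)]; simp
    · intro c _ hc
      rw [hh c b (by omega), Matrix.one_apply_ne hc, mul_zero]
    · simp
  · rw [Finset.sum_eq_single a]
    · rw [hg a a (by omega), hh a b (by omega)]; simp
    · intro c _ hc
      rw [hg a c (by omega), Matrix.one_apply_ne (Ne.symm hc), zero_mul]
    · simp

def UR (n : ℕ) (k : Type) [Field k] [Fintype k] (r : ℕ) : Subgroup (GLn n k) :=
  subOf (IsUR r) (isUR_one r) (isUR_mul r)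

/-- cuspidality in terms of functionals -/
def Cusp (W : Representation R (GLn n k) VW) : Prop :=
  ∀ r : ℕ, 0 < r → r < n → ∀ μ : VW →ₗ[R] R, (∀ g, IsUR r g → ∀ v, μ (W g v) = μ v) → μ = 0

lemma rep_mul {G : Type} [Group G] (W : Representation R G VW) (a b : G) (v : VW) :
    W (a * b) v = W a (W b v) := by
  rw [map_mul]; rfl

lemma cusp_sum (W : Representation R (GLn n k) VW) (hW : Cusp W) (r : ℕ) (hr : 0 < r) (hrn : r < n)
    (g : GLn n k) (v : VW) : ∑ u : UR n k r, W (g * u * g⁻¹) v = 0 := by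
  rw [← Module.forall_dual_apply_eq_zero_iff R]
  intro f
  have := hW r hr hrn (∑ u : UR n k r, f ∘ₗ W (g * u)) (by
    intro x hx v
    simp only [LinearMap.sum_apply, LinearMap.comp_apply]
    rw [← Equiv.sum_comp (Equiv.mulRight (⟨x, hx⟩ : UR n k r)) (fun u : UR n k r => f (W (g * u) v))]
    apply Finset.sum_congr rfl
    intro u _
    rw [← rep_mul]
    simp [mul_assoc])
  have h2 := LinearMap.congr_fun this (W g⁻¹ v)
  simp only [LinearMap.sum_apply, LinearMap.comp_apply, LinearMap.zero_apply] at h2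
  rw [map_sum, ← h2]
  apply Finset.sum_congr rfl
  intro u _
  rw [rep_mul]

def J (n : ℕ) (k : Type) [Field k] (r : ℕ) : Matrix (Fin n) (Fin n) k :=
  Matrix.diagonal fun i : Fin n => if (i : ℕ) < r then (1:k) else 0

lemma sing_nf (Y : Matrix (Fin n) (Fin n) k) (hY : ¬ IsUnit Y) (hne : Y ≠ 0) :
    ∃ (g h : GLn n k) (r : ℕ), 0 < r ∧ r < n ∧ Y = g * J n k r * h := by
  obtain ⟨V, U, e, hV, hU, heq⟩ := Matrix.exists_rank_normal_form Y
  have hrn : Y.rank ≤ n := by simpa using Matrix.rank_le_card_width Y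
  generalize Y.rank = r at *
  have hsum : r + (Fintype.card (Fin n) - r) = n := by simp; omega
  let σ : Equiv.Perm (Fin n) := e.trans (finSumFinEquiv.trans (finCongr hsum))
  have hJ : (Matrix.fromBlocks (1 : Matrix (Fin r) (Fin r) k) 0 0 (0 : Matrix (Fin (Fintype.card (Fin n) - r)) (Fin (Fintype.card (Fin n) - r)) k)).submatrix e e
      = PmM k σ⁻¹ * J n k r * PmM k σ := by
    ext i j
    rw [mul_PmM_apply, PmM_mul_apply]
    simp only [Matrix.submatrix_apply, inv_inv, J, Matrix.diagonal_apply]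
    by_cases hij : i = j
    · subst hij
      simp only [if_true, σ, Equiv.trans_apply]
      exact fB_diag (e i)
    · rw [if_neg (by simpa using hij)]
      have : e i ≠ e j := by simpa using hij
      rcases hi : e i with x | x <;> rcases hj : e j with y | y <;> simp_all [Matrix.one_apply]
  obtain ⟨V, rfl⟩ := hV
  obtain ⟨U, rfl⟩ := hU
  have hY2 : Y = ((V⁻¹ * Pm k σ⁻¹ : GLn n k) : Matrix _ _ k) * J n k r * ((Pm k σ * U⁻¹ : GLn n k) : Matrix _ _ k) := by
    have : Y = (V⁻¹ : GLn n k) * (V * Y * U) * (U⁻¹ : GLn n k) := by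
      simp only [mul_assoc, Units.inv_mul_cancel_left, Units.mul_inv, mul_one]
    rw [this, heq, hJ]
    simp only [Units.val_mul, mul_assoc]
    rfl
  refine ⟨V⁻¹ * Pm k σ⁻¹, Pm k σ * U⁻¹, r, ?_, ?_, hY2⟩
  · rcases Nat.eq_zero_or_pos r with h0 | h0
    · exfalso; apply hne
      rw [hY2, h0]
      have : J n k 0 = 0 := by ext i j; simp [J, Matrix.diagonal_apply]
      rw [this]; simp
    · exact h0
  · rcases hrn.lt_or_eq with h0 | h0
    · exact h0
    · exfalso; apply hY
      rw [hY2]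
      have : J n k r = 1 := by
        rw [h0]; ext i j; simp [J, Matrix.diagonal_apply, Matrix.one_apply]
      rw [this, mul_one]
      exact (Units.isUnit _).mul (Units.isUnit _)

/-- membership in the unipotent radical attached to the image of A -/
def inU (A : Matrix (Fin n) (Fin n) k) (x : GLn n k) : Prop :=
  ((x : Matrix (Fin n) (Fin n) k) - 1) * A = 0 ∧ ∃ B, (x : Matrix (Fin n) (Fin n) k) - 1 = A * B

lemma mul_J_apply (M : Matrix (Fin n) (Fin n) k) (r : ℕ) (a b : Fin n) :
    (M * J n k r) a b = if (b : ℕ) < r then M a b else 0 := by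
  simp [J, Matrix.mul_diagonal]

lemma J_mul_apply (M : Matrix (Fin n) (Fin n) k) (r : ℕ) (a b : Fin n) :
    (J n k r * M) a b = if (a : ℕ) < r then M a b else 0 := by
  simp [J, Matrix.diagonal_mul]

lemma UR_mul_J (r : ℕ) (x : GLn n k) (hx : IsUR r x) : (x : Matrix _ _ k) * J n k r = J n k r := by
  ext a b
  rw [mul_J_apply]
  split_ifs with h
  · rw [hx a b (by omega)]
    by_cases e : a = b
    · subst e; simp [J, h]
    · simp [J, Matrix.diagonal_apply, Matrix.one_apply, e]
  · simp [J, Matrix.diagonal_apply]; intro e; subst e; simpa using h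

lemma inU_iff (g h : GLn n k) (r : ℕ) (x : GLn n k) :
    inU (g * J n k r * h : Matrix (Fin n) (Fin n) k) x ↔ IsUR r (g⁻¹ * x * g) := by
  set M : Matrix (Fin n) (Fin n) k := (g⁻¹ : GLn n k) * ((x : Matrix (Fin n) (Fin n) k) - 1) * g with hM
  have hM1 : ((g⁻¹ * x * g : GLn n k) : Matrix (Fin n) (Fin n) k) = 1 + M := by
    rw [hM, mul_sub, sub_mul]; simp
  have hx : (x : Matrix (Fin n) (Fin n) k) - 1 = g * M * (g⁻¹ : GLn n k) := by
    rw [hM, ← mul_assoc, ← mul_assoc, Units.mul_inv, one_mul, mul_assoc, Units.mul_inv, mul_one]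
  have h1 : ((x : Matrix (Fin n) (Fin n) k) - 1) * (g * J n k r * h) = g * (M * J n k r) * h := by
    rw [hx]; simp only [mul_assoc]
    rw [Units.inv_mul_cancel_left]
  have e1 : ((x : Matrix (Fin n) (Fin n) k) - 1) * (g * J n k r * h) = 0 ↔ M * J n k r = 0 := by
    rw [h1]
    constructor
    · intro h0
      have := congrArg (fun z : Matrix (Fin n) (Fin n) k => (g⁻¹ : GLn n k) * z * (h⁻¹ : GLn n k)) h0
      simp only [mul_assoc, Units.inv_mul_cancel_left, Units.mul_inv, mul_one, zero_mul, mul_zero] at this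
      exact this
    · intro h0; rw [h0]; simp
  have e2 : (∃ B, (x : Matrix (Fin n) (Fin n) k) - 1 = g * J n k r * h * B) ↔ ∃ B, M = J n k r * B := by
    constructor
    · rintro ⟨B, hB⟩
      refine ⟨h * B * g, ?_⟩
      rw [hM, hB]; simp only [mul_assoc, Units.inv_mul_cancel_left]
    · rintro ⟨B, hB⟩
      refine ⟨(h⁻¹ : GLn n k) * B * (g⁻¹ : GLn n k), ?_⟩
      rw [hx, hB]; simp only [mul_assoc, Units.mul_inv_cancel_left]
  unfold inU IsUR
  rw [e1, e2, hM1]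
  constructor
  · rintro ⟨ha, B, hB⟩ a b hab
    rw [Matrix.add_apply]
    convert add_zero _
    by_cases h : (a : ℕ) < r
    · have := congrFun (congrFun ha a) b
      rw [mul_J_apply, if_pos (by omega)] at this
      simpa using this
    · rw [hB, J_mul_apply, if_neg h]
  · intro h
    have h' : ∀ a b : Fin n, ¬ ((a : ℕ) < r ∧ r ≤ (b : ℕ)) → M a b = 0 := by
      intro a b hab
      have := h a b hab
      rw [Matrix.add_apply] at this
      simpa using this
    refine ⟨?_, M, ?_⟩
    · ext a b
      rw [mul_J_apply]
      split_ifs with hb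
      · exact h' a b (by omega)
      · simp
    · ext a b
      rw [J_mul_apply]
      split_ifs with hb
      · rfl
      · exact h' a b (by omega)

end St14
end
end

section
open scoped Classical
open scoped TensorProduct

noncomputable section

namespace St14

set_option linter.unusedSectionVars false
set_option linter.unusedSimpArgs false
set_option linter.unusedVariables false

variable {n : ℕ} {k : Type} [Field k] [Fintype k] {R : Type} [Field R]
variable {VW : Type} [AddCommGroup VW] [Module R VW]

def IsUp (g : GLn n k) : Prop := ∀ i j : Fin n, j < i → (g : Matrix (Fin n) (Fin n) k) i j = 0

def IsUni (g : GLn n k) : Prop := IsUp g ∧ ∀ i : Fin n, (g : Matrix (Fin n) (Fin n) k) i i = 1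

lemma isUp_one : IsUp (1 : GLn n k) := fun i j h => Matrix.one_apply_ne (ne_of_gt h)

lemma isUp_mul (g h : GLn n k) (hg : IsUp g) (hh : IsUp h) : IsUp (g * h) := by
  intro i j hij
  rw [Units.val_mul, Matrix.mul_apply]
  apply Finset.sum_eq_zero
  intro c _
  rcases lt_or_ge c i with h1 | h1
  · rw [hg i c h1, zero_mul]
  · rw [hh c j (lt_of_lt_of_le hij h1), mul_zero]

lemma up_mul_diag (g h : GLn n k) (hg : IsUp g) (hh : IsUp h) (i : Fin n) :
    ((g * h : GLn n k) : Matrix (Fin n) (Fin n) k) i i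
      = (g : Matrix (Fin n) (Fin n) k) i i * (h : Matrix (Fin n) (Fin n) k) i i := by
  rw [Units.val_mul, Matrix.mul_apply, Finset.sum_eq_single i]
  · intro c _ hc
    rcases lt_or_gt_of_ne hc with h1 | h1
    · rw [hg i c h1, zero_mul]
    · rw [hh c i h1, mul_zero]
  · simp

lemma isUni_one : IsUni (1 : GLn n k) := ⟨isUp_one, fun i => Matrix.one_apply_eq i⟩

lemma isUni_mul (g h : GLn n k) (hg : IsUni g) (hh : IsUni h) : IsUni (g * h) :=
  ⟨isUp_mul g h hg.1 hh.1, fun i => by rw [up_mul_diag g h hg.1 hh.1, hg.2, hh.2, mul_one]⟩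

def Bs (n : ℕ) (k : Type) [Field k] [Fintype k] : Subgroup (GLn n k) := subOf IsUp isUp_one isUp_mul
def Ns (n : ℕ) (k : Type) [Field k] [Fintype k] : Subgroup (GLn n k) := subOf IsUni isUni_one isUni_mul

lemma mem_Bs (g : GLn n k) : g ∈ Bs n k ↔ IsUp g := Iff.rfl
lemma mem_Ns (g : GLn n k) : g ∈ Ns n k ↔ IsUni g := Iff.rfl

lemma isUp_inv {g : GLn n k} (hg : IsUp g) : IsUp g⁻¹ := (Bs n k).inv_mem hg
lemma isUni_inv {g : GLn n k} (hg : IsUni g) : IsUni g⁻¹ := (Ns n k).inv_mem hg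

lemma up_det (g : GLn n k) (hg : IsUp g) :
    (g : Matrix (Fin n) (Fin n) k).det = ∏ i, (g : Matrix (Fin n) (Fin n) k) i i :=
  Matrix.det_of_isUpperTriangular (fun i j h => hg i j h)

lemma up_diag_ne (g : GLn n k) (hg : IsUp g) (i : Fin n) : (g : Matrix (Fin n) (Fin n) k) i i ≠ 0 := by
  have h1 : (g : Matrix (Fin n) (Fin n) k).det ≠ 0 := by
    have := (Matrix.isUnit_iff_isUnit_det _).1 (Units.isUnit g)
    exact this.ne_zero
  rw [up_det g hg, Finset.prod_ne_zero_iff] at h1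
  exact h1 i (Finset.mem_univ _)

/-- index set of positive roots -/
abbrev PR (n : ℕ) := {p : Fin n × Fin n // p.1 < p.2}

def bM (d : Fin n → kˣ) (M : PR n → k) : Matrix (Fin n) (Fin n) k :=
  Matrix.of fun (i j : Fin n) => if h : i < j then M ⟨(i, j), h⟩ else if i = j then (d i : k) else 0

lemma bM_lt (d : Fin n → kˣ) (M : PR n → k) (i j : Fin n) (h : i < j) : bM d M i j = M ⟨(i, j), h⟩ := by
  simp [bM, h]
lemma bM_eq (d : Fin n → kˣ) (M : PR n → k) (i : Fin n) : bM d M i i = d i := by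
  simp [bM]
lemma bM_gt (d : Fin n → kˣ) (M : PR n → k) (i j : Fin n) (h : j < i) : bM d M i j = 0 := by
  simp [bM, not_lt_of_gt h, ne_of_gt h]

lemma bM_det (d : Fin n → kˣ) (M : PR n → k) : (bM d M).det = ∏ i, (d i : k) := by
  rw [Matrix.det_of_isUpperTriangular (fun i j h => bM_gt d M i j h)]
  simp [bM_eq]

def bG (d : Fin n → kˣ) (M : PR n → k) : GLn n k :=
  Matrix.GeneralLinearGroup.mkOfDetNeZero (bM d M) (by
    rw [bM_det, Finset.prod_ne_zero_iff]; intro i _; exact (d i).ne_zero)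

lemma bG_val (d : Fin n → kˣ) (M : PR n → k) : (bG d M : Matrix (Fin n) (Fin n) k) = bM d M := rfl

lemma bG_up (d : Fin n → kˣ) (M : PR n → k) : IsUp (bG d M) := fun i j h => bM_gt d M i j h

def bEq : (Fin n → kˣ) × (PR n → k) ≃ {x : GLn n k // IsUp x} where
  toFun p := ⟨bG p.1 p.2, bG_up _ _⟩
  invFun x := (fun i => Units.mk0 _ (up_diag_ne x.1 x.2 i), fun p => (x.1 : Matrix (Fin n) (Fin n) k) p.1.1 p.1.2)
  left_inv p := by
    apply Prod.ext
    · funext i; ext; simp [bG_val, bM_eq]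
    · funext q; simp [bG_val, bM_lt _ _ _ _ q.2]
  right_inv x := by
    apply Subtype.ext
    ext i j
    simp only [bG_val]
    rcases lt_trichotomy i j with h | h | h
    · rw [bM_lt _ _ _ _ h]
    · subst h; rw [bM_eq]; rfl
    · rw [bM_gt _ _ _ _ h, x.2 i j h]

def dch (ϱ : kˣ →* Rˣ) (g : GLn n k) : R := ((ϱ (Matrix.GeneralLinearGroup.det g) : Rˣ) : R)

lemma dch_mul (ϱ : kˣ →* Rˣ) (g h : GLn n k) : dch ϱ (g * h) = dch ϱ g * dch ϱ h := by
  simp [dch]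

lemma dch_one (g : GLn n k) : dch (1 : kˣ →* Rˣ) g = 1 := by simp [dch]

lemma dch_of_det (ϱ : kˣ →* Rˣ) (g : GLn n k) (h : (g : Matrix (Fin n) (Fin n) k).det = 1) : dch ϱ g = 1 := by
  have : Matrix.GeneralLinearGroup.det g = 1 := by ext; simpa using h
  simp [dch, this]

lemma uni_det (g : GLn n k) (hg : IsUni g) : (g : Matrix (Fin n) (Fin n) k).det = 1 := by
  rw [up_det g hg.1]; simp [hg.2]

lemma bG_uni (M : PR n → k) : IsUni (bG 1 M) := ⟨bG_up _ _, fun i => by rw [bG_val, bM_eq]; simp⟩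

/-- left equivariance under B -/
def BInv (ϱ : kˣ →* Rˣ) (f : GLn n k → R) : Prop :=
  ∀ b, IsUp b → ∀ g, f (b * g) = dch ϱ b * f g

lemma q_ne (hqR : (Fintype.card k : R) ≠ 0) (m : ℕ) : (Fintype.card k : R) ^ m ≠ 0 := pow_ne_zero _ hqR

variable (ψ : AddChar k R) (hψ : ψ.IsPrimitive)

def trp (x : GLn n k) : R := ψ (Matrix.trace (x : Matrix (Fin n) (Fin n) k))

lemma sum_prod_pi {ι : Type} [Fintype ι] [DecidableEq ι] {κ : Type} [Fintype κ] (f : ι → κ → R) :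
    ∑ M : ι → κ, ∏ p, f p (M p) = ∏ p, ∑ t, f p t := by
  rw [Finset.prod_univ_sum]; simp

lemma trace_bG_mul (M : PR n → k) (y : GLn n k) :
    Matrix.trace ((bG 1 M * y : GLn n k) : Matrix (Fin n) (Fin n) k)
      = Matrix.trace (y : Matrix (Fin n) (Fin n) k)
        + ∑ p : PR n, M p * (y : Matrix (Fin n) (Fin n) k) p.1.2 p.1.1 := by
  have h1 : (bG 1 M : Matrix (Fin n) (Fin n) k) = 1 + (bM 1 M - 1) := by rw [bG_val]; abel
  rw [Units.val_mul, h1, add_mul, one_mul, Matrix.trace_add]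
  congr 1
  simp only [Matrix.trace, Matrix.diag, Matrix.mul_apply]
  rw [← Fintype.sum_prod_type' (f := fun (i j : Fin n) => (bM 1 M - 1) i j * (y : Matrix (Fin n) (Fin n) k) j i)]
  have h2 : ∀ q : Fin n × Fin n, ¬ q.1 < q.2 → (bM 1 M - 1) q.1 q.2 = 0 := by
    rintro ⟨i, j⟩ hq
    simp only [not_lt] at hq
    rcases hq.eq_or_lt with h | h
    · have h' : j = i := h
      subst h'
      simp [bM_eq]
    · simp [bM_gt _ _ _ _ h, Matrix.one_apply_ne (ne_of_gt h)]
  rw [← Finset.sum_filter_of_ne (p := fun q : Fin n × Fin n => q.1 < q.2)]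
  · rw [Finset.sum_subtype (p := fun q : Fin n × Fin n => q.1 < q.2) _ (by simp)]
    apply Finset.sum_congr rfl
    rintro ⟨⟨i, j⟩, hp⟩ _
    simp only at hp
    simp [bM_lt _ _ _ _ hp, Matrix.one_apply_ne (ne_of_lt hp)]
  · intro q _ hq
    by_contra h
    rw [h2 q h, zero_mul] at hq
    exact hq rfl

lemma ach_sum {ι : Type} (s : Finset ι) (f : ι → k) : ψ (∑ i ∈ s, f i) = ∏ i ∈ s, ψ (f i) := by
  induction s using Finset.induction_on with
  | empty => simp
  | insert a s ha ih => rw [Finset.sum_insert ha, Finset.prod_insert ha, AddChar.map_add_eq_mul, ih]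

lemma sum_unip (hψ : ψ.IsPrimitive) (y : GLn n k) :
    ∑ M : PR n → k, trp ψ (bG 1 M * y) = if IsUp y then (Fintype.card k : R) ^ Fintype.card (PR n) * trp ψ y else 0 := by
  have : ∀ M : PR n → k, trp ψ (bG 1 M * y) = trp ψ y * ∏ p : PR n, ψ (M p * (y : Matrix (Fin n) (Fin n) k) p.1.2 p.1.1) := by
    intro M
    rw [trp, trace_bG_mul, AddChar.map_add_eq_mul, ach_sum]; rfl
  simp only [this]
  rw [← Finset.mul_sum, sum_prod_pi (fun (p : PR n) (t : k) => ψ (t * (y : Matrix (Fin n) (Fin n) k) p.1.2 p.1.1))]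
  simp only [AddChar.sum_mulShift _ hψ]
  split_ifs with h
  · rw [Finset.prod_congr rfl (g := fun _ => (Fintype.card k : R))]
    · simp [mul_comm]
    · intro p _
      rw [if_pos (h _ _ p.2)]
  · unfold IsUp at h
    push_neg at h
    obtain ⟨i, j, hij, hne⟩ := h
    rw [Finset.prod_eq_zero (Finset.mem_univ (⟨(j, i), hij⟩ : PR n)), mul_zero]
    simp [hne]

def gs (ϱ : kˣ →* Rˣ) : R := ∑ a : kˣ, ψ a * (ϱ a : R)

def gam (n : ℕ) (ϱ : kˣ →* Rˣ) : R := (Fintype.card k : R) ^ Fintype.card (PR n) * gs ψ ϱ ^ n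

lemma sum_borel (ϱ : kˣ →* Rˣ) :
    ∑ x : GLn n k, (if IsUp x then trp ψ x * dch ϱ x else 0) = gam ψ n ϱ := by
  rw [← Finset.sum_filter]
  rw [Finset.sum_subtype (p := IsUp) _ (by simp) (fun x => trp ψ x * dch ϱ x)]
  rw [← Equiv.sum_comp bEq, Fintype.sum_prod_type]
  have : ∀ (d : Fin n → kˣ) (M : PR n → k), trp ψ (bEq (d, M)).1 * dch ϱ (bEq (d, M)).1
      = ∏ i, (ψ (d i) * (ϱ (d i) : R)) := by
    intro d M
    have h1 : trp ψ (bEq (d, M)).1 = ∏ i, ψ (d i) := by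
      simp only [trp, bEq, Equiv.coe_fn_mk, bG_val, Matrix.trace, Matrix.diag, bM_eq]
      rw [ach_sum]
    have h2 : Matrix.GeneralLinearGroup.det (bG d M) = ∏ i, d i := by
      ext
      rw [Matrix.GeneralLinearGroup.val_det_apply, bG_val, bM_det]; simp
    have h3 : dch ϱ (bEq (d, M)).1 = ∏ i, (ϱ (d i) : R) := by
      simp only [dch, bEq, Equiv.coe_fn_mk, h2, map_prod, Units.coe_prod]
    rw [h1, h3, Finset.prod_mul_distrib]
  simp only [this]
  simp only [Finset.sum_const, Finset.card_univ, Fintype.card_fun, nsmul_eq_mul]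
  rw [← Finset.mul_sum, sum_prod_pi (fun (_ : Fin n) (a : kˣ) => ψ a * (ϱ a : R))]
  simp [gam, gs]

lemma gauss_fun (hψ : ψ.IsPrimitive) (hqR : (Fintype.card k : R) ≠ 0) (ϱ : kˣ →* Rˣ) (f : GLn n k → R) (hf : BInv ϱ f) (g : GLn n k) :
    ∑ x : GLn n k, trp ψ x * f (x * g) = gam ψ n ϱ * f g := by
  apply mul_left_cancel₀ (q_ne hqR (Fintype.card (PR n)))
  have h1 : ∀ M : PR n → k, ∑ x : GLn n k, trp ψ x * f (x * g) = ∑ x : GLn n k, trp ψ (bG 1 M * x) * f (x * g) := by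
    intro M
    rw [← Equiv.sum_comp (Equiv.mulLeft (bG 1 M))]
    apply Finset.sum_congr rfl
    intro x _
    simp only [Equiv.coe_mulLeft]
    rw [mul_assoc, hf _ (bG_up _ _), dch_of_det _ _ (uni_det _ (bG_uni M)), one_mul]
  have h2 : ∑ M : PR n → k, ∑ x : GLn n k, trp ψ x * f (x * g) = ∑ M : PR n → k, ∑ x : GLn n k, trp ψ (bG 1 M * x) * f (x * g) :=
    Finset.sum_congr rfl (fun M _ => h1 M)
  rw [Finset.sum_const, Finset.card_univ, Fintype.card_fun, nsmul_eq_mul, Nat.cast_pow, Finset.sum_comm] at h2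
  rw [h2, ← sum_borel, Finset.sum_mul, Finset.mul_sum]
  apply Finset.sum_congr rfl
  intro x _
  rw [← Finset.sum_mul, sum_unip ψ hψ]
  split_ifs with h
  · rw [hf x h]; ring
  · simp

lemma trp_conj (g x : GLn n k) : trp ψ (g * x * g⁻¹) = trp ψ x := by
  simp only [trp, Units.val_mul]
  rw [Matrix.trace_mul_comm, ← mul_assoc]; simp

lemma gauss_fun' (hψ : ψ.IsPrimitive) (hqR : (Fintype.card k : R) ≠ 0) (ϱ : kˣ →* Rˣ) (f : GLn n k → R) (hf : BInv ϱ f) :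
    ∑ x : GLn n k, trp ψ x • regRep R (GLn n k) x f = gam ψ n ϱ • f := by
  funext g
  simp only [Finset.sum_apply, Pi.smul_apply, smul_eq_mul, regRep_apply]
  rw [← gauss_fun ψ hψ hqR ϱ f hf, ← Equiv.sum_comp (MulAut.conj g).symm.toEquiv]
  apply Finset.sum_congr rfl
  intro x _
  have : (MulAut.conj g).symm.toEquiv x = g⁻¹ * x * g := by simp
  rw [this]
  congr 1
  · have := trp_conj ψ g⁻¹ x
    rwa [inv_inv] at this
  · congr 1; group

lemma gauss_one (hψ : ψ.IsPrimitive) (hqR : (Fintype.card k : R) ≠ 0) :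
    ∑ x : GLn n k, trp ψ x = gam ψ n 1 := by
  have := gauss_fun ψ hψ hqR (1 : kˣ →* Rˣ) (fun _ : GLn n k => (1 : R)) (fun b _ g => by simp [dch_one]) 1
  simpa using this

lemma gs_one (hψ : ψ.IsPrimitive) : gs ψ 1 = -1 := by
  have h0 : ∑ a : k, ψ a = 0 := by
    have := AddChar.sum_mulShift (1 : k) hψ
    simpa using this
  have h1 : ∑ a : k, ψ a = ψ 0 + ∑ a : kˣ, ψ a := by
    rw [← Finset.add_sum_erase _ _ (Finset.mem_univ (0:k))]
    congr 1
    rw [Finset.sum_subtype (p := fun a : k => a ≠ 0) _ (by simp) (fun x => ψ x)]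
    exact (Equiv.sum_comp unitsEquivNeZero (fun a : {a : k // a ≠ 0} => ψ a)).symm
  rw [h0] at h1
  simp only [gs, MonoidHom.one_apply, Units.val_one, mul_one]
  rw [AddChar.map_zero_eq_one] at h1
  linear_combination -h1

lemma card_PR (n : ℕ) : 2 * Fintype.card (PR n) + n = n * n := by
  have e : Fintype.card (Fin n × Fin n) = n * n := by simp
  have h1 : Fintype.card (Fin n × Fin n) = ∑ q : Fin n × Fin n, ((if q.1 < q.2 then 1 else 0) + (if q.2 < q.1 then 1 else 0) + if q.1 = q.2 then 1 else 0) := by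
    rw [← Finset.card_univ, Finset.card_eq_sum_ones]
    apply Finset.sum_congr rfl
    rintro ⟨i, j⟩ _
    rcases lt_trichotomy i j with h | h | h
    · simp [h, ne_of_lt h, not_lt_of_gt h]
    · simp [h]
    · simp [h, ne_of_gt h, not_lt_of_gt h]
  have h2 : ∑ q : Fin n × Fin n, (if q.1 < q.2 then 1 else 0) = Fintype.card (PR n) := by
    rw [Fintype.card_subtype, Finset.card_filter]
  have h3 : ∑ q : Fin n × Fin n, (if q.2 < q.1 then 1 else 0) = Fintype.card (PR n) := by
    rw [← h2, ← Equiv.sum_comp (Equiv.prodComm (Fin n) (Fin n))]; rfl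
  have h4 : ∑ q : Fin n × Fin n, (if q.1 = q.2 then 1 else 0) = n := by
    rw [Fintype.sum_prod_type]; simp
  rw [← e, h1, Finset.sum_add_distrib, Finset.sum_add_distrib, h2, h3, h4]
  ring

/-- subquotient of principal series -/
def Sub (ϱ : kˣ →* Rˣ) (W : Representation R (GLn n k) VW) : Prop :=
  ∃ (qs : Submodule R (GLn n k → R)) (hq : ∀ g, ∀ f ∈ qs, regRep R (GLn n k) g f ∈ qs) (φ : qs →ₗ[R] VW),
    Function.Surjective φ ∧ (∀ (g : GLn n k) (f : qs), φ ⟨regRep R (GLn n k) g f, hq g f f.2⟩ = W g (φ f)) ∧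
    ∀ f ∈ qs, BInv ϱ f

lemma op_mem {qs : Submodule R (GLn n k → R)} (hq : ∀ g, ∀ f ∈ qs, regRep R (GLn n k) g f ∈ qs) (c : GLn n k → R)
   (f : qs) : ∑ x, c x • regRep R (GLn n k) x (f : GLn n k → R) ∈ qs :=
  Submodule.sum_mem _ fun x _ => Submodule.smul_mem _ _ (hq x _ f.2)

lemma op_map {qs : Submodule R (GLn n k → R)} (hq : ∀ g, ∀ f ∈ qs, regRep R (GLn n k) g f ∈ qs) (φ : qs →ₗ[R] VW)
    (W : Representation R (GLn n k) VW)
    (he : ∀ (g : GLn n k) (f : qs), φ ⟨regRep R (GLn n k) g f, hq g f f.2⟩ = W g (φ f))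
    (c : GLn n k → R) (f : qs) : φ ⟨_, op_mem hq c f⟩ = ∑ x, c x • W x (φ f) := by
  have : (⟨_, op_mem hq c f⟩ : qs) = ∑ x, c x • (⟨regRep R (GLn n k) x f, hq x f f.2⟩ : qs) := by
    apply Subtype.ext
    simp
  rw [this, map_sum]
  apply Finset.sum_congr rfl
  intro x _
  rw [map_smul, he]

lemma gauss_op (hψ : ψ.IsPrimitive) (hqR : (Fintype.card k : R) ≠ 0) (ϱ : kˣ →* Rˣ) (W : Representation R (GLn n k) VW)
    (hs : Sub ϱ W) (v : VW) : ∑ x, trp ψ x • W x v = gam ψ n ϱ • v := by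
  obtain ⟨qs, hq, φ, hsur, he, hB⟩ := hs
  obtain ⟨f, rfl⟩ := hsur v
  rw [← op_map hq φ W he (trp ψ) f, ← map_smul]
  congr 1
  apply Subtype.ext
  simp only [Submodule.coe_smul]
  exact gauss_fun' ψ hψ hqR ϱ (f : GLn n k → R) (hB f f.2)

end St14
end
end

section
open scoped Classical
open scoped TensorProduct

noncomputable section

namespace St14

set_option linter.unusedSectionVars false
set_option linter.unusedSimpArgs false
set_option linter.unusedVariables false

variable {n : ℕ} {k : Type} [Field k] [Fintype k] {R : Type} [Field R]
variable {VW : Type} [AddCommGroup VW] [Module R VW]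

def NsEq : (PR n → k) ≃ Ns n k where
  toFun M := ⟨bG 1 M, bG_uni M⟩
  invFun x := fun p => (x.1 : Matrix (Fin n) (Fin n) k) p.1.1 p.1.2
  left_inv M := by
    funext q; simp [bG_val, bM_lt _ _ _ _ q.2]
  right_inv x := by
    apply Subtype.ext
    ext i j
    simp only [bG_val]
    rcases lt_trichotomy i j with h | h | h
    · rw [bM_lt _ _ _ _ h]
    · subst h; rw [bM_eq]; exact (x.2.2 i).symm
    · rw [bM_gt _ _ _ _ h]; exact (x.2.1 i j h).symm

lemma card_Ns : Nat.card (Ns n k) = Fintype.card k ^ Fintype.card (PR n) := by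
  rw [← Nat.card_congr NsEq]; simp

lemma card_unip (hqR : (Fintype.card k : R) ≠ 0) (K : Subgroup (GLn n k)) (hK : K ≤ Ns n k) :
    (Fintype.card K : R) ≠ 0 := by
  have h1 : Nat.card K ∣ Nat.card (Ns n k) := Subgroup.card_dvd_of_le hK
  rw [card_Ns, Nat.card_eq_fintype_card] at h1
  intro h0
  obtain ⟨m, hm⟩ := h1
  have : ((Fintype.card k ^ Fintype.card (PR n) : ℕ) : R) = 0 := by
    rw [hm, Nat.cast_mul, h0, zero_mul]
  rw [Nat.cast_pow] at this
  exact q_ne hqR _ this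

lemma UR_le (r : ℕ) : UR n k r ≤ Ns n k := by
  intro g hg
  have hg' : IsUR r g := hg
  refine ⟨fun i j h => ?_, fun i => ?_⟩
  · rw [hg' i j (by have : (j : ℕ) < i := h; omega), Matrix.one_apply_ne (ne_of_gt h)]
  · rw [hg' i i (by omega), Matrix.one_apply_eq]

variable (ψ : AddChar k R)

def Aop (W : Representation R (GLn n k) VW) (Y : Matrix (Fin n) (Fin n) k) (v : VW) : VW :=
  ∑ X : GLn n k, ψ (Matrix.trace ((X : Matrix (Fin n) (Fin n) k) * Y)) • W X v

lemma Aop_unit (hψ : ψ.IsPrimitive) (hqR : (Fintype.card k : R) ≠ 0) (ϱ : kˣ →* Rˣ)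
    (W : Representation R (GLn n k) VW) (hs : Sub ϱ W) (y : GLn n k) (v : VW) :
    Aop ψ W (y : Matrix (Fin n) (Fin n) k) v = gam ψ n ϱ • W y⁻¹ v := by
  rw [← gauss_op ψ hψ hqR ϱ W hs, Aop, ← Equiv.sum_comp (Equiv.mulRight y⁻¹)]
  apply Finset.sum_congr rfl
  intro x _
  simp only [Equiv.coe_mulRight]
  rw [rep_mul, ← Units.val_mul, inv_mul_cancel_right]; rfl

lemma Aop_mul (W : Representation R (GLn n k) VW) (Y : Matrix (Fin n) (Fin n) k) (x : GLn n k) (v : VW) :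
    Aop ψ W Y (W x v) = Aop ψ W ((x⁻¹ : GLn n k) * Y) v := by
  rw [Aop, Aop, ← Equiv.sum_comp (Equiv.mulRight x⁻¹)]
  apply Finset.sum_congr rfl
  intro X _
  simp only [Equiv.coe_mulRight]
  rw [← rep_mul, inv_mul_cancel_right, Units.val_mul, mul_assoc]

lemma Aop_sum {ι : Type} (s : Finset ι) (W : Representation R (GLn n k) VW) (Y : Matrix (Fin n) (Fin n) k) (v : ι → VW) :
    Aop ψ W Y (∑ i ∈ s, v i) = ∑ i ∈ s, Aop ψ W Y (v i) := by
  simp only [Aop, map_sum, Finset.smul_sum]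
  rw [Finset.sum_comm]

lemma Aop_J (hqR : (Fintype.card k : R) ≠ 0) 
    (W : Representation R (GLn n k) VW) (hW : Cusp W) (g : GLn n k) (Z : Matrix (Fin n) (Fin n) k) (r : ℕ) (hr : 0 < r) (hrn : r < n)
    (hZ : ∀ x : GLn n k, IsUR r x → (x : Matrix (Fin n) (Fin n) k) * Z = Z) (v : VW) :
    Aop ψ W ((g : Matrix (Fin n) (Fin n) k) * Z) v = 0 := by
  have h1 : ∀ u : UR n k r, Aop ψ W ((g : Matrix (Fin n) (Fin n) k) * Z) (W (g * u * g⁻¹) v) = Aop ψ W ((g : Matrix (Fin n) (Fin n) k) * Z) v := by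
    intro u
    rw [Aop_mul]
    congr 1
    have h2 : (((g * u * g⁻¹)⁻¹ : GLn n k) : Matrix (Fin n) (Fin n) k) = g * ((u⁻¹ : GLn n k) : Matrix (Fin n) (Fin n) k) * (g⁻¹ : GLn n k) := by
      rw [← Units.val_mul, ← Units.val_mul]; congr 1; group
    rw [h2]
    simp only [mul_assoc, Units.inv_mul_cancel_left]
    rw [hZ _ ((UR n k r).inv_mem u.2)]
  have h3 : Aop ψ W ((g : Matrix (Fin n) (Fin n) k) * Z) (∑ u : UR n k r, W (g * u * g⁻¹) v) = 0 := by
    rw [cusp_sum W hW r hr hrn]; simp [Aop]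
  rw [Aop_sum] at h3
  simp only [h1] at h3
  rw [Finset.sum_const, Finset.card_univ, ← Nat.cast_smul_eq_nsmul R] at h3
  exact (smul_eq_zero.1 h3).resolve_left (card_unip hqR _ (UR_le r))

lemma Aop_sing (hqR : (Fintype.card k : R) ≠ 0) (hn : 2 ≤ n)
    (W : Representation R (GLn n k) VW) (hW : Cusp W) (Y : Matrix (Fin n) (Fin n) k) (hY : ¬ IsUnit Y) (v : VW) :
    Aop ψ W Y v = 0 := by
  by_cases h0 : Y = 0
  · have := Aop_J ψ hqR W hW 1 0 1 (by omega) (by omega) (by simp) v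
    rw [mul_zero] at this
    rw [h0, this]
  · obtain ⟨g, h, r, hr, hrn, rfl⟩ := sing_nf Y hY h0
    rw [mul_assoc]
    apply Aop_J ψ hqR W hW g _ r hr hrn
    intro x hx
    rw [← mul_assoc, UR_mul_J r x hx]

/-- block subgroup attached to a two-colouring -/
def IsH (sd : Fin n → Bool) (g : GLn n k) : Prop := ∀ i j : Fin n, sd i ≠ sd j → (g : Matrix (Fin n) (Fin n) k) i j = 0

lemma isH_one (sd : Fin n → Bool) : IsH sd (1 : GLn n k) := by
  intro i j h
  exact Matrix.one_apply_ne (fun e => h (by rw [e]))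

lemma isH_mul (sd : Fin n → Bool) (g h : GLn n k) (hg : IsH sd g) (hh : IsH sd h) : IsH sd (g * h) := by
  intro i j hij
  rw [Units.val_mul, Matrix.mul_apply]
  apply Finset.sum_eq_zero
  intro c _
  by_cases h1 : sd i = sd c
  · rw [hh c j (by rw [← h1]; exact hij), mul_zero]
  · rw [hg i c h1, zero_mul]

def Hs (k : Type) [Field k] [Fintype k] (sd : Fin n → Bool) : Subgroup (GLn n k) :=
  subOf (IsH sd) (isH_one sd) (isH_mul sd)

lemma mem_Hs (sd : Fin n → Bool) (g : GLn n k) : g ∈ Hs k sd ↔ IsH sd g := Iff.rfl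

abbrev DP (sd : Fin n → Bool) := {p : Fin n × Fin n // sd p.1 ≠ sd p.2}

def IsO (sd : Fin n → Bool) (Y : Matrix (Fin n) (Fin n) k) : Prop := ∀ i j : Fin n, sd i = sd j → Y i j = 0

def offM (sd : Fin n → Bool) (Y : DP sd → k) : Matrix (Fin n) (Fin n) k :=
  Matrix.of fun (i j : Fin n) => if h : sd i ≠ sd j then Y ⟨(i, j), h⟩ else 0

lemma offM_ne (sd : Fin n → Bool) (Y : DP sd → k) (i j : Fin n) (h : sd i ≠ sd j) : offM sd Y i j = Y ⟨(i, j), h⟩ := by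
  simp [offM, h]
lemma offM_eq (sd : Fin n → Bool) (Y : DP sd → k) (i j : Fin n) (h : sd i = sd j) : offM sd Y i j = 0 := by
  simp [offM, h]

def offE (sd : Fin n → Bool) : (DP sd → k) ≃ {Y : Matrix (Fin n) (Fin n) k // IsO sd Y} where
  toFun Y := ⟨offM sd Y, fun i j h => offM_eq sd Y i j h⟩
  invFun Y := fun p => Y.1 p.1.1 p.1.2
  left_inv Y := by
    funext p; exact offM_ne sd Y _ _ p.2
  right_inv Y := by
    apply Subtype.ext
    ext i j
    by_cases h : sd i = sd j
    · simp only [offM_eq _ _ _ _ h]; exact (Y.2 i j h).symm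
    · simp only [offM_ne _ _ _ _ h]

lemma trace_off (sd : Fin n → Bool) (Y : DP sd → k) (X : Matrix (Fin n) (Fin n) k) :
    Matrix.trace (X * offM sd Y) = ∑ p : DP sd, Y p * X p.1.2 p.1.1 := by
  rw [Matrix.trace_mul_comm]
  simp only [Matrix.trace, Matrix.diag, Matrix.mul_apply]
  rw [← Fintype.sum_prod_type' (f := fun (i j : Fin n) => (offM sd Y) i j * X j i)]
  rw [← Finset.sum_filter_of_ne (p := fun q : Fin n × Fin n => sd q.1 ≠ sd q.2)]
  · rw [Finset.sum_subtype (p := fun q : Fin n × Fin n => sd q.1 ≠ sd q.2) _ (by simp)]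
    apply Finset.sum_congr rfl
    rintro ⟨⟨i, j⟩, hp⟩ _
    show offM sd Y i j * _ = _
    rw [offM_ne sd Y i j hp]
  · intro q _ hq
    by_contra h
    rw [offM_eq _ _ _ _ h, zero_mul] at hq
    exact hq rfl

lemma sum_off (hψ : ψ.IsPrimitive) (sd : Fin n → Bool) (X : GLn n k) :
    ∑ Y : DP sd → k, ψ (Matrix.trace ((X : Matrix (Fin n) (Fin n) k) * offM sd Y))
      = if IsH sd X then (Fintype.card k : R) ^ Fintype.card (DP sd) else 0 := by
  simp only [trace_off, ach_sum]
  rw [sum_prod_pi (fun (p : DP sd) (t : k) => ψ (t * (X : Matrix (Fin n) (Fin n) k) p.1.2 p.1.1))]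
  simp only [AddChar.sum_mulShift _ hψ]
  split_ifs with h
  · rw [Finset.prod_congr rfl (g := fun _ => (Fintype.card k : R))]
    · simp
    · intro p _
      rw [if_pos (h _ _ (Ne.symm p.2))]
  · unfold IsH at h
    push Not at h
    obtain ⟨i, j, hij, hne⟩ := h
    rw [Finset.prod_eq_zero (Finset.mem_univ (⟨(j, i), hij.symm⟩ : DP sd))]
    simp [hne]

lemma isO_iff (sd : Fin n → Bool) (σ : Equiv.Perm (Fin n)) (hσ : ∀ i, sd (σ i) = !(sd i)) (g : GLn n k) :
    IsO sd (((g * Pm k σ)⁻¹ : GLn n k) : Matrix (Fin n) (Fin n) k) ↔ IsH sd g := by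
  have h1 : IsH sd g ↔ IsH sd g⁻¹ := by rw [← mem_Hs, ← mem_Hs, inv_mem_iff]
  rw [h1, mul_inv_rev, Pm_inv, Units.val_mul, Pm_val]
  unfold IsO IsH
  constructor
  · intro h i j hij
    have := h (σ⁻¹ i) j (by
      have := hσ (σ⁻¹ i)
      rw [show σ (σ⁻¹ i) = i by simp] at this
      rw [this] at hij
      revert hij; cases sd (σ⁻¹ i) <;> cases sd j <;> simp)
    rw [PmM_mul_apply] at this
    simpa using this
  · intro h i j hij
    rw [PmM_mul_apply]
    apply h
    rw [inv_inv, hσ, hij]; simp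

lemma poisson (hψ : ψ.IsPrimitive) (hqR : (Fintype.card k : R) ≠ 0) (hn : 2 ≤ n) (ϱ : kˣ →* Rˣ)
    (W : Representation R (GLn n k) VW) (hs : Sub ϱ W) (hW : Cusp W)
    (sd : Fin n → Bool) (σ : Equiv.Perm (Fin n)) (hσ : ∀ i, sd (σ i) = !(sd i)) (v : VW) :
    ((Fintype.card k : R) ^ Fintype.card (DP sd)) • ∑ h : Hs k sd, W h v
      = gam ψ n ϱ • ∑ h : Hs k sd, W (h * Pm k σ) v := by
  have h1 : ∑ Y : DP sd → k, Aop ψ W (offM sd Y) v = ((Fintype.card k : R) ^ Fintype.card (DP sd)) • ∑ h : Hs k sd, W h v := by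
    simp only [Aop]
    rw [Finset.sum_comm]
    simp only [← Finset.sum_smul, sum_off ψ hψ]
    simp only [ite_smul, zero_smul]
    rw [← Finset.sum_filter, ← Finset.smul_sum]
    congr 1
    exact Finset.sum_subtype (p := fun g => g ∈ Hs k sd) _ (by simp [mem_Hs]) (fun x => W x v)
  rw [← h1]
  have h2 : ∑ Y : DP sd → k, Aop ψ W (offM sd Y) v = ∑ Y : {Y : Matrix (Fin n) (Fin n) k // IsO sd Y}, Aop ψ W Y v := by
    rw [← Equiv.sum_comp (offE sd)]; rfl
  have h3 : ∑ Y : {Y : Matrix (Fin n) (Fin n) k // IsO sd Y}, Aop ψ W Y v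
     = ∑ Y : Matrix (Fin n) (Fin n) k, if IsO sd Y then Aop ψ W Y v else 0 := by
    rw [← Finset.sum_filter, Finset.sum_subtype (p := fun Y : Matrix (Fin n) (Fin n) k => IsO sd Y) _ (by simp)]
  have h4 : ∑ Y : Matrix (Fin n) (Fin n) k, (if IsO sd Y then Aop ψ W Y v else 0)
      = ∑ y : GLn n k, if IsO sd (y : Matrix (Fin n) (Fin n) k) then Aop ψ W y v else 0 := by
    rw [← Finset.sum_filter_of_ne (p := fun Y : Matrix (Fin n) (Fin n) k => IsUnit Y)]
    · symm
      apply Finset.sum_bij (fun (y : GLn n k) _ => (y : Matrix (Fin n) (Fin n) k))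
      · intro y _; simp
      · intro a _ b _ h; exact Units.ext h
      · intro Y hY
        simp only [Finset.mem_filter, Finset.mem_univ, true_and] at hY
        obtain ⟨y, rfl⟩ := hY
        exact ⟨y, Finset.mem_univ _, rfl⟩
      · intro y _; rfl
    · intro Y _ hY
      by_contra h
      rw [Aop_sing ψ hqR hn W hW Y h] at hY
      simp at hY
  rw [h2, h3, h4]
  simp only [Aop_unit ψ hψ hqR ϱ W hs]
  rw [← Equiv.sum_comp ((Equiv.mulRight (Pm k σ)).trans (Equiv.inv (GLn n k)))]
  simp only [Equiv.trans_apply, Equiv.coe_mulRight, Equiv.inv_apply, isO_iff sd σ hσ, inv_inv]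
  rw [← Finset.sum_filter, ← Finset.smul_sum]
  congr 1
  exact Finset.sum_subtype (p := fun g => g ∈ Hs k sd) _ (by simp [mem_Hs]) (fun x => W (x * Pm k σ) v)

lemma card_DP (sd : Fin n → Bool) (σ : Equiv.Perm (Fin n)) (hσ : ∀ i, sd (σ i) = !(sd i)) :
    2 * Fintype.card (DP sd) = n * n := by
  have e : Fintype.card (Fin n × Fin n) = n * n := by simp
  have h1 : Fintype.card (Fin n × Fin n) = ∑ q : Fin n × Fin n, ((if sd q.1 ≠ sd q.2 then 1 else 0) + (if sd q.1 = sd q.2 then 1 else 0)) := by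
    rw [← Finset.card_univ, Finset.card_eq_sum_ones]
    apply Finset.sum_congr rfl
    rintro ⟨i, j⟩ _
    by_cases h : sd i = sd j <;> simp [h]
  have h2 : ∑ q : Fin n × Fin n, (if sd q.1 ≠ sd q.2 then 1 else 0) = Fintype.card (DP sd) := by
    rw [Fintype.card_subtype, Finset.card_filter]
  have h3 : ∑ q : Fin n × Fin n, (if sd q.1 = sd q.2 then 1 else 0) = Fintype.card (DP sd) := by
    rw [← h2, ← Equiv.sum_comp (Equiv.prodCongr σ (Equiv.refl (Fin n)))]
    apply Finset.sum_congr rfl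
    rintro ⟨i, j⟩ _
    simp only [Equiv.prodCongr_apply, Prod.map_apply, Equiv.refl_apply, hσ]
    cases sd i <;> cases sd j <;> simp
  rw [← e, h1, Finset.sum_add_distrib, h2, h3]
  ring

end St14
end
end

section
open scoped Classical
open scoped TensorProduct

noncomputable section

namespace St14

set_option linter.unusedSectionVars false
set_option linter.unusedSimpArgs false
set_option linter.unusedVariables false

variable {n : ℕ} {k : Type} [Field k] 

lemma perm_ind (P : Equiv.Perm (Fin n) → Prop) (h1 : P 1)
    (hs : ∀ i j : Fin n, (i : ℕ) + 1 = j → ∀ τ, P τ → P (Equiv.swap i j * τ)) (τ : Equiv.Perm (Fin n)) : P τ := by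
  rcases n with _ | m
  · rw [Subsingleton.elim τ 1]; exact h1
  · have : τ ∈ Submonoid.closure (Set.range fun i : Fin m ↦ Equiv.swap i.castSucc i.succ) := by
      rw [Equiv.Perm.mclosure_swap_castSucc_succ]; trivial
    induction this using Submonoid.closure_induction_left with
    | one => exact h1
    | mul_left x hx y hy ih =>
      obtain ⟨i, rfl⟩ := hx
      exact hs _ _ (by simp) _ ih

/-- root elements -/
def xr (i j : Fin n) (h : i ≠ j) (t : k) : GLn n k where
  val := Matrix.transvection i j t
  inv := Matrix.transvection i j (-t)
  val_inv := by rw [Matrix.transvection_mul_transvection_same _ _ h]; simp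
  inv_val := by rw [Matrix.transvection_mul_transvection_same _ _ h]; simp

lemma xr_val (i j : Fin n) (h : i ≠ j) (t : k) : (xr i j h t : Matrix (Fin n) (Fin n) k) = Matrix.transvection i j t := rfl

lemma xr_apply (i j : Fin n) (h : i ≠ j) (t : k) (a b : Fin n) : (xr i j h t : Matrix (Fin n) (Fin n) k) a b
    = (1 : Matrix (Fin n) (Fin n) k) a b + if a = i ∧ b = j then t else 0 := by
  rw [xr_val, Matrix.transvection, Matrix.add_apply, Matrix.single_apply]
  congr 1
  exact if_congr (and_congr eq_comm eq_comm) rfl rfl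

lemma xr_mul (i j : Fin n) (h : i ≠ j) (s t : k) : xr i j h s * xr i j h t = xr i j h (s + t) := by
  ext1; exact Matrix.transvection_mul_transvection_same _ _ h _ _

lemma xr_zero (i j : Fin n) (h : i ≠ j) : xr i j h (0 : k) = 1 := by
  ext1; exact Matrix.transvection_zero _ _

lemma xr_inv (i j : Fin n) (h : i ≠ j) (t : k) : (xr i j h t)⁻¹ = xr i j h (-t) := by
  rw [inv_eq_iff_mul_eq_one, xr_mul, add_neg_cancel, xr_zero]

lemma mul_xr_same (A : Matrix (Fin n) (Fin n) k) (i j : Fin n) (h : i ≠ j) (t : k) (a : Fin n) :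
    (A * (xr i j h t : Matrix (Fin n) (Fin n) k)) a j = A a j + t * A a i := by
  rw [xr_val]; exact Matrix.mul_transvection_apply_same _ _ _ _ _

lemma mul_xr_ne (A : Matrix (Fin n) (Fin n) k) (i j : Fin n) (h : i ≠ j) (t : k) (a b : Fin n) (hb : b ≠ j) :
    (A * (xr i j h t : Matrix (Fin n) (Fin n) k)) a b = A a b := by
  rw [xr_val]; exact Matrix.mul_transvection_apply_of_ne _ _ _ _ hb _ _

variable [Fintype k]

lemma xr_uni (i j : Fin n) (h : i < j) (t : k) : IsUni (xr i j (ne_of_lt h) t) := by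
  constructor
  · intro a b hab
    rw [xr_apply, Matrix.one_apply_ne (ne_of_gt hab), if_neg, add_zero]
    rintro ⟨rfl, rfl⟩
    exact absurd h (not_lt_of_gt hab)
  · intro a
    rw [xr_apply, Matrix.one_apply_eq, if_neg, add_zero]
    rintro ⟨rfl, h'⟩
    exact absurd h' (ne_of_lt h)

lemma Pm_xr (σ : Equiv.Perm (Fin n)) (i j : Fin n) (h : i ≠ j) (t : k) :
    xr i j h t * Pm k σ = Pm k σ * xr (σ⁻¹ i) (σ⁻¹ j) (by simpa using h) t := by
  ext a b
  rw [Units.val_mul, Units.val_mul, Pm_val, mul_PmM_apply, PmM_mul_apply, xr_apply, xr_apply]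
  congr 1
  · rw [← PmM_apply, ← mul_one (PmM k σ), PmM_mul_apply]
  · have h1 : (σ b = j) ↔ (b = σ⁻¹ j) := by
      rw [Equiv.Perm.eq_inv_iff_eq]
    simp [h1]

lemma swap_up (i j : Fin n) (hij : (i : ℕ) + 1 = j) (c : GLn n k) (hc : IsUp c)
    (h0 : (c : Matrix (Fin n) (Fin n) k) i j = 0) : IsUp (Pm k (Equiv.swap i j) * c * Pm k (Equiv.swap i j)) := by
  intro a b hab
  rw [Units.val_mul, Units.val_mul, Pm_val, mul_PmM_apply, PmM_mul_apply, Equiv.swap_inv]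
  by_cases h1 : a = j ∧ b = i
  · obtain ⟨rfl, rfl⟩ := h1
    simpa using h0
  · apply hc
    have hab' : (b : ℕ) < a := hab
    show ((Equiv.swap i j b : Fin n) : ℕ) < (Equiv.swap i j a : Fin n)
    rw [Equiv.swap_apply_def, Equiv.swap_apply_def]
    simp only [Fin.ext_iff] at *
    split_ifs <;> omega

lemma Pm_swap_sq (i j : Fin n) : Pm k (Equiv.swap i j) * Pm k (Equiv.swap i j) = 1 := by
  rw [← Pm_mul, Equiv.swap_mul_self, Pm_one]

lemma adj_lt {i j : Fin n} (hij : (i : ℕ) + 1 = j) : i < j := by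
  show (i : ℕ) < j; omega

/-- the elements y_t -/
def yt (i j : Fin n) (hij : (i : ℕ) + 1 = j) (t : k) : GLn n k :=
  Pm k (Equiv.swap i j) * xr i j (ne_of_lt (adj_lt hij)) t

lemma swap_mul_up (i j : Fin n) (hij : (i : ℕ) + 1 = j) (b : GLn n k) (hb : IsUp b) :
    ∃ (b' : GLn n k) (t : k), IsUp b' ∧ Pm k (Equiv.swap i j) * b = b' * yt i j hij t := by
  set x : k → GLn n k := xr i j (ne_of_lt (adj_lt hij)) with hx
  let t : k := (b : Matrix (Fin n) (Fin n) k) i j / (b : Matrix (Fin n) (Fin n) k) i i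
  refine ⟨Pm k (Equiv.swap i j) * (b * x (-t)) * Pm k (Equiv.swap i j), t, ?_, ?_⟩
  · apply swap_up i j hij
    · exact isUp_mul _ _ hb (xr_uni i j (adj_lt hij) _).1
    · rw [Units.val_mul, hx, mul_xr_same]
      simp only [t]
      have := up_diag_ne b hb i
      field_simp
      ring
  · rw [yt, ← hx]
    have h1 := Pm_swap_sq (k := k) i j
    have h2 : x (-t) * x t = 1 := by rw [hx, xr_mul, neg_add_cancel, xr_zero]
    calc Pm k (Equiv.swap i j) * b = Pm k (Equiv.swap i j) * b * (x (-t) * x t) := by rw [h2, mul_one]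
      _ = Pm k (Equiv.swap i j) * b * x (-t) * (Pm k (Equiv.swap i j) * Pm k (Equiv.swap i j)) * x t := by rw [h1]; simp [mul_assoc]
      _ = _ := by simp only [mul_assoc]

lemma yt_low (i j : Fin n) (hij : (i : ℕ) + 1 = j) (t : k) (ht : t ≠ 0) :
    IsUp (yt i j hij t * xr j i (ne_of_gt (adj_lt hij)) (-t⁻¹)) := by
  have hlt := adj_lt hij
  have key : ∀ a b : Fin n, ((yt i j hij t : GLn n k) : Matrix (Fin n) (Fin n) k) a b
      = (1 : Matrix (Fin n) (Fin n) k) (Equiv.swap i j a) b + if (Equiv.swap i j a) = i ∧ b = j then t else 0 := by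
    intro a b
    rw [yt, Units.val_mul, Pm_val, PmM_mul_apply, xr_apply, Equiv.swap_inv]
  intro a b hab
  rw [Units.val_mul]
  by_cases hb : b = i
  · subst hb
    rw [mul_xr_same, key, key]
    by_cases ha : a = j
    · subst ha
      rw [Equiv.swap_apply_right]
      simp [ne_of_lt hlt, Matrix.one_apply_ne (ne_of_lt hlt), ht]
    · have hs : Equiv.swap b j a = a := Equiv.swap_apply_of_ne_of_ne (ne_of_gt hab) ha
      rw [hs]
      simp [Matrix.one_apply_ne (ne_of_gt hab), Matrix.one_apply_ne ha, ne_of_gt hab]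
  · rw [mul_xr_ne _ _ _ _ _ _ _ hb, key]
    have hab' : (b : ℕ) < a := hab
    have hne : Equiv.swap i j a ≠ b := by
      rw [Equiv.swap_apply_def]
      simp only [Fin.ext_iff] at *
      split_ifs <;> omega
    rw [Matrix.one_apply_ne hne, if_neg, add_zero]
    rintro ⟨h1, rfl⟩
    have : a = b := by
      have := congrArg (Equiv.swap i b) h1
      simpa using this
    exact absurd this (ne_of_gt hab)

def Bru (g : GLn n k) : Prop := ∃ (b : GLn n k) (σ : Equiv.Perm (Fin n)) (m : GLn n k), IsUp b ∧ IsUni m ∧ g = b * Pm k σ * m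

lemma bru_up (b g : GLn n k) (hb : IsUp b) (hg : Bru g) : Bru (b * g) := by
  obtain ⟨b', σ, m, h1, h2, rfl⟩ := hg
  exact ⟨b * b', σ, m, isUp_mul _ _ hb h1, h2, by simp only [mul_assoc]⟩

lemma bru_swap (i j : Fin n) (hij : (i : ℕ) + 1 = j) (g : GLn n k) (hg : Bru g) : Bru (Pm k (Equiv.swap i j) * g) := by
  obtain ⟨b, σ, m, h1, h2, rfl⟩ := hg
  obtain ⟨b', t, hb', he⟩ := swap_mul_up i j hij b h1
  have hne : σ⁻¹ i ≠ σ⁻¹ j := by simpa using ne_of_lt (adj_lt hij)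
  rw [← mul_assoc, ← mul_assoc, he]
  rw [mul_assoc, mul_assoc]
  apply bru_up _ _ hb'
  by_cases hlt : σ⁻¹ i < σ⁻¹ j
  · refine ⟨1, Equiv.swap i j * σ, xr (σ⁻¹ i) (σ⁻¹ j) hne t * m, isUp_one, isUni_mul _ _ (xr_uni _ _ hlt _) h2, ?_⟩
    rw [yt, one_mul, Pm_mul, ← mul_assoc, mul_assoc (Pm k (Equiv.swap i j)), Pm_xr]
    simp only [mul_assoc]
  · have hgt : σ⁻¹ j < σ⁻¹ i := lt_of_le_of_ne (not_lt.1 hlt) hne.symm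
    by_cases ht : t = 0
    · subst ht
      refine ⟨1, Equiv.swap i j * σ, m, isUp_one, h2, ?_⟩
      rw [yt, xr_zero, Pm_mul]; simp [mul_assoc]
    · refine ⟨_, σ, xr (σ⁻¹ j) (σ⁻¹ i) hne.symm t⁻¹ * m, yt_low i j hij t ht, isUni_mul _ _ (xr_uni _ _ hgt _) h2, ?_⟩
      have h3 : xr j i (ne_of_gt (adj_lt hij)) (-t⁻¹) * xr j i (ne_of_gt (adj_lt hij)) (t⁻¹) = 1 := by
        rw [xr_mul, neg_add_cancel, xr_zero]
      have h4 := Pm_xr σ j i (ne_of_gt (adj_lt hij)) t⁻¹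
      calc yt i j hij t * (Pm k σ * m) = yt i j hij t * (xr j i (ne_of_gt (adj_lt hij)) (-t⁻¹) * xr j i (ne_of_gt (adj_lt hij)) (t⁻¹)) * Pm k σ * m := by
            rw [h3]; simp [mul_assoc]
        _ = yt i j hij t * xr j i (ne_of_gt (adj_lt hij)) (-t⁻¹) * (xr j i (ne_of_gt (adj_lt hij)) (t⁻¹) * Pm k σ) * m := by
            simp only [mul_assoc]
        _ = _ := by rw [h4]; simp only [mul_assoc]

lemma bru_perm (τ : Equiv.Perm (Fin n)) : ∀ g : GLn n k, Bru g → Bru (Pm k τ * g) := by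
  apply perm_ind (fun τ => ∀ g : GLn n k, Bru g → Bru (Pm k τ * g))
  · intro g hg; rwa [Pm_one, one_mul]
  · intro i j hij τ h g hg
    rw [Pm_mul, mul_assoc]
    exact bru_swap i j hij _ (h g hg)

lemma bruhat (g : GLn n k) : Bru g := by
  have main : ∀ M : Matrix (Fin n) (Fin n) k, M.det ≠ 0 → ∀ g : GLn n k, (g : Matrix (Fin n) (Fin n) k) = M → ∀ x, Bru x → Bru (g * x) := by
    intro M hM
    refine Matrix.diagonal_transvection_induction_of_det_ne_zero
      (fun M => ∀ g : GLn n k, (g : Matrix (Fin n) (Fin n) k) = M → ∀ x, Bru x → Bru (g * x)) M hM ?_ ?_ ?_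
    · intro D hD g hg x hx
      apply bru_up _ _ _ hx
      intro i j hij
      rw [hg, Matrix.diagonal_apply_ne _ (ne_of_gt hij)]
    · rintro ⟨i, j, h, t⟩ g hg x hx
      have hg' : g = xr i j h t := by ext1; exact hg
      subst hg'
      by_cases hlt : i < j
      · exact bru_up _ _ (xr_uni i j hlt t).1 hx
      · have hgt : j < i := lt_of_le_of_ne (not_lt.1 hlt) h.symm
        have h1 := Pm_xr (Equiv.swap i j) j i h.symm t
        have h2 : xr i j h t = Pm k (Equiv.swap i j) * xr j i h.symm t * Pm k (Equiv.swap i j) := by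
          rw [mul_assoc, h1, ← mul_assoc, Pm_swap_sq, one_mul]
          simp
        rw [h2, mul_assoc, mul_assoc]
        apply bru_perm
        apply bru_up _ _ (xr_uni j i hgt t).1
        apply bru_perm _ _ hx
    · intro A B hA hB ihA ihB g hg x hx
      let a : GLn n k := Matrix.GeneralLinearGroup.mkOfDetNeZero A hA
      let b : GLn n k := Matrix.GeneralLinearGroup.mkOfDetNeZero B hB
      have : g = a * b := by ext1; rw [hg]; rfl
      rw [this, mul_assoc]
      exact ihA a rfl _ (ihB b rfl _ hx)
  have h1 : (g : Matrix (Fin n) (Fin n) k).det ≠ 0 := ((Matrix.isUnit_iff_isUnit_det _).1 (Units.isUnit g)).ne_zero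
  have := main _ h1 g rfl 1 ⟨1, 1, 1, isUp_one, isUni_one, by simp [Pm_one]⟩
  rwa [mul_one] at this

end St14
end
end

section
open scoped Classical
open scoped TensorProduct

noncomputable section

namespace St14

set_option linter.unusedSectionVars false
set_option linter.unusedSimpArgs false
set_option linter.unusedVariables false

variable {n : ℕ} {k : Type} [Field k] [Fintype k] {R : Type} [Field R]

lemma perm_le (σ : Equiv.Perm (Fin n)) (h : ∀ j, σ j ≤ j) : σ = 1 := by
  have key : ∀ m : ℕ, ∀ j : Fin n, (j : ℕ) = m → σ j = j := by
    intro m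
    induction m using Nat.strong_induction_on with
    | _ m ih =>
      intro j hj
      by_contra hne
      have hlt : σ j < j := lt_of_le_of_ne (h j) hne
      have h1 := ih (σ j : ℕ) (by rw [← hj]; exact hlt) (σ j) rfl
      exact hne (σ.injective h1)
  ext j
  rw [key j j rfl]; rfl

lemma perm_rev (σ : Equiv.Perm (Fin n)) (h : ∀ i j : Fin n, (i : ℕ) + 1 = j → σ j < σ i) : σ = Fin.revPerm := by
  have key : ∀ m : ℕ, ∀ j : Fin n, (j : ℕ) = m → (σ j : ℕ) + j ≤ n - 1 := by
    intro m
    induction m with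
    | zero => intro j hj; have := (σ j).2; omega
    | succ m ih =>
      intro j hj
      let i : Fin n := ⟨m, by have := j.2; omega⟩
      have h1 := ih i rfl
      have h2 : (σ j : ℕ) < σ i := h i j (by simp [i, hj])
      have h3 : (i : ℕ) = m := rfl
      omega
  have h2 : σ * Fin.revPerm = 1 := by
    apply perm_le
    intro j
    have := key _ (Fin.rev j) rfl
    show ((σ (Fin.rev j) : Fin n) : ℕ) ≤ j
    have h3 := Fin.val_rev j
    have := j.2
    omega
  have h3 : Fin.revPerm * Fin.revPerm = (1 : Equiv.Perm (Fin n)) := by ext; simp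
  calc σ = σ * (Fin.revPerm * Fin.revPerm) := by rw [h3, mul_one]
    _ = _ := by rw [← mul_assoc, h2, one_mul]

/-- left invariance under B -/
def LB (f : GLn n k → R) : Prop := ∀ b, IsUp b → ∀ g, f (b * g) = f g

/-- line sums -/
def LS (i j : Fin n) (hij : (i : ℕ) + 1 = j) (f : GLn n k → R) (g : GLn n k) : R :=
  f g + ∑ t : k, f (yt i j hij t * g)

lemma LS_up (i j : Fin n) (hij : (i : ℕ) + 1 = j) (f : GLn n k → R) (hf : LB f) : LB (LS i j hij f) := by
  intro b hb g
  unfold LS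
  rw [hf b hb]
  congr 1
  have hi := up_diag_ne b hb i
  have hj := up_diag_ne b hb j
  -- the bijection of parameters
  let B : Matrix (Fin n) (Fin n) k := b
  have key : ∀ t : k, f (yt i j hij ((t * B j j + B i j) / B i i) * g) = f (yt i j hij t * (b * g)) := by
    intro t
    set t' := (t * B j j + B i j) / B i i with ht'
    set x : k → GLn n k := xr i j (ne_of_lt (adj_lt hij)) with hx
    set s := Pm k (Equiv.swap i j) with hs
    have h1 : s * s = 1 := Pm_swap_sq i j
    have h2 : x (-t') * x t' = 1 := by rw [hx, xr_mul, neg_add_cancel, xr_zero]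
    have hup : IsUp (s * (x t * b * x (-t')) * s) := by
      apply swap_up i j hij
      · exact isUp_mul _ _ (isUp_mul _ _ (xr_uni i j (adj_lt hij) _).1 hb) (xr_uni i j (adj_lt hij) _).1
      · have e1 : ∀ c : Fin n, ((x t * b : GLn n k) : Matrix (Fin n) (Fin n) k) i c = B i c + t * B j c := by
          intro c
          rw [Units.val_mul, hx, xr_val, Matrix.transvection_mul_apply_same]
        rw [Units.val_mul, hx, mul_xr_same, ← hx, e1, e1]
        have : B j i = 0 := hb j i (adj_lt hij)
        rw [this, ht']
        have : B i i ≠ 0 := hi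
        field_simp
        ring
    rw [← hf _ hup (yt i j hij t' * g)]
    congr 1
    rw [yt, yt, ← hs]
    change s * (x t * b * x (-t')) * s * (s * x t' * g) = s * x t * (b * g)
    calc s * (x t * b * x (-t')) * s * (s * x t' * g) = s * x t * b * x (-t') * (s * s) * x t' * g := by simp only [mul_assoc]
      _ = s * x t * b * (x (-t') * x t') * g := by rw [h1]; simp only [mul_assoc, mul_one, one_mul]
      _ = _ := by rw [h2]; simp only [mul_assoc, mul_one, one_mul]
  have bij : Function.Bijective (fun t : k => (t * B j j + B i j) / B i i) := by
    rw [Fintype.bijective_iff_injective_and_card]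
    refine ⟨?_, rfl⟩
    intro t t' h
    have hi' : B i i ≠ 0 := hi
    have hj' : B j j ≠ 0 := hj
    simp only at h
    rw [div_left_inj' hi', add_left_inj] at h
    exact mul_right_cancel₀ hj' h
  rw [← Function.Bijective.sum_comp bij (fun t => f (yt i j hij t * g))]
  exact Finset.sum_congr rfl (fun t _ => (key t).symm)

lemma yt_ne_zero (i j : Fin n) (hij : (i : ℕ) + 1 = j) (f : GLn n k → R) (hf : LB f) (t : k) (ht : t ≠ 0) (g : GLn n k) :
    f (yt i j hij t * g) = f (xr j i (ne_of_gt (adj_lt hij)) t⁻¹ * g) := by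
  have h1 := hf _ (yt_low i j hij t ht) (xr j i (ne_of_gt (adj_lt hij)) t⁻¹ * g)
  rw [← h1]
  congr 1
  have h3 : xr j i (ne_of_gt (adj_lt hij)) (-t⁻¹) * xr j i (ne_of_gt (adj_lt hij)) (t⁻¹) = 1 := by
    rw [xr_mul, neg_add_cancel, xr_zero]
  rw [mul_assoc, ← mul_assoc (xr j i _ (-t⁻¹)), h3, one_mul]

lemma yt_swap (i j : Fin n) (hij : (i : ℕ) + 1 = j) (t : k) :
    yt i j hij t * Pm k (Equiv.swap i j) = xr j i (ne_of_gt (adj_lt hij)) t := by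
  rw [yt, mul_assoc, Pm_xr, ← mul_assoc, Pm_swap_sq, one_mul]
  simp

lemma LS_swap (i j : Fin n) (hij : (i : ℕ) + 1 = j) (f : GLn n k → R) (hf : LB f) (g : GLn n k) :
    LS i j hij f (Pm k (Equiv.swap i j) * g) = LS i j hij f g := by
  unfold LS
  have h1 : ∀ t : k, f (yt i j hij t * (Pm k (Equiv.swap i j) * g)) = f (xr j i (ne_of_gt (adj_lt hij)) t * g) := by
    intro t; rw [← mul_assoc, yt_swap]
  simp only [h1]
  rw [← Finset.add_sum_erase _ _ (Finset.mem_univ (0:k)), ← Finset.add_sum_erase _ (fun t => f (yt i j hij t * g)) (Finset.mem_univ (0:k))]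
  have h2 : ∑ t ∈ Finset.univ.erase (0:k), f (xr j i (ne_of_gt (adj_lt hij)) t * g) = ∑ t ∈ Finset.univ.erase (0:k), f (yt i j hij t * g) := by
    refine Finset.sum_bij' (fun t _ => t⁻¹) (fun t _ => t⁻¹) ?_ ?_ ?_ ?_ ?_
    · intro t ht; simpa using ht
    · intro t ht; simpa using ht
    · intro t ht; simp
    · intro t ht; simp
    · intro t ht
      rw [yt_ne_zero i j hij f hf _ (by simpa using ht), inv_inv]
  rw [h2, xr_zero]
  have h3 : yt i j hij (0:k) = Pm k (Equiv.swap i j) := by rw [yt, xr_zero, mul_one]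
  rw [h3, one_mul]
  ring

lemma LS_yt (i j : Fin n) (hij : (i : ℕ) + 1 = j) (f : GLn n k → R) (hf : LB f) (t : k) (g : GLn n k) :
    LS i j hij f (yt i j hij t * g) = LS i j hij f g := by
  rw [yt, mul_assoc, LS_swap i j hij f hf, LS_up i j hij f hf _ (xr_uni i j (adj_lt hij) t).1]

def indB (R : Type) [Field R] (g : GLn n k) : R := if IsUp g then 1 else 0

lemma indB_LB : LB (indB R : GLn n k → R) := by
  intro b hb g
  unfold indB
  have : IsUp (b * g) ↔ IsUp g := (Bs n k).mul_mem_cancel_left (x := b) hb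
  simp only [this]

lemma LS_ind_or (i j : Fin n) (hij : (i : ℕ) + 1 = j) (g : GLn n k) (h0 : LS i j hij (indB R : GLn n k → R) g ≠ 0) :
    LS i j hij (indB R : GLn n k → R) (g * Pm k (Equiv.swap i j)) = LS i j hij (indB R : GLn n k → R) 1 ∧ LS i j hij (indB R : GLn n k → R) g = LS i j hij (indB R : GLn n k → R) 1 := by
  have hLB := LS_up i j hij (indB R : GLn n k → R) indB_LB
  have hU : ∀ b : GLn n k, IsUp b → LS i j hij (indB R : GLn n k → R) (b * Pm k (Equiv.swap i j)) = LS i j hij (indB R : GLn n k → R) 1 ∧ LS i j hij (indB R : GLn n k → R) b = LS i j hij (indB R : GLn n k → R) 1 := by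
    intro b hb
    constructor
    · rw [hLB b hb, ← LS_swap i j hij _ indB_LB, Pm_swap_sq]
    · have := hLB b hb 1
      rwa [mul_one] at this
  by_cases hg : IsUp g
  · exact hU g hg
  · by_cases hy : ∃ t : k, IsUp (yt i j hij t * g)
    · obtain ⟨t, ht⟩ := hy
      have := hU _ ht
      rwa [mul_assoc, LS_yt i j hij _ indB_LB, LS_yt i j hij _ indB_LB] at this
    · exfalso; apply h0
      push Not at hy
      unfold LS indB
      simp [hg, hy]

lemma LS_ind_swap (i j : Fin n) (hij : (i : ℕ) + 1 = j) (g : GLn n k) :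
    LS i j hij (indB R : GLn n k → R) (g * Pm k (Equiv.swap i j)) = LS i j hij (indB R : GLn n k → R) g := by
  by_cases h0 : LS i j hij (indB R : GLn n k → R) g = 0
  · by_cases h1 : LS i j hij (indB R : GLn n k → R) (g * Pm k (Equiv.swap i j)) = 0
    · rw [h0, h1]
    · have := LS_ind_or i j hij _ h1
      rw [mul_assoc, Pm_swap_sq, mul_one] at this
      rw [this.1, this.2]
  · have := LS_ind_or i j hij _ h0
    rw [this.1, this.2]

/-- Steinberg vector -/
def eS (R : Type) [Field R] (g : GLn n k) : R :=
  ∑ σ : Equiv.Perm (Fin n), ((Equiv.Perm.sign σ : ℤ) : R) * indB R (g * Pm k σ)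

lemma eS_LB : LB (eS R : GLn n k → R) := by
  intro b hb g
  unfold eS
  simp only [mul_assoc]
  simp only [indB_LB b hb]

lemma eS_LS (i j : Fin n) (hij : (i : ℕ) + 1 = j) (g : GLn n k) : LS i j hij (eS R) g = 0 := by
  have h1 : LS i j hij (eS R) g = ∑ σ : Equiv.Perm (Fin n), ((Equiv.Perm.sign σ : ℤ) : R) * LS i j hij (indB R) (g * Pm k σ) := by
    unfold LS eS
    rw [Finset.sum_comm, ← Finset.sum_add_distrib]
    apply Finset.sum_congr rfl
    intro σ _
    rw [mul_add, Finset.mul_sum]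
    simp only [mul_assoc]
  rw [h1]
  have hne : i ≠ j := ne_of_lt (adj_lt hij)
  apply Finset.sum_involution (fun σ _ => σ * Equiv.swap i j)
  · intro σ _
    rw [Pm_mul, ← mul_assoc, LS_ind_swap, Equiv.Perm.sign_mul, Equiv.Perm.sign_swap hne]
    simp
  · intro σ _ _ h
    have : Equiv.swap i j = 1 := by simpa using h
    rw [Equiv.swap_eq_one_iff] at this
    exact hne this
  · intro σ _; simp
  · intro σ _; simp [mul_assoc]

lemma PmM_self (σ : Equiv.Perm (Fin n)) (j : Fin n) : PmM k σ (σ j) j = 1 := by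
  rw [PmM_apply, Matrix.one_apply_eq]

lemma Pm_up (σ : Equiv.Perm (Fin n)) (h : IsUp (Pm k σ)) : σ = 1 := by
  apply perm_le
  intro j
  by_contra hj
  have := h (σ j) j (not_le.1 hj)
  rw [Pm_val, PmM_self] at this
  exact one_ne_zero this

lemma eS_one : eS R (1 : GLn n k) = 1 := by
  unfold eS
  rw [Finset.sum_eq_single 1]
  · simp [indB, Pm_one, isUp_one]
  · intro σ _ hσ
    rw [one_mul, indB, if_neg (fun h => hσ (Pm_up σ h)), mul_zero]
  · simp

lemma eS_w0 (m : GLn n k) (hm : IsUni m) : eS R (Pm k Fin.revPerm * m) = if m = 1 then ((Equiv.Perm.sign (Fin.revPerm : Equiv.Perm (Fin n)) : ℤ) : R) else 0 := by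
  have hrr : (Fin.revPerm : Equiv.Perm (Fin n)) * Fin.revPerm = 1 := by ext; simp
  have hri : (Fin.revPerm : Equiv.Perm (Fin n))⁻¹ = Fin.revPerm := by
    rw [inv_eq_iff_mul_eq_one, hrr]
  have key : ∀ (σ : Equiv.Perm (Fin n)), IsUp (Pm k Fin.revPerm * m * Pm k σ) → σ = Fin.revPerm ∧ m = 1 := by
    intro σ h
    have h' : ∀ i j : Fin n, j < i → (m : Matrix (Fin n) (Fin n) k) (Fin.rev i) (σ j) = 0 := by
      intro i j hij
      have := h i j hij
      rw [Units.val_mul, Units.val_mul, Pm_val, Pm_val, mul_PmM_apply, PmM_mul_apply, hri] at this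
      exact this
    have h1 : (Fin.revPerm : Equiv.Perm (Fin n)) * σ = 1 := by
      apply perm_le
      intro j
      by_contra hj
      have := h' (Fin.rev (σ j)) j (not_le.1 hj)
      rw [Fin.rev_rev, hm.2] at this
      exact one_ne_zero this
    have h2 : σ = Fin.revPerm := by
      calc σ = (Fin.revPerm * Fin.revPerm) * σ := by rw [hrr, one_mul]
        _ = _ := by rw [mul_assoc, h1, mul_one]
    refine ⟨h2, ?_⟩
    ext a b
    rcases lt_trichotomy a b with hab | hab | hab
    · have := h' (Fin.rev a) (Fin.rev b) (by simpa using hab)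
      rw [h2] at this
      simp only [Fin.rev_rev, Fin.revPerm_apply] at this
      rw [this, Units.val_one, Matrix.one_apply_ne (ne_of_lt hab)]
    · subst hab
      rw [hm.2, Units.val_one, Matrix.one_apply_eq]
    · rw [hm.1 _ _ hab, Units.val_one, Matrix.one_apply_ne (ne_of_gt hab)]
  unfold eS
  split_ifs with h
  · rw [Finset.sum_eq_single Fin.revPerm]
    · rw [h, mul_one, ← Pm_mul, hrr, Pm_one]; simp [indB, isUp_one]
    · intro σ _ hσ
      rw [indB, if_neg (fun h => hσ (key σ h).1), mul_zero]
    · simp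
  · apply Finset.sum_eq_zero
    intro σ _
    rw [indB, if_neg (fun h' => h (key σ h').2), mul_zero]

/-- Steinberg submodule -/
def StM (n : ℕ) (k R : Type) [Field k] [Fintype k] [Field R] : Submodule R (GLn n k → R) where
  carrier := {f | LB f ∧ ∀ i j hij g, LS i j hij f g = 0}
  zero_mem' := ⟨fun _ _ _ => rfl, fun i j hij g => by simp [LS]⟩
  add_mem' := by
    intro a b ha hb
    refine ⟨fun x hx g => by simp only [Pi.add_apply, ha.1 x hx, hb.1 x hx], fun i j hij g => ?_⟩
    have h1 := ha.2 i j hij g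
    have h2 := hb.2 i j hij g
    simp only [LS, Pi.add_apply, Finset.sum_add_distrib] at *
    linear_combination h1 + h2
  smul_mem' := by
    intro c a ha
    refine ⟨fun x hx g => by simp only [Pi.smul_apply, ha.1 x hx], fun i j hij g => ?_⟩
    have h1 := ha.2 i j hij g
    simp only [LS, Pi.smul_apply, smul_eq_mul, ← Finset.mul_sum] at *
    linear_combination c * h1

lemma mem_StM (f : GLn n k → R) : f ∈ StM n k R ↔ LB f ∧ ∀ i j hij g, LS i j hij f g = 0 := Iff.rfl

lemma eS_mem : (eS R : GLn n k → R) ∈ StM n k R := ⟨eS_LB, eS_LS⟩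

lemma StM_reg (g : GLn n k) (f : GLn n k → R) (hf : f ∈ StM n k R) : regRep R (GLn n k) g f ∈ StM n k R := by
  refine ⟨fun b hb x => ?_, fun i j hij x => ?_⟩
  · simp only [regRep_apply, mul_assoc, hf.1 b hb]
  · have := hf.2 i j hij (x * g)
    simpa only [LS, regRep_apply, mul_assoc] using this

def mu (σ : Equiv.Perm (Fin n)) : ℕ := ∑ a : Fin n, (a : ℕ) * (σ⁻¹ a : Fin n)

lemma mu_lt (σ : Equiv.Perm (Fin n)) (i j : Fin n) (hij : (i : ℕ) + 1 = j) (h : σ⁻¹ i < σ⁻¹ j) :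
    mu (Equiv.swap i j * σ) < mu σ := by
  have hne : i ≠ j := ne_of_lt (adj_lt hij)
  unfold mu
  rw [← Finset.add_sum_erase _ _ (Finset.mem_univ i), ← Finset.add_sum_erase _ _ (Finset.mem_erase.2 ⟨hne.symm, Finset.mem_univ j⟩)]
  rw [← Finset.add_sum_erase _ (fun a : Fin n => (a : ℕ) * (σ⁻¹ a : Fin n)) (Finset.mem_univ i), ← Finset.add_sum_erase _ (fun a : Fin n => (a : ℕ) * (σ⁻¹ a : Fin n)) (Finset.mem_erase.2 ⟨hne.symm, Finset.mem_univ j⟩)]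
  have h3 : ∑ x ∈ (Finset.univ.erase i).erase j, (x : ℕ) * ((Equiv.swap i j * σ)⁻¹ x : Fin n) = ∑ x ∈ (Finset.univ.erase i).erase j, (x : ℕ) * (σ⁻¹ x : Fin n) := by
    apply Finset.sum_congr rfl
    intro x hx
    simp only [Finset.mem_erase, Finset.mem_univ, and_true] at hx
    rw [mul_inv_rev, Equiv.swap_inv, Equiv.Perm.mul_apply, Equiv.swap_apply_of_ne_of_ne hx.2 hx.1]
  rw [h3]
  have h4 : (Equiv.swap i j * σ)⁻¹ i = σ⁻¹ j := by
    rw [mul_inv_rev, Equiv.swap_inv, Equiv.Perm.mul_apply, Equiv.swap_apply_left]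
  have h5 : (Equiv.swap i j * σ)⁻¹ j = σ⁻¹ i := by
    rw [mul_inv_rev, Equiv.swap_inv, Equiv.Perm.mul_apply, Equiv.swap_apply_right]
  rw [h4, h5, ← hij]
  have h' : ((σ⁻¹ i : Fin n) : ℕ) < (σ⁻¹ j : Fin n) := h
  generalize ((σ⁻¹ i : Fin n) : ℕ) = x at *
  generalize ((σ⁻¹ j : Fin n) : ℕ) = y at *
  nlinarith

lemma St_inj (f : GLn n k → R) (hf : f ∈ StM n k R) (h0 : ∀ m, IsUni m → f (Pm k Fin.revPerm * m) = 0) : f = 0 := by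
  have key : ∀ N : ℕ, ∀ σ : Equiv.Perm (Fin n), mu σ = N → ∀ m, IsUni m → f (Pm k σ * m) = 0 := by
    intro N
    induction N using Nat.strong_induction_on with
    | _ N ih =>
      intro σ hσ m hm
      by_cases hr : ∀ i j : Fin n, (i : ℕ) + 1 = j → σ⁻¹ j < σ⁻¹ i
      · have h1 := perm_rev σ⁻¹ hr
        have h2 : σ = Fin.revPerm := by
          have : (Fin.revPerm : Equiv.Perm (Fin n))⁻¹ = Fin.revPerm := by
            rw [inv_eq_iff_mul_eq_one]; ext; simp
          rw [← this, ← h1, inv_inv]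
        rw [h2]; exact h0 m hm
      · push Not at hr
        obtain ⟨i, j, hij, hle⟩ := hr
        have hne : σ⁻¹ i ≠ σ⁻¹ j := by simpa using ne_of_lt (adj_lt hij)
        have hlt : σ⁻¹ i < σ⁻¹ j := lt_of_le_of_ne hle hne
        have h1 := hf.2 i j hij (Pm k σ * m)
        unfold LS at h1
        rw [Finset.sum_eq_zero, add_zero] at h1
        · exact h1
        · intro t _
          have h2 : yt i j hij t * (Pm k σ * m) = Pm k (Equiv.swap i j * σ) * (xr (σ⁻¹ i) (σ⁻¹ j) hne t * m) := by
            rw [yt, Pm_mul, ← mul_assoc, mul_assoc (Pm k (Equiv.swap i j)), Pm_xr]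
            simp only [mul_assoc]
          rw [h2]
          exact ih _ (by rw [← hσ]; exact mu_lt σ i j hij hlt) _ rfl _ (isUni_mul _ _ (xr_uni _ _ hlt _) hm)
  funext g
  obtain ⟨b, σ, m, hb, hm, rfl⟩ := bruhat g
  rw [mul_assoc, hf.1 b hb, key _ σ rfl m hm]; rfl

end St14
end
end

section
open scoped Classical
open scoped TensorProduct

noncomputable section

namespace St14

set_option linter.unusedSectionVars false
set_option linter.unusedSimpArgs false
set_option linter.unusedVariables false

variable {n : ℕ} {k : Type} [Field k] [Fintype k] {R : Type} [Field R]
variable {VW : Type} [AddCommGroup VW] [Module R VW]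

def sdg (M : Matrix (Fin n) (Fin n) k) : k := ∑ i : Fin n, ∑ j : Fin n, if (i : ℕ) + 1 = j then M i j else 0

variable (ψ : AddChar k R)

def psiN (m : GLn n k) : R := ψ (sdg (m : Matrix (Fin n) (Fin n) k))

lemma uni_mul_adj (a b : GLn n k) (ha : IsUni a) (hb : IsUni b) (i j : Fin n) (hij : (i : ℕ) + 1 = j) :
    ((a * b : GLn n k) : Matrix (Fin n) (Fin n) k) i j
      = (a : Matrix (Fin n) (Fin n) k) i j + (b : Matrix (Fin n) (Fin n) k) i j := by
  have hne : i ≠ j := ne_of_lt (adj_lt hij)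
  rw [Units.val_mul, Matrix.mul_apply, ← Finset.add_sum_erase _ _ (Finset.mem_univ i),
    ← Finset.add_sum_erase _ _ (Finset.mem_erase.2 ⟨hne.symm, Finset.mem_univ j⟩), Finset.sum_eq_zero]
  · rw [ha.2, hb.2]; ring
  · intro c hc
    simp only [Finset.mem_erase, Finset.mem_univ, and_true] at hc
    by_cases h : c < i
    · rw [ha.1 _ _ h, zero_mul]
    · rw [hb.1 c j, mul_zero]
      have h1 : (c : ℕ) ≠ j := fun h => hc.1 (Fin.ext h)
      have h2 : (c : ℕ) ≠ i := fun h => hc.2 (Fin.ext h)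
      have h3 : ¬ ((c : ℕ) < i) := h
      show (j : ℕ) < c
      omega

lemma sdg_mul (a b : GLn n k) (ha : IsUni a) (hb : IsUni b) :
    sdg ((a * b : GLn n k) : Matrix (Fin n) (Fin n) k) = sdg (a : Matrix (Fin n) (Fin n) k) + sdg (b : Matrix (Fin n) (Fin n) k) := by
  unfold sdg
  rw [← Finset.sum_add_distrib]
  refine Finset.sum_congr rfl fun i _ => ?_
  rw [← Finset.sum_add_distrib]
  refine Finset.sum_congr rfl fun j _ => ?_
  split_ifs with h
  · exact uni_mul_adj a b ha hb i j h
  · rw [add_zero]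

lemma psiN_mul (a b : GLn n k) (ha : IsUni a) (hb : IsUni b) : psiN ψ (a * b) = psiN ψ a * psiN ψ b := by
  unfold psiN; rw [sdg_mul a b ha hb, AddChar.map_add_eq_mul]

lemma sdg_one : sdg (1 : Matrix (Fin n) (Fin n) k) = 0 := by
  unfold sdg
  refine Finset.sum_eq_zero fun i _ => Finset.sum_eq_zero fun j _ => ?_
  split_ifs with h
  · exact Matrix.one_apply_ne (ne_of_lt (adj_lt h))
  · rfl

lemma psiN_one : psiN ψ (1 : GLn n k) = 1 := by
  unfold psiN; rw [Units.val_one, sdg_one, AddChar.map_zero_eq_one]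

lemma psiN_inv (a : GLn n k) (ha : IsUni a) : psiN ψ a⁻¹ * psiN ψ a = 1 := by
  rw [← psiN_mul ψ _ _ (isUni_inv ha) ha, inv_mul_cancel, psiN_one]

lemma sdg_xr (i j : Fin n) (hij : (i : ℕ) + 1 = j) (t : k) : sdg (xr i j (ne_of_lt (adj_lt hij)) t : Matrix (Fin n) (Fin n) k) = t := by
  unfold sdg
  rw [Finset.sum_eq_single i, Finset.sum_eq_single j]
  · rw [if_pos hij, xr_apply, if_pos ⟨rfl, rfl⟩, Matrix.one_apply_ne (ne_of_lt (adj_lt hij)), zero_add]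
  · intro b _ hb
    split_ifs with h
    · rw [xr_apply, if_neg (by tauto), Matrix.one_apply_ne (ne_of_lt (adj_lt h)), zero_add]
    · rfl
  · simp
  · intro a _ ha
    refine Finset.sum_eq_zero fun b _ => ?_
    split_ifs with h
    · rw [xr_apply, if_neg (by tauto), Matrix.one_apply_ne (ne_of_lt (adj_lt h)), zero_add]
    · rfl
  · simp

lemma psiN_xr (i j : Fin n) (hij : (i : ℕ) + 1 = j) (t : k) : psiN ψ (xr i j (ne_of_lt (adj_lt hij)) t) = ψ t := by
  unfold psiN; rw [sdg_xr i j hij]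

lemma Pm_xr' (σ : Equiv.Perm (Fin n)) (i j : Fin n) (h : i ≠ j) (t : k) :
    Pm k σ * xr i j h t = xr (σ i) (σ j) (fun e => h (σ.injective e)) t * Pm k σ := by
  rw [Pm_xr]; simp

/-- the ψ-line -/
def PL (f : GLn n k → R) : Prop := LB f ∧ ∀ g m, IsUni m → f (g * m) = psiN ψ m * f g

lemma psi_nt (hψ : ψ.IsPrimitive) : ∃ t, ψ t ≠ 1 := by
  have := hψ one_ne_zero
  rw [AddChar.mulShift_one] at this
  by_contra h
  push Not at h
  exact this (by ext t; simp [h t])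

lemma PL_L1 (hψ : ψ.IsPrimitive) (f : GLn n k → R) (hf : PL ψ f) (σ : Equiv.Perm (Fin n)) (i j : Fin n) (hij : (i : ℕ) + 1 = j)
    (h : σ i < σ j) : f (Pm k σ) = 0 := by
  obtain ⟨t, ht⟩ := psi_nt ψ hψ
  have hne : i ≠ j := ne_of_lt (adj_lt hij)
  have h1 := hf.2 (Pm k σ) _ (xr_uni i j (adj_lt hij) t)
  rw [psiN_xr ψ i j hij, Pm_xr', hf.1 _ (xr_uni _ _ h t).1] at h1
  by_contra h0
  apply ht
  apply mul_right_cancel₀ h0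
  rw [one_mul]; exact h1.symm

lemma PL_L2 (hψ : ψ.IsPrimitive) (f : GLn n k → R) (hf : PL ψ f) (h0 : f (Pm k Fin.revPerm) = 0) : f = 0 := by
  funext g
  obtain ⟨b, σ, m, hb, hm, rfl⟩ := bruhat g
  rw [hf.2 _ _ hm, ← mul_one (b * Pm k σ), mul_assoc, hf.1 b hb, mul_one]
  suffices f (Pm k σ) = 0 by rw [this, mul_zero]; rfl
  by_cases hr : ∀ i j : Fin n, (i : ℕ) + 1 = j → σ j < σ i
  · rw [perm_rev σ hr, h0]
  · push Not at hr
    obtain ⟨i, j, hij, hle⟩ := hr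
    exact PL_L1 ψ hψ f hf σ i j hij (lt_of_le_of_ne hle (fun e => ne_of_lt (adj_lt hij) (σ.injective e)))

lemma sum_psi_inv (hψ : ψ.IsPrimitive) : ∑ t ∈ Finset.univ.erase (0:k), ψ t⁻¹ = -1 := by
  have h1 : ∑ t ∈ Finset.univ.erase (0:k), ψ t⁻¹ = ∑ t ∈ Finset.univ.erase (0:k), ψ t := by
    refine Finset.sum_bij' (fun t _ => t⁻¹) (fun t _ => t⁻¹) ?_ ?_ ?_ ?_ ?_
    · intro t ht; simpa using ht
    · intro t ht; simpa using ht
    · intro t ht; simp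
    · intro t ht; simp
    · intro t ht; rfl
  have h2 : ∑ t : k, ψ t = 0 := by
    have := AddChar.sum_mulShift (1 : k) hψ
    simpa using this
  rw [← Finset.add_sum_erase _ _ (Finset.mem_univ (0:k)), AddChar.map_zero_eq_one] at h2
  rw [h1]; linear_combination h2

lemma PL_St (hψ : ψ.IsPrimitive) (f : GLn n k → R) (hf : PL ψ f) : f ∈ StM n k R := by
  refine ⟨hf.1, fun i j hij => ?_⟩
  suffices LS i j hij f = 0 from fun g => congrFun this g
  have hlt := adj_lt hij
  have hne : i ≠ j := ne_of_lt hlt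
  apply PL_L2 ψ hψ
  · refine ⟨LS_up i j hij f hf.1, fun g m hm => ?_⟩
    unfold LS
    simp only [← mul_assoc, hf.2 _ m hm, mul_add, Finset.mul_sum]
  · unfold LS
    rw [← Finset.add_sum_erase _ _ (Finset.mem_univ (0:k))]
    have h1 : f (yt i j hij 0 * Pm k Fin.revPerm) = 0 := by
      rw [yt, xr_zero, mul_one, ← Pm_mul]
      have hadj : ((Fin.rev j : Fin n) : ℕ) + 1 = (Fin.rev i : Fin n) := by
        rw [Fin.val_rev, Fin.val_rev]; have := j.2; omega
      apply PL_L1 ψ hψ f hf _ (Fin.rev j) (Fin.rev i) hadj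
      simp only [Equiv.Perm.mul_apply, Fin.revPerm_apply, Fin.rev_rev, Equiv.swap_apply_left, Equiv.swap_apply_right]
      exact hlt
    have h2 : ∀ t ∈ Finset.univ.erase (0:k), f (yt i j hij t * Pm k Fin.revPerm) = ψ t⁻¹ * f (Pm k Fin.revPerm) := by
      intro t ht
      rw [yt_ne_zero i j hij f hf.1 t (by simpa using ht)]
      have hadj : ((Fin.rev j : Fin n) : ℕ) + 1 = (Fin.rev i : Fin n) := by
        rw [Fin.val_rev, Fin.val_rev]; have := j.2; omega
      have h3 : (xr j i (ne_of_gt hlt) t⁻¹ : GLn n k) * Pm k Fin.revPerm = Pm k Fin.revPerm * xr (Fin.rev j) (Fin.rev i) (ne_of_lt (adj_lt hadj)) t⁻¹ := by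
        rw [Pm_xr']; simp
      rw [h3, hf.2 _ _ (xr_uni _ _ (adj_lt hadj) _), psiN_xr ψ _ _ hadj]
    rw [h1, Finset.sum_congr rfl h2, ← Finset.sum_mul, sum_psi_inv ψ hψ]
    ring

/-- Whittaker functionals -/
def Whit (W : Representation R (GLn n k) VW) (l : VW →ₗ[R] R) : Prop :=
  ∀ m, IsUni m → ∀ v, l (W m v) = psiN ψ m * l v

def eps (x : GLn n k) : R := if IsUni x then psiN ψ x⁻¹ else 0

lemma eps_PL (f : GLn n k → R) (hf : LB f) : PL ψ (∑ x, eps ψ x • regRep R (GLn n k) x f) := by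
  refine ⟨fun b hb g => ?_, fun g m hm => ?_⟩
  · simp only [Finset.sum_apply, Pi.smul_apply, regRep_apply, mul_assoc, hf b hb]
  · simp only [Finset.sum_apply, Pi.smul_apply, regRep_apply, smul_eq_mul]
    rw [Finset.mul_sum, ← Equiv.sum_comp (Equiv.mulLeft m) (fun x => psiN ψ m * (eps ψ x * f (g * x)))]
    refine Finset.sum_congr rfl fun x _ => ?_
    simp only [Equiv.coe_mulLeft]
    rw [mul_assoc g, ← mul_assoc (psiN ψ m)]
    congr 1
    unfold eps
    have : IsUni (m * x) ↔ IsUni x := (Ns n k).mul_mem_cancel_left hm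
    simp only [this]
    split_ifs with hx
    · rw [mul_inv_rev, psiN_mul ψ _ _ (isUni_inv hx) (isUni_inv hm)]
      linear_combination (-psiN ψ x⁻¹) * psiN_inv ψ m hm
    · rw [mul_zero]

lemma sum_uni (c : R) : ∑ x : GLn n k, (if IsUni x then c else 0) = (Fintype.card (Ns n k) : R) * c := by
  rw [← Finset.sum_filter, Finset.sum_const, nsmul_eq_mul]
  congr 2
  rw [Fintype.card_subtype]
  rfl

lemma whit_eps (W : Representation R (GLn n k) VW) (l : VW →ₗ[R] R) (hl : Whit ψ W l) (v : VW) :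
    l (∑ x, eps ψ x • W x v) = (Fintype.card (Ns n k) : R) * l v := by
  rw [map_sum, ← sum_uni]
  refine Finset.sum_congr rfl fun x _ => ?_
  rw [map_smul, smul_eq_mul, eps]
  split_ifs with h
  · rw [hl x h]; linear_combination (l v) * psiN_inv ψ x h
  · rw [zero_mul]

lemma whit_main (hψ : ψ.IsPrimitive) (hqR : (Fintype.card k : R) ≠ 0) (W : Representation R (GLn n k) VW) (hs : Sub 1 W)
    (l : VW →ₗ[R] R) (hl : Whit ψ W l) (hl0 : l ≠ 0) :
    ∃ v0, l v0 ≠ 0 ∧ (∀ l', Whit ψ W l' → ∀ v, l' v * l v0 = l' v0 * l v) ∧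
      (∀ (c : GLn n k → R) (z : R), (∀ f ∈ StM n k R, ∑ x, c x • regRep R (GLn n k) x f = z • f) → ∑ x, c x • W x v0 = z • v0) := by
  obtain ⟨qs, hq, φ, hsur, he, hB⟩ := hs
  have hLB : ∀ f ∈ qs, LB f := by
    intro f hf b hb g
    rw [hB f hf b hb, dch]; simp
  have hN : (Fintype.card (Ns n k) : R) ≠ 0 := card_unip hqR _ le_rfl
  obtain ⟨v, hv⟩ : ∃ v, l v ≠ 0 := by
    by_contra h
    push Not at h
    exact hl0 (LinearMap.ext h)
  obtain ⟨f, rfl⟩ := hsur v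
  set f0 : qs := ⟨_, op_mem hq (eps ψ) f⟩ with hf0
  have hmap : ∀ f : qs, φ ⟨_, op_mem hq (eps ψ) f⟩ = ∑ x, eps ψ x • W x (φ f) := fun f => op_map hq φ W he (eps ψ) f
  have hw : ∀ l', Whit ψ W l' → ∀ f : qs, l' (φ ⟨_, op_mem hq (eps ψ) f⟩) = (Fintype.card (Ns n k) : R) * l' (φ f) := by
    intro l' hl' f
    rw [hmap, whit_eps ψ W l' hl']
  have hPL0 : PL ψ (f0 : GLn n k → R) := eps_PL ψ _ (hLB _ f.2)
  have hl00 : l (φ f0) ≠ 0 := by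
    rw [hf0, hw l hl]; exact mul_ne_zero hN hv
  have hne : (f0 : GLn n k → R) (Pm k Fin.revPerm) ≠ 0 := by
    intro h
    have := PL_L2 ψ hψ _ hPL0 h
    have h2 : f0 = 0 := Subtype.ext this
    rw [h2, map_zero, map_zero] at hl00
    exact hl00 rfl
  refine ⟨φ f0, hl00, ?_, ?_⟩
  · intro l' hl' v
    obtain ⟨f1, rfl⟩ := hsur v
    set f2 : qs := ⟨_, op_mem hq (eps ψ) f1⟩ with hf2
    have hPL2 : PL ψ (f2 : GLn n k → R) := eps_PL ψ _ (hLB _ f1.2)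
    set a := (f2 : GLn n k → R) (Pm k Fin.revPerm) / (f0 : GLn n k → R) (Pm k Fin.revPerm) with ha
    have h2 : f2 = a • f0 := by
      have : ((f2 - a • f0 : qs) : GLn n k → R) = 0 := by
        apply PL_L2 ψ hψ
        · refine ⟨fun b hb g => ?_, fun g m hm => ?_⟩
          · simp only [Submodule.coe_sub, Submodule.coe_smul, Pi.sub_apply, Pi.smul_apply, hPL2.1 b hb, hPL0.1 b hb]
          · simp only [Submodule.coe_sub, Submodule.coe_smul, Pi.sub_apply, Pi.smul_apply, hPL2.2 _ m hm, hPL0.2 _ m hm, smul_eq_mul]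
            ring
        · simp only [Submodule.coe_sub, Submodule.coe_smul, Pi.sub_apply, Pi.smul_apply, smul_eq_mul, ha]
          field_simp
          ring
      have : f2 - a • f0 = 0 := Subtype.ext this
      exact sub_eq_zero.1 this
    have e1 := hw l' hl' f1
    have e2 := hw l hl f1
    rw [← hf2, h2, map_smul, map_smul, smul_eq_mul] at e1 e2
    apply mul_left_cancel₀ hN
    linear_combination (-(l (φ f0))) * e1 + l' (φ f0) * e2
  · intro c z hc
    rw [← op_map hq φ W he c f0, ← map_smul]
    congr 1
    exact Subtype.ext (hc _ (PL_St ψ hψ _ hPL0))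

end St14
end
end

section
open scoped Classical
open scoped TensorProduct

noncomputable section

namespace St14

set_option linter.unusedSectionVars false
set_option linter.unusedSimpArgs false
set_option linter.unusedVariables false

variable {n : ℕ} {k : Type} [Field k] [Fintype k] {R : Type} [Field R]
variable {VW : Type} [AddCommGroup VW] [Module R VW]

lemma cl_op {G : Type} [Group G] [Fintype G] (W : Representation R G VW) (c : G → R) (hc : ∀ g x, c (g * x * g⁻¹) = c x) (g : G) (v : VW) :
    ∑ x, c x • W x (W g v) = W g (∑ x, c x • W x v) := by
  rw [map_sum, ← Equiv.sum_comp (MulAut.conj g).toEquiv (fun x => c x • W x (W g v))]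
  refine Finset.sum_congr rfl fun x _ => ?_
  simp only [MulEquiv.toEquiv_eq_coe, MulEquiv.coe_toEquiv, MulAut.conj_apply, hc, map_smul]
  rw [← rep_mul, ← rep_mul, inv_mul_cancel_right]

lemma op_St (c : GLn n k → R) (f : GLn n k → R) (hf : f ∈ StM n k R) : ∑ x, c x • regRep R (GLn n k) x f ∈ StM n k R :=
  Submodule.sum_mem _ fun x _ => Submodule.smul_mem _ _ (StM_reg x f hf)

/-- sum over N -/
def avN (f : GLn n k → R) : GLn n k → R := ∑ m : Ns n k, regRep R (GLn n k) m f

lemma avN_apply (f : GLn n k → R) (x : GLn n k) : avN f x = ∑ m : Ns n k, f (x * m) := by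
  simp only [avN, Finset.sum_apply, regRep_apply]

lemma avN_St (f : GLn n k → R) (hf : f ∈ StM n k R) : avN f ∈ StM n k R :=
  Submodule.sum_mem _ fun x _ => StM_reg _ f hf

lemma avN_inv (f : GLn n k → R) (x : GLn n k) (m : GLn n k) (hm : IsUni m) : avN f (x * m) = avN f x := by
  rw [avN_apply, avN_apply, ← Equiv.sum_comp (Equiv.mulLeft (⟨m, hm⟩ : Ns n k)) (fun a : Ns n k => f (x * a))]
  refine Finset.sum_congr rfl fun a _ => ?_
  simp [mul_assoc]

lemma avN_one (f : GLn n k → R) (hf : f ∈ StM n k R) : avN f 1 = (Fintype.card (Ns n k) : R) * f 1 := by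
  rw [avN_apply]
  have : ∀ m : Ns n k, f (1 * m) = f 1 := by
    intro m
    have := hf.1 m m.2.1 1
    rw [mul_one] at this
    rw [one_mul, this]
  rw [Finset.sum_congr rfl (fun m _ => this m)]
  simp

def sg (n : ℕ) (R : Type) [Field R] : R := ((Equiv.Perm.sign (Fin.revPerm : Equiv.Perm (Fin n)) : ℤ) : R)

lemma sg_sq : sg n R * sg n R = 1 := by
  unfold sg
  rw [← Int.cast_mul, Int.units_coe_mul_self, Int.cast_one]

lemma sg_ne : sg n R ≠ 0 := fun h => by have := sg_sq (n := n) (R := R); rw [h, zero_mul] at this; exact zero_ne_one this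

lemma avN_eS : avN (eS R : GLn n k → R) (Pm k Fin.revPerm) = sg n R := by
  rw [avN_apply, Finset.sum_eq_single 1]
  · rw [OneMemClass.coe_one, eS_w0 _ (isUni_one)]; simp [sg]
  · intro m _ hm
    rw [eS_w0 _ m.2]
    exact if_neg (fun h => hm (Subtype.ext h))
  · simp

lemma avN_eq (hqR : (Fintype.card k : R) ≠ 0) (f : GLn n k → R) (hf : f ∈ StM n k R) : avN f = f 1 • avN (eS R) := by
  have hN : (Fintype.card (Ns n k) : R) ≠ 0 := card_unip hqR _ le_rfl
  set a := avN f (Pm k Fin.revPerm) / sg n R with ha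
  have h1 : avN f = a • avN (eS R) := by
    rw [← sub_eq_zero]
    apply St_inj
    · exact Submodule.sub_mem _ (avN_St f hf) (Submodule.smul_mem _ _ (avN_St _ eS_mem))
    · intro m hm
      rw [Pi.sub_apply, Pi.smul_apply, avN_inv _ _ _ hm, avN_inv _ _ _ hm, avN_eS, smul_eq_mul, ha, div_mul_cancel₀ _ sg_ne, sub_self]
  have h2 := congrFun h1 1
  rw [Pi.smul_apply, avN_one f hf, avN_one _ eS_mem, eS_one, smul_eq_mul, mul_one, mul_comm] at h2
  rw [h1, mul_right_cancel₀ hN h2]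

lemma St_scalar (hqR : (Fintype.card k : R) ≠ 0) (c : GLn n k → R) (hc : ∀ g x, c (g * x * g⁻¹) = c x) :
    ∃ z : R, ∀ f ∈ StM n k R, ∑ x, c x • regRep R (GLn n k) x f = z • f := by
  have hN : (Fintype.card (Ns n k) : R) ≠ 0 := card_unip hqR _ le_rfl
  let T : (GLn n k → R) →ₗ[R] (GLn n k → R) := ∑ x, c x • regRep R (GLn n k) x
  have hT : ∀ f, T f = ∑ x, c x • regRep R (GLn n k) x f := by intro f; simp [T]
  have hcomm : ∀ g f, T (regRep R (GLn n k) g f) = regRep R (GLn n k) g (T f) := by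
    intro g f; rw [hT, hT, cl_op _ c hc]
  have hTav : ∀ f, T (avN f) = avN (T f) := by
    intro f; unfold avN; rw [map_sum]; simp only [hcomm]
  refine ⟨T (avN (eS R)) 1 / Fintype.card (Ns n k), ?_⟩
  have h1 : ∀ f ∈ StM n k R, T f 1 = T (avN (eS R)) 1 / Fintype.card (Ns n k) * f 1 := by
    intro f hf
    have h2 := avN_one (T f) (by rw [hT]; exact op_St c f hf)
    rw [← hTav, avN_eq hqR f hf, map_smul, Pi.smul_apply, smul_eq_mul] at h2
    field_simp
    linear_combination -h2
  intro f hf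
  rw [← hT]
  funext g
  have h2 := h1 _ (StM_reg g f hf)
  rw [hcomm, regRep_apply, regRep_apply, one_mul] at h2
  exact h2

def regS (n : ℕ) (k R : Type) [Field k] [Fintype k] [Field R] : Representation R (GLn n k) (StM n k R) where
  toFun g := (regRep R (GLn n k) g).restrict (fun f hf => StM_reg g f hf)
  map_one' := by ext f x; simp [regRep]
  map_mul' a b := by ext f x; simp [regRep, mul_assoc]

lemma regS_apply (g : GLn n k) (f : StM n k R) : ((regS n k R g f : StM n k R) : GLn n k → R) = regRep R (GLn n k) g f := rfl

def Phi (n : ℕ) (k R : Type) [Field k] [Fintype k] [Field R] : StM n k R →ₗ[R] (Ns n k → R) where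
  toFun f m := (f : GLn n k → R) (Pm k Fin.revPerm * (m : GLn n k))
  map_add' _ _ := rfl
  map_smul' _ _ := rfl

lemma Phi_bij : Function.Bijective (Phi n k R) := by
  constructor
  · rw [← LinearMap.ker_eq_bot, LinearMap.ker_eq_bot']
    intro f hf
    apply Subtype.ext
    apply St_inj _ f.2
    intro m hm
    exact congrFun hf ⟨m, hm⟩
  · intro F
    refine ⟨sg n R • ∑ m : Ns n k, F m • regS n k R (m⁻¹ : GLn n k) ⟨eS R, eS_mem⟩, ?_⟩
    funext m
    simp only [map_smul, map_sum, Pi.smul_apply, Finset.sum_apply]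
    rw [Finset.sum_eq_single m]
    · have : Phi n k R (regS n k R (m⁻¹ : GLn n k) ⟨eS R, eS_mem⟩) m = sg n R := by
        change eS R (Pm k Fin.revPerm * (m : GLn n k) * (m⁻¹ : GLn n k)) = _
        rw [mul_inv_cancel_right, ← mul_one (Pm k Fin.revPerm), eS_w0 1 isUni_one, if_pos rfl]; rfl
      rw [this]
      simp only [smul_eq_mul]
      linear_combination (F m) * sg_sq (n := n) (R := R)
    · intro a _ ha
      have : Phi n k R (regS n k R (a⁻¹ : GLn n k) ⟨eS R, eS_mem⟩) m = 0 := by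
        change eS R (Pm k Fin.revPerm * (m : GLn n k) * (a⁻¹ : GLn n k)) = _
        rw [mul_assoc, eS_w0 _ (isUni_mul _ _ m.2 (isUni_inv a.2)), if_neg]
        intro h
        exact ha (Subtype.ext (mul_inv_eq_one.1 h).symm)
      rw [this, smul_zero]
    · simp

def PhiE (n : ℕ) (k R : Type) [Field k] [Fintype k] [Field R] : StM n k R ≃ₗ[R] (Ns n k → R) :=
  LinearEquiv.ofBijective (Phi n k R) Phi_bij

lemma tr_uni (u : GLn n k) (hu : IsUni u) : LinearMap.trace R _ (regS n k R u) = if u = 1 then (Fintype.card (Ns n k) : R) else 0 := by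
  rw [← LinearMap.trace_conj' (regS n k R u) (PhiE n k R), LinearMap.trace_eq_matrix_trace R (Pi.basisFun R (Ns n k)), Matrix.trace]
  have h1 : ∀ F : Ns n k → R, ∀ m, ((PhiE n k R).conj (regS n k R u)) F m = F (m * ⟨u, hu⟩) := by
    intro F m
    obtain ⟨f, rfl⟩ := (PhiE n k R).surjective F
    rw [LinearEquiv.conj_apply_apply, LinearEquiv.symm_apply_apply]
    change (f : GLn n k → R) (Pm k Fin.revPerm * (m : GLn n k) * u) = (f : GLn n k → R) (Pm k Fin.revPerm * ((m * ⟨u, hu⟩ : Ns n k) : GLn n k))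
    rw [mul_assoc]; rfl
  have h2 : ∀ m : Ns n k, (LinearMap.toMatrix (Pi.basisFun R (Ns n k)) (Pi.basisFun R (Ns n k)) ((PhiE n k R).conj (regS n k R u))).diag m = if u = 1 then 1 else 0 := by
    intro m
    rw [Matrix.diag_apply, LinearMap.toMatrix_apply, Pi.basisFun_repr, h1, Pi.basisFun_apply, Pi.single_apply]
    refine if_congr ?_ rfl rfl
    rw [mul_eq_left]
    exact ⟨fun h => congrArg Subtype.val h, fun h => Subtype.ext h⟩
  rw [Finset.sum_congr rfl (fun m _ => h2 m)]
  split_ifs <;> simp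

lemma tr_conj (g x : GLn n k) : LinearMap.trace R _ (regS n k R (g * x * g⁻¹)) = LinearMap.trace R _ (regS n k R x) := by
  rw [map_mul (regS n k R), LinearMap.trace_mul_comm, ← map_mul (regS n k R), ← mul_assoc, inv_mul_cancel, one_mul]

lemma lemS (hqR : (Fintype.card k : R) ≠ 0) (c : GLn n k → R) (hc : ∀ g x, c (g * x * g⁻¹) = c x)
    (hsupp : ∀ x, c x ≠ 0 → ∃ g, IsUni (g * x * g⁻¹)) :
    ∀ f ∈ StM n k R, ∑ x, c x • regRep R (GLn n k) x f = c 1 • f := by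
  obtain ⟨z, hz⟩ := St_scalar hqR c hc
  have hN : (Fintype.card (Ns n k) : R) ≠ 0 := card_unip hqR _ le_rfl
  have h1 : ∑ x, c x • regS n k R x = z • (1 : Module.End R (StM n k R)) := by
    refine LinearMap.ext fun f => Subtype.ext ?_
    have := hz f f.2
    simp only [LinearMap.sum_apply, LinearMap.smul_apply, Submodule.coe_sum, Submodule.coe_smul, regS_apply]
    exact this
  have h2 := congrArg (LinearMap.trace R (StM n k R)) h1
  have h3 : LinearMap.trace R (StM n k R) (1 : Module.End R (StM n k R)) = (Fintype.card (Ns n k) : R) := by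
    have := tr_uni (R := R) (1 : GLn n k) isUni_one
    rwa [if_pos rfl, map_one] at this
  rw [map_sum, map_smul, h3, Finset.sum_eq_single 1, map_smul, map_one, h3] at h2
  · have h4 : c 1 = z := mul_right_cancel₀ hN h2
    rw [h4]; exact hz
  · intro x _ hx
    rw [map_smul]
    by_cases h0 : c x = 0
    · rw [h0, zero_smul]
    · obtain ⟨g, hg⟩ := hsupp x h0
      rw [← tr_conj g x, tr_uni _ hg, if_neg, smul_zero]
      intro h
      exact hx (by simpa using h)
  · simp

lemma lemSW (ψ : AddChar k R) (hψ : ψ.IsPrimitive) (hqR : (Fintype.card k : R) ≠ 0) (W : Representation R (GLn n k) VW) (hs : Sub 1 W)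
    (hirr : IsIrreducibleRep W)
    (l : VW →ₗ[R] R) (hl : Whit ψ W l) (hl0 : l ≠ 0) (c : GLn n k → R) (hc : ∀ g x, c (g * x * g⁻¹) = c x)
    (hsupp : ∀ x, c x ≠ 0 → ∃ g, IsUni (g * x * g⁻¹)) (v : VW) : ∑ x, c x • W x v = c 1 • v := by
  obtain ⟨v0, h0, -, h⟩ := whit_main ψ hψ hqR W hs l hl hl0
  have h1 := h c (c 1) (lemS hqR c hc hsupp)
  let P : Submodule R VW := LinearMap.ker (∑ x, c x • W x - c 1 • (1 : Module.End R VW))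
  have hP : ∀ v, v ∈ P ↔ ∑ x, c x • W x v = c 1 • v := by
    intro v
    simp [P, LinearMap.mem_ker, sub_eq_zero]
  have := hirr.2 P (by
    intro g v hv
    rw [hP] at hv ⊢
    rw [cl_op W c hc, hv, map_smul])
  rw [← hP]
  rcases this with h2 | h2
  · exfalso
    have h3 : v0 ∈ P := (hP v0).2 h1
    rw [h2, Submodule.mem_bot] at h3
    rw [h3, map_zero] at h0
    exact h0 rfl
  · rw [h2]; trivial

end St14
end
end

section
open scoped Classical
open scoped TensorProduct

noncomputable section

namespace St14

set_option linter.unusedSectionVars false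
set_option linter.unusedSimpArgs false
set_option linter.unusedVariables false

variable {n : ℕ} {k : Type} [Field k] [Fintype k] {R : Type} [Field R]
variable {VW : Type} [AddCommGroup VW] [Module R VW]

lemma inU_conj (g x : GLn n k) (A : Matrix (Fin n) (Fin n) k) (h : inU A x) :
    inU ((g : Matrix (Fin n) (Fin n) k) * A * ((g⁻¹ : GLn n k) : Matrix (Fin n) (Fin n) k)) (g * x * g⁻¹) := by
  obtain ⟨h1, B, h2⟩ := h
  have e1 : (g : Matrix (Fin n) (Fin n) k) * ((g⁻¹ : GLn n k) : Matrix (Fin n) (Fin n) k) = 1 := Units.mul_inv g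
  have e2 : ((g⁻¹ : GLn n k) : Matrix (Fin n) (Fin n) k) * g = 1 := Units.inv_mul g
  have h3 : ((g * x * g⁻¹ : GLn n k) : Matrix (Fin n) (Fin n) k) - 1
      = (g : Matrix (Fin n) (Fin n) k) * ((x : Matrix (Fin n) (Fin n) k) - 1) * ((g⁻¹ : GLn n k) : Matrix (Fin n) (Fin n) k) := by
    rw [mul_sub, sub_mul, mul_one, e1]; rfl
  constructor
  · rw [h3]
    calc _ = (g : Matrix (Fin n) (Fin n) k) * ((x : Matrix (Fin n) (Fin n) k) - 1) * (((g⁻¹ : GLn n k) : Matrix (Fin n) (Fin n) k) * g) * A * ((g⁻¹ : GLn n k) : Matrix (Fin n) (Fin n) k) := by simp only [mul_assoc]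
      _ = (g : Matrix (Fin n) (Fin n) k) * (((x : Matrix (Fin n) (Fin n) k) - 1) * A) * ((g⁻¹ : GLn n k) : Matrix (Fin n) (Fin n) k) := by rw [e2, mul_one]; simp only [mul_assoc]
      _ = 0 := by rw [h1, mul_zero, zero_mul]
  · refine ⟨(g : Matrix (Fin n) (Fin n) k) * B * ((g⁻¹ : GLn n k) : Matrix (Fin n) (Fin n) k), ?_⟩
    rw [h3, h2]
    calc _ = (g : Matrix (Fin n) (Fin n) k) * A * 1 * B * ((g⁻¹ : GLn n k) : Matrix (Fin n) (Fin n) k) := by simp only [mul_assoc, mul_one, one_mul]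
      _ = _ := by rw [← e2]; simp only [mul_assoc]

def cjM (g : GLn n k) : Matrix (Fin n) (Fin n) k ≃ Matrix (Fin n) (Fin n) k where
  toFun A := (g : Matrix (Fin n) (Fin n) k) * A * ((g⁻¹ : GLn n k) : Matrix (Fin n) (Fin n) k)
  invFun A := ((g⁻¹ : GLn n k) : Matrix (Fin n) (Fin n) k) * A * g
  left_inv A := by
    have e2 : ((g⁻¹ : GLn n k) : Matrix (Fin n) (Fin n) k) * g = 1 := Units.inv_mul g
    simp only
    rw [mul_assoc, mul_assoc (_ * A), e2, mul_one, ← mul_assoc, e2, one_mul]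
  right_inv A := by
    have e1 : (g : Matrix (Fin n) (Fin n) k) * ((g⁻¹ : GLn n k) : Matrix (Fin n) (Fin n) k) = 1 := Units.mul_inv g
    simp only
    rw [mul_assoc, mul_assoc (_ * A), e1, mul_one, ← mul_assoc, e1, one_mul]

lemma inU_conj_iff (g x : GLn n k) (A : Matrix (Fin n) (Fin n) k) : inU (cjM g A) (g * x * g⁻¹) ↔ inU A x := by
  refine ⟨fun h => ?_, fun h => inU_conj g x A h⟩
  have := inU_conj g⁻¹ _ _ h
  rw [inv_inv] at this
  have e : ((g⁻¹ : GLn n k) : Matrix (Fin n) (Fin n) k) * (cjM g A) * g = A := (cjM g).symm_apply_apply A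
  rw [e] at this
  simpa [mul_assoc] using this

lemma inU_triv (A : Matrix (Fin n) (Fin n) k) (hA : A = 0 ∨ IsUnit A) (x : GLn n k) : inU A x ↔ x = 1 := by
  constructor
  · rintro ⟨h1, B, h2⟩
    have : (x : Matrix (Fin n) (Fin n) k) - 1 = 0 := by
      rcases hA with h | h
      · rw [h2, h, zero_mul]
      · exact (h.mul_left_eq_zero).1 h1
    exact Units.ext (sub_eq_zero.1 this)
  · rintro rfl
    exact ⟨by simp, 0, by simp⟩

lemma inU_one (A : Matrix (Fin n) (Fin n) k) : inU A 1 := ⟨by simp, 0, by simp⟩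

def IsSg (A : Matrix (Fin n) (Fin n) k) : Prop := A ≠ 0 ∧ ¬ IsUnit A

lemma sum_inU (W : Representation R (GLn n k) VW) (hW : Cusp W) (A : Matrix (Fin n) (Fin n) k) (v : VW) :
    ∑ x : GLn n k, (if inU A x then W x v else 0) = if IsSg A then 0 else v := by
  by_cases hA : IsSg A
  · rw [if_pos hA]
    obtain ⟨g, h, r, hr, hrn, rfl⟩ := sing_nf A hA.2 hA.1
    refine Eq.trans ?_ (cusp_sum W hW r hr hrn g v)
    simp only [inU_iff]
    rw [← Finset.sum_filter]
    refine Finset.sum_bij' (fun x hx => (⟨g⁻¹ * x * g, (Finset.mem_filter.1 hx).2⟩ : UR n k r)) (fun u _ => g * u * g⁻¹) ?_ ?_ ?_ ?_ ?_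
    · intro x hx; exact Finset.mem_univ _
    · intro u _
      rw [Finset.mem_filter]
      refine ⟨Finset.mem_univ _, ?_⟩
      have : g⁻¹ * (g * u * g⁻¹) * g = (u : GLn n k) := by group
      rw [this]; exact u.2
    · intro x _; simp only; group
    · intro u _; apply Subtype.ext; simp only; group
    · intro x _; simp only; congr 2; group
  · rw [if_neg hA]
    have : A = 0 ∨ IsUnit A := by unfold IsSg at hA; tauto
    simp only [inU_triv A this]
    simp

lemma lem7 (ψ : AddChar k R) (hψ : ψ.IsPrimitive) (hqR : (Fintype.card k : R) ≠ 0) (W : Representation R (GLn n k) VW) (hs : Sub 1 W)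
    (hirr : IsIrreducibleRep W) (hW : Cusp W)
    (l : VW →ₗ[R] R) (hl : Whit ψ W l) (hl0 : l ≠ 0) (f : Matrix (Fin n) (Fin n) k → R)
    (hf : ∀ g A, f (cjM g A) = f A) : ∑ A, (if IsSg A then f A else 0) = 0 := by
  set c : GLn n k → R := fun x => ∑ A, if inU A x then f A else 0 with hc
  obtain ⟨v, hv⟩ : ∃ v, l v ≠ 0 := by
    by_contra h
    push Not at h
    exact hl0 (LinearMap.ext h)
  have h1 := lemSW ψ hψ hqR W hs hirr l hl hl0 c (by
    intro g x
    simp only [hc]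
    rw [← Equiv.sum_comp (cjM g)]
    refine Finset.sum_congr rfl fun A _ => ?_
    simp only [inU_conj_iff, hf]) (by
    intro x hx
    obtain ⟨A, -, hA⟩ := Finset.exists_ne_zero_of_sum_ne_zero hx
    have hU : inU A x := by by_contra h; exact hA (if_neg h)
    by_cases hS : IsSg A
    · obtain ⟨g, h, r, hr, hrn, rfl⟩ := sing_nf A hS.2 hS.1
      rw [inU_iff] at hU
      refine ⟨g⁻¹, ?_⟩
      rw [inv_inv]
      exact UR_le r hU
    · have : A = 0 ∨ IsUnit A := by unfold IsSg at hS; tauto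
      rw [inU_triv A this] at hU
      refine ⟨1, ?_⟩
      rw [hU]; simpa using isUni_one) v
  have h2 : ∑ x, c x • W x v = ∑ A, f A • (if IsSg A then 0 else v) := by
    simp only [hc, Finset.sum_smul]
    rw [Finset.sum_comm]
    refine Finset.sum_congr rfl fun A _ => ?_
    rw [← sum_inU W hW, Finset.smul_sum]
    refine Finset.sum_congr rfl fun x _ => ?_
    split_ifs <;> simp
  have h3 : c 1 = ∑ A, f A := by
    simp only [hc, inU_one, if_true]
  rw [h2, h3, Finset.sum_smul, ← sub_eq_zero, ← Finset.sum_sub_distrib] at h1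
  have h4 : ∀ A, f A • (if IsSg A then 0 else v) - f A • v = -((if IsSg A then f A else 0) • v) := by
    intro A; split_ifs <;> simp
  rw [Finset.sum_congr rfl (fun A _ => h4 A), Finset.sum_neg_distrib, neg_eq_zero, ← Finset.sum_smul] at h1
  have h5 := congrArg l h1
  rw [map_smul, map_zero, smul_eq_mul] at h5
  exact (mul_eq_zero.1 h5).resolve_right hv

lemma sum_trace (ψ : AddChar k R) (hψ : ψ.IsPrimitive) (hn : 0 < n) : ∑ A : Matrix (Fin n) (Fin n) k, ψ (Matrix.trace A) = 0 := by
  obtain ⟨t, ht⟩ := psi_nt ψ hψ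
  let i : Fin n := ⟨0, hn⟩
  have h1 := Equiv.sum_comp (Equiv.addLeft (Matrix.single i i t)) (fun A : Matrix (Fin n) (Fin n) k => ψ (Matrix.trace A))
  simp only [Equiv.coe_addLeft, Matrix.trace_add, Matrix.trace_single_eq_same, AddChar.map_add_eq_mul] at h1
  rw [← Finset.mul_sum] at h1
  by_contra h0
  exact ht (mul_right_cancel₀ h0 (by rw [h1, one_mul]))

lemma split_sum (f : Matrix (Fin n) (Fin n) k → R) (hn : 0 < n) :
    ∑ A, f A = f 0 + ∑ x : GLn n k, f x + ∑ A, (if IsSg A then f A else 0) := by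
  have h1 : ∑ x : GLn n k, f x = ∑ A, if IsUnit A then f A else 0 := by
    rw [← Finset.sum_filter]
    refine Finset.sum_bij (fun x _ => (x : Matrix (Fin n) (Fin n) k)) ?_ ?_ ?_ ?_
    · intro x _; simp
    · intro x _ y _ h; exact Units.ext h
    · intro A hA; obtain ⟨x, hx⟩ := (Finset.mem_filter.1 hA).2; exact ⟨x, Finset.mem_univ _, hx⟩
    · intro x _; rfl
  have h2 : f 0 = ∑ A, if A = 0 then f A else 0 := by simp
  rw [h1, h2, ← Finset.sum_add_distrib, ← Finset.sum_add_distrib]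
  refine Finset.sum_congr rfl fun A _ => ?_
  haveI : Nonempty (Fin n) := ⟨⟨0, hn⟩⟩
  by_cases h0 : A = 0
  · subst h0; simp [IsSg]
  · by_cases hu : IsUnit A <;> simp [IsSg, h0, hu]

def rk1 (A : Matrix (Fin n) (Fin n) k) : R :=
  ∑ a : Fin n → k, ∑ b : Fin n → k, if a ≠ 0 ∧ b ≠ 0 ∧ A = Matrix.vecMulVec a b then 1 else 0

def mvE (g : GLn n k) : (Fin n → k) ≃ (Fin n → k) where
  toFun a := Matrix.mulVec (g : Matrix (Fin n) (Fin n) k) a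
  invFun a := Matrix.mulVec ((g⁻¹ : GLn n k) : Matrix (Fin n) (Fin n) k) a
  left_inv a := by simp only [Matrix.mulVec_mulVec, Units.inv_mul, Matrix.one_mulVec]
  right_inv a := by simp only [Matrix.mulVec_mulVec, Units.mul_inv, Matrix.one_mulVec]

def vmE (g : GLn n k) : (Fin n → k) ≃ (Fin n → k) where
  toFun a := Matrix.vecMul a ((g⁻¹ : GLn n k) : Matrix (Fin n) (Fin n) k)
  invFun a := Matrix.vecMul a (g : Matrix (Fin n) (Fin n) k)
  left_inv a := by simp only [Matrix.vecMul_vecMul, Units.inv_mul, Matrix.vecMul_one]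
  right_inv a := by simp only [Matrix.vecMul_vecMul, Units.mul_inv, Matrix.vecMul_one]

lemma rk1_cj (g : GLn n k) (A : Matrix (Fin n) (Fin n) k) : (rk1 (cjM g A) : R) = rk1 A := by
  unfold rk1
  rw [← Equiv.sum_comp (mvE g)]
  refine Finset.sum_congr rfl fun a _ => ?_
  rw [← Equiv.sum_comp (vmE g)]
  refine Finset.sum_congr rfl fun b _ => ?_
  have e1 : mvE g a ≠ 0 ↔ a ≠ 0 := by
    rw [ne_eq, ne_eq, not_iff_not]
    have : mvE g 0 = 0 := Matrix.mulVec_zero (g : Matrix (Fin n) (Fin n) k)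
    rw [← (mvE g).apply_eq_iff_eq (x := a), this]
  have e2 : vmE g b ≠ 0 ↔ b ≠ 0 := by
    rw [ne_eq, ne_eq, not_iff_not]
    have : vmE g 0 = 0 := Matrix.zero_vecMul ((g⁻¹ : GLn n k) : Matrix (Fin n) (Fin n) k)
    rw [← (vmE g).apply_eq_iff_eq (x := b), this]
  have e3 : cjM g A = Matrix.vecMulVec (mvE g a) (vmE g b) ↔ A = Matrix.vecMulVec a b := by
    have : Matrix.vecMulVec (mvE g a) (vmE g b) = cjM g (Matrix.vecMulVec a b) := by
      change _ = (g : Matrix (Fin n) (Fin n) k) * Matrix.vecMulVec a b * ((g⁻¹ : GLn n k) : Matrix (Fin n) (Fin n) k)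
      rw [Matrix.mul_vecMulVec, Matrix.vecMulVec_mul]; rfl
    rw [this, (cjM g).apply_eq_iff_eq]
  simp only [e1, e2, e3]

lemma vmv_sg (hn : 2 ≤ n) (a b : Fin n → k) (ha : a ≠ 0) (hb : b ≠ 0) : IsSg (Matrix.vecMulVec a b) := by
  constructor
  · obtain ⟨i, hi⟩ := Function.ne_iff.1 ha
    obtain ⟨j, hj⟩ := Function.ne_iff.1 hb
    intro h
    have := congrFun (congrFun h i) j
    rw [Matrix.vecMulVec_apply] at this
    exact (mul_ne_zero hi hj) this
  · intro h
    have h1 := Matrix.rank_of_isUnit _ h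
    have h2 := Matrix.rank_vecMulVec_le a b
    rw [h1, Fintype.card_fin] at h2
    omega

lemma rk1_sum (hn : 2 ≤ n) : ∑ A : Matrix (Fin n) (Fin n) k, (if IsSg A then (rk1 A : R) else 0) = ((Fintype.card k : R) ^ n - 1) ^ 2 := by
  have h0 : ∑ a : Fin n → k, (if a ≠ 0 then (1:R) else 0) = (Fintype.card k : R) ^ n - 1 := by
    have : ∀ a : Fin n → k, (if a ≠ 0 then (1:R) else 0) = 1 - if a = 0 then 1 else 0 := by
      intro a; split_ifs <;> simp_all
    rw [Finset.sum_congr rfl (fun a _ => this a), Finset.sum_sub_distrib]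
    simp
  have h1 : ∀ A : Matrix (Fin n) (Fin n) k, (if IsSg A then (rk1 A : R) else 0) = rk1 A := by
    intro A
    split_ifs with h
    · rfl
    · symm
      refine Finset.sum_eq_zero fun a _ => Finset.sum_eq_zero fun b _ => if_neg ?_
      rintro ⟨ha, hb, rfl⟩
      exact h (vmv_sg hn a b ha hb)
  rw [Finset.sum_congr rfl (fun A _ => h1 A)]
  unfold rk1
  rw [Finset.sum_comm, sq, ← h0, Finset.sum_mul]
  refine Finset.sum_congr rfl fun a _ => ?_
  rw [Finset.sum_comm, Finset.mul_sum]
  refine Finset.sum_congr rfl fun b _ => ?_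
  by_cases ha : a = 0
  · simp [ha]
  · by_cases hb : b = 0
    · simp [hb]
    · simp [ha, hb]

lemma lem_q (ψ : AddChar k R) (hψ : ψ.IsPrimitive) (hqR : (Fintype.card k : R) ≠ 0) (W : Representation R (GLn n k) VW) (hs : Sub 1 W)
    (hirr : IsIrreducibleRep W) (hW : Cusp W)
    (l : VW →ₗ[R] R) (hl : Whit ψ W l) (hl0 : l ≠ 0) (u : ℕ) (hu : 1 ≤ u) (hn : n = 2 * u) :
    (Fintype.card k : R) ^ u = -1 := by
  have h1 := lem7 ψ hψ hqR W hs hirr hW l hl hl0 (fun A => ψ (Matrix.trace A)) (by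
    intro g A
    change ψ (Matrix.trace ((g : Matrix (Fin n) (Fin n) k) * A * ((g⁻¹ : GLn n k) : Matrix (Fin n) (Fin n) k))) = _
    rw [Matrix.trace_mul_comm, ← mul_assoc, Units.inv_mul, one_mul])
  have h2 := split_sum (fun A : Matrix (Fin n) (Fin n) k => ψ (Matrix.trace A)) (by omega)
  rw [h1, sum_trace ψ hψ (by omega), Matrix.trace_zero, AddChar.map_zero_eq_one, add_zero] at h2
  have h3 : ∑ x : GLn n k, ψ (Matrix.trace (x : Matrix (Fin n) (Fin n) k)) = gam ψ n 1 := gauss_one ψ hψ hqR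
  have h4 := lem7 ψ hψ hqR W hs hirr hW l hl hl0 (fun A => rk1 A) (fun g A => rk1_cj g A)
  rw [rk1_sum (by omega)] at h4
  have h5 : (Fintype.card k : R) ^ n = 1 := by
    have := pow_eq_zero_iff (two_ne_zero) |>.1 h4
    exact sub_eq_zero.1 this
  rw [h3, gam, gs_one ψ hψ] at h2
  have hc := card_PR n
  have h6 : (-1 : R) ^ n = 1 := by rw [hn, pow_mul]; simp
  rw [h6, mul_one] at h2
  have h7 : Fintype.card (PR n) + u = n * u := by
    subst hn; nlinarith
  have h8 : (Fintype.card k : R) ^ (Fintype.card (PR n)) * (Fintype.card k : R) ^ u = 1 := by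
    rw [← pow_add, h7, pow_mul, h5, one_pow]
  linear_combination (-(Fintype.card k : R)^u) * h2 - h8

end St14
end
end

section
open scoped Classical
open scoped TensorProduct

noncomputable section

namespace St14

set_option linter.unusedSectionVars false
set_option linter.unusedSimpArgs false
set_option linter.unusedVariables false

variable {n : ℕ} {k : Type} [Field k] [Fintype k] {R : Type} [Field R]
variable {VW : Type} [AddCommGroup VW] [Module R VW]

lemma dch_id (ϱ : kˣ →* Rˣ) : dch ϱ (1 : GLn n k) = 1 := by simp [dch]

lemma dch_inv (ϱ : kˣ →* Rˣ) (g : GLn n k) : dch ϱ g⁻¹ * dch ϱ g = 1 := by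
  rw [← dch_mul, inv_mul_cancel, dch_id]

def tw (ϱ : kˣ →* Rˣ) (W : Representation R (GLn n k) VW) : Representation R (GLn n k) VW where
  toFun g := dch ϱ g⁻¹ • W g
  map_one' := by rw [inv_one, dch_id, one_smul, map_one]
  map_mul' g h := by
    rw [mul_inv_rev, dch_mul, map_mul]
    ext v
    simp [smul_smul]

lemma tw_apply (ϱ : kˣ →* Rˣ) (W : Representation R (GLn n k) VW) (g : GLn n k) (v : VW) :
    tw ϱ W g v = dch ϱ g⁻¹ • W g v := rfl

lemma tw_uni (ϱ : kˣ →* Rˣ) (W : Representation R (GLn n k) VW) (g : GLn n k) (hg : IsUni g) (v : VW) :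
    tw ϱ W g v = W g v := by
  rw [tw_apply, dch_of_det ϱ _ (uni_det _ (isUni_inv hg)), one_smul]

def mulD (ϱ : kˣ →* Rˣ) : (GLn n k → R) →ₗ[R] (GLn n k → R) where
  toFun f x := dch ϱ x * f x
  map_add' f g := by ext x; simp [mul_add]
  map_smul' c f := by ext x; simp; ring

lemma mulD_reg (ϱ : kˣ →* Rˣ) (g : GLn n k) (f : GLn n k → R) :
    mulD ϱ (regRep R (GLn n k) g f) = dch ϱ g⁻¹ • regRep R (GLn n k) g (mulD ϱ f) := by
  ext x
  rw [Pi.smul_apply, regRep_apply]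
  change dch ϱ x * regRep R (GLn n k) g f x = dch ϱ g⁻¹ * (dch ϱ (x * g) * f (x * g))
  rw [regRep_apply, dch_mul]
  linear_combination (-(dch ϱ x * f (x * g))) * dch_inv ϱ g

lemma Sub_tw (ϱ : kˣ →* Rˣ) (W : Representation R (GLn n k) VW) (hs : Sub ϱ W) : Sub 1 (tw ϱ W) := by
  obtain ⟨qs, hq, φ, hsur, he, hB⟩ := hs
  have hq0 : ∀ g, ∀ f ∈ qs.comap (mulD ϱ), regRep R (GLn n k) g f ∈ qs.comap (mulD ϱ) := by
    intro g f hf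
    rw [Submodule.mem_comap] at hf ⊢
    rw [mulD_reg]
    exact qs.smul_mem _ (hq g _ hf)
  refine ⟨qs.comap (mulD ϱ), hq0, φ ∘ₗ ((mulD ϱ).restrict (p := qs.comap (mulD ϱ)) (q := qs) (fun f hf => hf)), ?_, ?_, ?_⟩
  · intro w
    obtain ⟨f, rfl⟩ := hsur w
    have e : mulD ϱ (fun x => dch ϱ x⁻¹ * (f : GLn n k → R) x) = f := by
      ext x
      change dch ϱ x * (dch ϱ x⁻¹ * (f : GLn n k → R) x) = _
      linear_combination (f : GLn n k → R) x * dch_inv ϱ x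
    refine ⟨⟨fun x => dch ϱ x⁻¹ * (f : GLn n k → R) x, ?_⟩, ?_⟩
    · rw [Submodule.mem_comap, e]; exact f.2
    · rw [LinearMap.comp_apply]
      congr 1
      exact Subtype.ext e
  · intro g f
    rw [LinearMap.comp_apply, LinearMap.comp_apply, tw_apply, ← he, ← map_smul]
    congr 1
    exact Subtype.ext (mulD_reg ϱ g f)
  · intro f hf b hb g
    have h1 := hB _ hf b hb g
    change dch ϱ (b * g) * f (b * g) = dch ϱ b * (dch ϱ g * f g) at h1
    rw [dch_mul] at h1
    rw [dch_one, one_mul]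
    linear_combination dch ϱ g⁻¹ * dch ϱ b⁻¹ * h1 + (f g - f (b * g)) * (dch_inv ϱ g) * (dch ϱ b⁻¹ * dch ϱ b) + (f g - f (b * g)) * dch_inv ϱ b

lemma Cusp_tw (ϱ : kˣ →* Rˣ) (W : Representation R (GLn n k) VW) (hW : Cusp W) : Cusp (tw ϱ W) := by
  intro r h0 h1 μ hμ
  refine hW r h0 h1 μ fun g hg v => ?_
  rw [← hμ g hg v, tw_uni ϱ W g (UR_le r hg)]

lemma irr_tw (ϱ : kˣ →* Rˣ) (W : Representation R (GLn n k) VW) (hW : IsIrreducibleRep W) : IsIrreducibleRep (tw ϱ W) := by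
  refine ⟨hW.1, fun p hp => hW.2 p fun g v hv => ?_⟩
  have := p.smul_mem (dch ϱ g) (hp g v hv)
  rw [tw_apply, smul_smul, mul_comm, dch_inv, one_smul] at this
  exact this

lemma whit_tw (ψ : AddChar k R) (ϱ : kˣ →* Rˣ) (W : Representation R (GLn n k) VW) (l : VW →ₗ[R] R) :
    Whit ψ (tw ϱ W) l ↔ Whit ψ W l := by
  refine forall₂_congr fun m hm => forall_congr' fun v => ?_
  rw [tw_uni ϱ W m hm]

/-- multiplicity one -/
lemma mult_one (ψ : AddChar k R) (hψ : ψ.IsPrimitive) (hqR : (Fintype.card k : R) ≠ 0) (ϱ : kˣ →* Rˣ) (W : Representation R (GLn n k) VW)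
    (hs : Sub ϱ W) (l : VW →ₗ[R] R) (hl : Whit ψ W l) (hl0 : l ≠ 0) (l' : VW →ₗ[R] R) (hl' : Whit ψ W l') : ∃ r : R, l' = r • l := by
  obtain ⟨v0, h0, h1, -⟩ := whit_main ψ hψ hqR (tw ϱ W) (Sub_tw ϱ W hs) l ((whit_tw ψ ϱ W l).2 hl) hl0
  refine ⟨l' v0 / l v0, LinearMap.ext fun v => ?_⟩
  have := h1 l' ((whit_tw ψ ϱ W l').2 hl') v
  rw [LinearMap.smul_apply, smul_eq_mul, div_mul_eq_mul_div, eq_div_iff h0, this]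

lemma q_pow (ψ : AddChar k R) (hψ : ψ.IsPrimitive) (hqR : (Fintype.card k : R) ≠ 0) (ϱ : kˣ →* Rˣ) (W : Representation R (GLn n k) VW)
    (hs : Sub ϱ W) (hirr : IsIrreducibleRep W) (hW : Cusp W)
    (l : VW →ₗ[R] R) (hl : Whit ψ W l) (hl0 : l ≠ 0) (u : ℕ) (hu : 1 ≤ u) (hn : n = 2 * u) :
    (Fintype.card k : R) ^ u = -1 :=
  lem_q ψ hψ hqR (tw ϱ W) (Sub_tw ϱ W hs) (irr_tw ϱ W hirr) (Cusp_tw ϱ W hW) l ((whit_tw ψ ϱ W l).2 hl) hl0 u hu hn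

end St14
end
end

section
open scoped Classical
open scoped TensorProduct

noncomputable section

namespace St14

set_option linter.unusedSectionVars false
set_option linter.unusedSimpArgs false
set_option linter.unusedVariables false

variable {n : ℕ} {k : Type} [Field k] [Fintype k] {R : Type} [Field R]
variable {VW : Type} [AddCommGroup VW] [Module R VW]

def InP (p : Fin n → Fin n → Prop) (g : GLn n k) : Prop :=
  ∀ i j, ¬ p i j → (g : Matrix (Fin n) (Fin n) k) i j = (1 : Matrix (Fin n) (Fin n) k) i j

def Tr (p : Fin n → Fin n → Prop) : Prop := ∀ i j l, p i j → p j l → p i l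

lemma inP_one (p : Fin n → Fin n → Prop) : InP p (1 : GLn n k) := fun _ _ _ => rfl

lemma inP_mul (p : Fin n → Fin n → Prop) (hp : Tr p) (g h : GLn n k) (hg : InP p g) (hh : InP p h) : InP p (g * h) := by
  intro i j hij
  have e : ((g * h : GLn n k) : Matrix (Fin n) (Fin n) k) = ((g : Matrix (Fin n) (Fin n) k) - 1) * ((h : Matrix (Fin n) (Fin n) k) - 1)
      + ((g : Matrix (Fin n) (Fin n) k) - 1) + ((h : Matrix (Fin n) (Fin n) k) - 1) + 1 := by
    rw [Units.val_mul]; noncomm_ring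
  rw [e, Matrix.add_apply, Matrix.add_apply, Matrix.add_apply, Matrix.sub_apply, Matrix.sub_apply, hg i j hij, hh i j hij, Matrix.mul_apply,
    Finset.sum_eq_zero, sub_self, zero_add, zero_add, zero_add]
  intro a _
  rw [Matrix.sub_apply, Matrix.sub_apply]
  by_cases h1 : p i a
  · have h2 : ¬ p a j := fun h2 => hij (hp i a j h1 h2)
    rw [hh a j h2, sub_self, mul_zero]
  · rw [hg i a h1, sub_self, zero_mul]

def PS (k : Type) [Field k] [Fintype k] (p : Fin n → Fin n → Prop) (hp : Tr p) : Subgroup (GLn n k) :=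
  subOf (InP p) (inP_one p) (inP_mul p hp)

lemma inP_inv (p : Fin n → Fin n → Prop) (hp : Tr p) (g : GLn n k) (hg : InP p g) : InP p g⁻¹ :=
  (PS k p hp).inv_mem hg

lemma inP_mono (p p' : Fin n → Fin n → Prop) (h : ∀ i j, p i j → p' i j) (g : GLn n k) (hg : InP p g) : InP p' g :=
  fun i j hij => hg i j fun hp => hij (h i j hp)

lemma inP_uni (g : GLn n k) : InP (fun i j => i < j) g ↔ IsUni g := by
  constructor
  · intro h
    exact ⟨fun i j hij => by rw [h i j (not_lt.2 hij.le), Matrix.one_apply_ne (ne_of_gt hij)], fun i => by rw [h i i (lt_irrefl i), Matrix.one_apply_eq]⟩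
  · intro h i j hij
    rcases lt_or_eq_of_le (not_lt.1 hij) with h1 | h1
    · rw [h.1 i j h1, Matrix.one_apply_ne (ne_of_gt h1)]
    · subst h1; rw [h.2, Matrix.one_apply_eq]

variable (sd : Fin n → Bool)

def pH (a i j : Fin n) : Prop := sd i = sd j ∧ i ≤ a ∧ j ≤ a
def pQ (a i j : Fin n) : Prop := sd i = sd j ∧ i < a ∧ j ≤ a
def pY (a i j : Fin n) : Prop := sd i = sd j ∧ i < a ∧ j = a
def pN (a i j : Fin n) : Prop := i < j ∧ a < j
def pU (a i j : Fin n) : Prop := i < a ∧ j = a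

lemma tH (a : Fin n) : Tr (pH sd a) := fun _ _ _ h1 h2 => ⟨h1.1.trans h2.1, h1.2.1, h2.2.2⟩
lemma tQ (a : Fin n) : Tr (pQ sd a) := fun _ _ _ h1 h2 => ⟨h1.1.trans h2.1, h1.2.1, h2.2.2⟩
lemma tY (a : Fin n) : Tr (pY sd a) := fun _ _ _ h1 h2 => ⟨h1.1.trans h2.1, h1.2.1, h2.2.2⟩
lemma tN (a : Fin n) : Tr (pN a) := fun _ _ _ h1 h2 => ⟨h1.1.trans h2.1, h2.2⟩
lemma tU (a : Fin n) : Tr (pU a) := fun _ _ _ h1 h2 => ⟨h1.1, h2.2⟩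

lemma N_uni (a : Fin n) (g : GLn n k) (hg : InP (pN a) g) : IsUni g :=
  (inP_uni g).1 (inP_mono _ _ (fun i j h => h.1) g hg)

lemma U_uni (a : Fin n) (g : GLn n k) (hg : InP (pU a) g) : IsUni g :=
  (inP_uni g).1 (inP_mono _ _ (fun i j h => by rw [h.2]; exact h.1) g hg)

lemma N_conj (a : Fin n) (u g : GLn n k) (hu : IsUni u) (hg : InP (pN a) g) : InP (pN a) (u * g * u⁻¹) := by
  have h1 : IsUni (u * g * u⁻¹) := isUni_mul _ _ (isUni_mul _ _ hu (N_uni a g hg)) (isUni_inv hu)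
  intro i j hij
  by_cases hlt : i < j
  · have hj : j ≤ a := not_lt.1 fun h => hij ⟨hlt, h⟩
    have h2 : ∀ b ≤ a, ((u * g : GLn n k) : Matrix (Fin n) (Fin n) k) i b = (u : Matrix (Fin n) (Fin n) k) i b := by
      intro b hb
      rw [Units.val_mul, Matrix.mul_apply]
      have : ∀ x, (g : Matrix (Fin n) (Fin n) k) x b = (1 : Matrix (Fin n) (Fin n) k) x b := fun x => hg x b fun h => absurd h.2 (not_lt.2 hb)
      simp only [this]
      simp [Matrix.one_apply]
    have h3 : ((u * g * u⁻¹ : GLn n k) : Matrix (Fin n) (Fin n) k) i j = ((u * u⁻¹ : GLn n k) : Matrix (Fin n) (Fin n) k) i j := by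
      rw [Units.val_mul, Units.val_mul u u⁻¹, Matrix.mul_apply, Matrix.mul_apply]
      refine Finset.sum_congr rfl fun b _ => ?_
      by_cases hb : b ≤ j
      · rw [h2 b (hb.trans hj)]
      · rw [(isUni_inv hu).1 b j (not_le.1 hb), mul_zero, mul_zero]
    rw [h3, mul_inv_cancel]; rfl
  · exact (inP_uni _).2 h1 i j hlt

lemma psiN_conj (ψ : AddChar k R) (u g : GLn n k) (hu : IsUni u) (hg : IsUni g) : psiN ψ (u * g * u⁻¹) = psiN ψ g := by
  rw [psiN_mul ψ _ _ (isUni_mul _ _ hu hg) (isUni_inv hu), psiN_mul ψ _ _ hu hg]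
  linear_combination psiN ψ g * psiN_inv ψ u hu

variable (c : Fin n)

def NM (x : Fin n → k) : Matrix (Fin n) (Fin n) k := Matrix.of fun i j => if i < c ∧ j = c then x i else 0

lemma NM_apply (x : Fin n → k) (i j : Fin n) : NM c x i j = if i < c ∧ j = c then x i else 0 := rfl

lemma NM_mul (x y : Fin n → k) : NM c x * NM c y = 0 := by
  ext i j
  rw [Matrix.mul_apply]
  refine Finset.sum_eq_zero fun a _ => ?_
  rw [NM_apply, NM_apply]
  split_ifs with h1 h2
  · exact absurd h2.1 (by rw [h1.2]; exact lt_irrefl c)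
  all_goals simp

lemma NM_add (x y : Fin n → k) : NM c (x + y) = NM c x + NM c y := by
  ext i j
  rw [Matrix.add_apply, NM_apply, NM_apply, NM_apply]
  split_ifs <;> simp

lemma NM_zero : NM c (0 : Fin n → k) = 0 := by
  ext i j
  rw [NM_apply]; split_ifs <;> rfl

lemma uM_mul (x y : Fin n → k) : (1 + NM c x) * (1 + NM c y) = 1 + NM c (x + y) := by
  rw [NM_add, mul_add, add_mul, add_mul, mul_one, mul_one, one_mul, NM_mul, add_zero, add_assoc]

def uG (x : Fin n → k) : GLn n k where
  val := 1 + NM c x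
  inv := 1 + NM c (-x)
  val_inv := by rw [uM_mul, add_neg_cancel, NM_zero, add_zero]
  inv_val := by rw [uM_mul, neg_add_cancel, NM_zero, add_zero]

lemma uG_val (x : Fin n → k) : (uG c x : Matrix (Fin n) (Fin n) k) = 1 + NM c x := rfl

lemma uG_mul (x y : Fin n → k) : uG c x * uG c y = uG c (x + y) := Units.ext (uM_mul c x y)

lemma uG_zero : uG c (0 : Fin n → k) = 1 := Units.ext (by rw [uG_val, NM_zero, add_zero]; rfl)

lemma uG_inv (x : Fin n → k) : (uG c x)⁻¹ = uG c (-x) := by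
  rw [inv_eq_iff_mul_eq_one, uG_mul, add_neg_cancel, uG_zero]

lemma uG_comm (x y : Fin n → k) : uG c x * uG c y = uG c y * uG c x := by rw [uG_mul, uG_mul, add_comm]

lemma uG_apply (x : Fin n → k) (i j : Fin n) : (uG c x : Matrix (Fin n) (Fin n) k) i j = (1 : Matrix (Fin n) (Fin n) k) i j + if i < c ∧ j = c then x i else 0 := rfl

lemma uG_inU (x : Fin n → k) : InP (pU c) (uG c x) := by
  intro i j h
  have h' : ¬ (i < c ∧ j = c) := h
  rw [uG_apply, if_neg h', add_zero]

lemma uG_uni (x : Fin n → k) : IsUni (uG c x) := U_uni c _ (uG_inU c x)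

lemma uG_inQ (x : Fin n → k) (hx : ∀ i, i < c → sd i ≠ sd c → x i = 0) : InP (pY sd c) (uG c x) := by
  intro i j h
  rw [uG_apply]
  split_ifs with h1
  · rw [hx i h1.1 (fun h2 => h ⟨by rw [h2, h1.2], h1.1, h1.2⟩), add_zero]
  · rw [add_zero]

lemma Y_Q (g : GLn n k) (hg : InP (pY sd c) g) : InP (pQ sd c) g :=
  inP_mono _ _ (fun i j h => ⟨h.1, h.2.1, h.2.2.le⟩) g hg

lemma H_Q (r c : Fin n) (hrc : (r : ℕ) + 1 = c) (g : GLn n k) (hg : InP (pH sd r) g) : InP (pQ sd c) g := by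
  refine inP_mono _ _ (fun i j h => ⟨h.1, ?_, ?_⟩) g hg
  · have := h.2.1; rw [Fin.le_def] at this; rw [Fin.lt_def]; omega
  · have := h.2.2; rw [Fin.le_def] at this ⊢; omega

lemma Q_H (r : Fin n) (g : GLn n k) (hg : InP (pQ sd r) g) : InP (pH sd r) g :=
  inP_mono _ _ (fun i j h => ⟨h.1, h.2.1.le, h.2.2⟩) g hg

lemma H_comm (r c : Fin n) (hrc : (r : ℕ) + 1 = c) (g : GLn n k) (hg : InP (pH sd r) g) (x : Fin n → k) :
    g * uG c x = uG c (Matrix.mulVec (g : Matrix (Fin n) (Fin n) k) x) * g := by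
  have hg' : ∀ i j, ¬ (i < c ∧ j < c) → (g : Matrix (Fin n) (Fin n) k) i j = (1 : Matrix (Fin n) (Fin n) k) i j := by
    intro i j h
    refine hg i j fun h2 => h ⟨?_, ?_⟩
    · have := h2.2.1; rw [Fin.le_def] at this; rw [Fin.lt_def]; omega
    · have := h2.2.2; rw [Fin.le_def] at this; rw [Fin.lt_def]; omega
  apply Units.ext
  rw [Units.val_mul, Units.val_mul, uG_val, uG_val, mul_add, add_mul, mul_one, one_mul]
  congr 1
  ext i j
  rw [Matrix.mul_apply, Matrix.mul_apply]
  simp only [NM_apply]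
  have e2 : ∑ a, (if i < c ∧ a = c then Matrix.mulVec (g : Matrix (Fin n) (Fin n) k) x i else 0) * (g : Matrix (Fin n) (Fin n) k) a j
      = if i < c ∧ j = c then Matrix.mulVec (g : Matrix (Fin n) (Fin n) k) x i else 0 := by
    rw [Finset.sum_eq_single c]
    · rw [hg' c j (fun h => lt_irrefl c h.1), Matrix.one_apply]
      rcases eq_or_ne j c with h2 | h2
      · subst h2; by_cases h1 : i < j <;> simp [h1]
      · simp [h2, h2.symm]
    · intro a _ ha; simp [ha]
    · intro h; exact absurd (Finset.mem_univ c) h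
  rw [e2]
  by_cases h2 : j = c
  · by_cases h1 : i < c
    · simp only [h1, h2, and_self, and_true, if_true]
      rw [Matrix.mulVec, dotProduct]
      refine Finset.sum_congr rfl fun a _ => ?_
      by_cases h3 : a < c
      · rw [if_pos h3]
      · rw [if_neg h3, hg' i a (fun h => h3 h.2), Matrix.one_apply_ne (fun e : i = a => h3 (e ▸ h1))]; simp
    · rw [if_neg (fun h => h1 h.1)]
      refine Finset.sum_eq_zero fun a _ => ?_
      by_cases h3 : a < c
      · rw [hg' i a (fun h => h1 h.1), Matrix.one_apply_ne (fun e : i = a => h1 (e ▸ h3)), zero_mul]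
      · rw [if_neg (fun h => h3 h.1), mul_zero]
  · simp [h2]

/-- factorisation of `N_{c-1}` -/
lemma N_fac (r c : Fin n) (hrc : (r : ℕ) + 1 = c) (g : GLn n k) (hg : InP (pN r) g) :
    InP (pN c) (g * (uG c (fun i => (g : Matrix (Fin n) (Fin n) k) i c))⁻¹) := by
  set x : Fin n → k := fun i => (g : Matrix (Fin n) (Fin n) k) i c with hx
  have hu := N_uni r g hg
  have h1 : IsUni (g * (uG c x)⁻¹) := isUni_mul _ _ hu (isUni_inv (uG_uni c x))
  intro i j hij
  by_cases hlt : i < j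
  · have hj : j ≤ c := not_lt.1 fun h => hij ⟨hlt, h⟩
    have h2 : ∀ i b, b < c → (g : Matrix (Fin n) (Fin n) k) i b = (1 : Matrix (Fin n) (Fin n) k) i b := by
      intro i b hb
      refine hg i b fun h => ?_
      have := h.2; rw [Fin.lt_def] at this hb; omega
    rw [uG_inv, Units.val_mul, uG_val, mul_add, mul_one, Matrix.add_apply, Matrix.mul_apply]
    have h3 : ∀ a, (g : Matrix (Fin n) (Fin n) k) i a * NM c (-x) a j = if a = i then (if i < c ∧ j = c then - x i else 0) else 0 := by
      intro a
      rw [NM_apply]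
      by_cases ha : a < c
      · rw [h2 i a ha, Matrix.one_apply]
        by_cases hai : a = i
        · subst hai; simp
        · rw [if_neg (fun h => hai h.symm), if_neg hai, zero_mul]
      · rw [if_neg (fun h => ha h.1), mul_zero]
        by_cases hai : a = i
        · subst hai; simp [ha]
        · rw [if_neg hai]
    rw [Finset.sum_congr rfl (fun a _ => h3 a), Finset.sum_ite_eq']
    simp only [Finset.mem_univ, if_true]
    rw [Matrix.one_apply_ne (ne_of_lt hlt)]
    rcases lt_or_eq_of_le hj with h4 | h4
    · rw [if_neg (fun h => (ne_of_lt h4) h.2), add_zero, h2 i j h4, Matrix.one_apply_ne (ne_of_lt hlt)]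
    · subst h4
      rw [if_pos ⟨hlt, rfl⟩, add_neg_cancel]
  · exact (inP_uni _).2 h1 i j hlt

lemma sdg_UR (r c : Fin n) (hrc : (r : ℕ) + 1 = c) (g : GLn n k) (hg : IsUR (c : ℕ) g) :
    sdg (g : Matrix (Fin n) (Fin n) k) = (g : Matrix (Fin n) (Fin n) k) r c := by
  rw [sdg, Finset.sum_eq_single r]
  · rw [Finset.sum_eq_single c]
    · rw [if_pos hrc]
    · intro j _ hj
      rw [if_neg]
      intro h; apply hj; apply Fin.ext; omega
    · intro h; exact absurd (Finset.mem_univ c) h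
  · intro i _ hi
    refine Finset.sum_eq_zero fun j _ => ?_
    split_ifs with h
    · have hir : (i : ℕ) ≠ r := fun e => hi (Fin.ext e)
      rw [hg i j (by omega)]
      exact Matrix.one_apply_ne (fun e => by rw [e] at h; omega)
    · rfl
  · intro h; exact absurd (Finset.mem_univ r) h

end St14
end
end

section
open scoped Classical
open scoped TensorProduct

noncomputable section

namespace St14

set_option linter.unusedSectionVars false
set_option linter.unusedSimpArgs false
set_option linter.unusedVariables false

variable {n : ℕ} {k : Type} [Field k] [Fintype k] {R : Type} [Field R]
variable {VW : Type} [AddCommGroup VW] [Module R VW]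

section fourier

variable (ψ : AddChar k R) (W : Representation R (GLn n k) VW) (c : Fin n) (μ : VW →ₗ[R] R)

def muT (θ : Fin n → k) : VW →ₗ[R] R := ∑ x : Fin n → k, ψ (-(θ ⬝ᵥ x)) • (μ ∘ₗ W (uG c x))

lemma muT_apply (θ : Fin n → k) (v : VW) : muT ψ W c μ θ v = ∑ x : Fin n → k, ψ (-(θ ⬝ᵥ x)) * μ (W (uG c x) v) := by
  rw [muT, LinearMap.sum_apply]; rfl

lemma four (hψ : ψ.IsPrimitive) (x : Fin n → k) : ∑ θ : Fin n → k, ψ (-(θ ⬝ᵥ x)) = if x = 0 then (Fintype.card k : R) ^ n else 0 := by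
  have h1 : ∀ θ : Fin n → k, ψ (-(θ ⬝ᵥ x)) = ∏ i, ψ (θ i * (-x i)) := by
    intro θ
    rw [← ach_sum, dotProduct, ← Finset.sum_neg_distrib]
    simp only [mul_neg]
  rw [Finset.sum_congr rfl (fun θ _ => h1 θ), sum_prod_pi (fun i a => ψ (a * (-x i)))]
  simp only [AddChar.sum_mulShift _ hψ, neg_eq_zero]
  split_ifs with hx
  · subst hx; simp
  · obtain ⟨i, hi⟩ := Function.ne_iff.1 hx
    refine Finset.prod_eq_zero (Finset.mem_univ i) ?_
    have hi' : x i ≠ 0 := hi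
    simp [hi']

lemma muT_sum (hψ : ψ.IsPrimitive) (v : VW) : ∑ θ, muT ψ W c μ θ v = (Fintype.card k : R) ^ n * μ v := by
  simp only [muT_apply]
  rw [Finset.sum_comm]
  simp only [← Finset.sum_mul, four ψ hψ]
  rw [Finset.sum_eq_single 0]
  · rw [if_pos rfl, uG_zero, map_one]; rfl
  · intro x _ hx; rw [if_neg hx, zero_mul]
  · intro h; exact absurd (Finset.mem_univ _) h

lemma muT_U (θ y : Fin n → k) (v : VW) : muT ψ W c μ θ (W (uG c y) v) = ψ (θ ⬝ᵥ y) * muT ψ W c μ θ v := by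
  rw [muT_apply, muT_apply, ← Equiv.sum_comp (Equiv.addRight y) (fun x => ψ (-(θ ⬝ᵥ x)) * μ (W (uG c x) v)), Finset.mul_sum]
  refine Finset.sum_congr rfl fun x _ => ?_
  rw [Equiv.coe_addRight, ← rep_mul, uG_mul, dotProduct_add, ← mul_assoc, ← AddChar.map_add_eq_mul]
  congr 2
  ring

variable (sd : Fin n → Bool)

def QInv : Prop := ∀ g : GLn n k, InP (pQ sd c) g → ∀ v, μ (W g v) = μ v
def NEq : Prop := ∀ g : GLn n k, InP (pN c) g → ∀ v, μ (W g v) = psiN ψ g * μ v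

lemma muT_H (r : Fin n) (hrc : (r : ℕ) + 1 = c) (hQ : QInv W c μ sd) (g : GLn n k) (hg : InP (pH sd r) g) (θ : Fin n → k) (v : VW) :
    muT ψ W c μ θ (W g v) = muT ψ W c μ (Matrix.vecMul θ (g : Matrix (Fin n) (Fin n) k)) v := by
  rw [muT_apply, muT_apply, ← Equiv.sum_comp (mvE g)]
  refine Finset.sum_congr rfl fun x _ => ?_
  have e : mvE g x = Matrix.mulVec (g : Matrix (Fin n) (Fin n) k) x := rfl
  rw [← rep_mul, e, ← H_comm sd r c hrc g hg, rep_mul, hQ g (H_Q sd r c hrc g hg), Matrix.dotProduct_mulVec]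

lemma muT_N (hN : NEq ψ W c μ) (g : GLn n k) (hg : InP (pN c) g) (θ : Fin n → k) (v : VW) :
    muT ψ W c μ θ (W g v) = psiN ψ g * muT ψ W c μ θ v := by
  rw [muT_apply, muT_apply, Finset.mul_sum]
  refine Finset.sum_congr rfl fun x _ => ?_
  have e : uG c x * g = (uG c x * g * (uG c x)⁻¹) * uG c x := by group
  rw [← rep_mul, e, rep_mul, hN _ (N_conj c _ g (uG_uni c x) hg), psiN_conj ψ _ _ (uG_uni c x) (N_uni c g hg)]
  ring

lemma uG_UR (x : Fin n → k) : IsUR (c : ℕ) (uG c x) := by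
  intro i j h
  refine uG_inU c x i j fun h2 => h ⟨h2.1, ?_⟩
  rw [h2.2]

lemma psiN_uG (r : Fin n) (hrc : (r : ℕ) + 1 = c) (x : Fin n → k) : psiN ψ (uG c x) = ψ (x r) := by
  rw [psiN, sdg_UR r c hrc _ (uG_UR c x), uG_apply, if_pos ⟨adj_lt hrc, rfl⟩, Matrix.one_apply_ne (ne_of_lt (adj_lt hrc)), zero_add]

lemma psi_ne (t : k) : ψ t ≠ 0 := by
  intro h
  have := AddChar.map_add_eq_mul ψ t (-t)
  rw [h, zero_mul, add_neg_cancel, AddChar.map_zero_eq_one] at this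
  exact one_ne_zero this

lemma muT_Nr (r : Fin n) (hrc : (r : ℕ) + 1 = c) (hN : NEq ψ W c μ) (g : GLn n k) (hg : InP (pN r) g) (θ : Fin n → k) (v : VW) :
    ψ ((g : Matrix (Fin n) (Fin n) k) r c) * muT ψ W c μ θ (W g v)
      = psiN ψ g * ψ (θ ⬝ᵥ (fun i => (g : Matrix (Fin n) (Fin n) k) i c)) * muT ψ W c μ θ v := by
  set x : Fin n → k := fun i => (g : Matrix (Fin n) (Fin n) k) i c with hx
  have e : g = (g * (uG c x)⁻¹) * uG c x := by group
  have h1 := N_fac r c hrc g hg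
  have h2 : psiN ψ g = psiN ψ (g * (uG c x)⁻¹) * psiN ψ (uG c x) := by
    conv_lhs => rw [e]
    exact psiN_mul ψ _ _ (N_uni c _ h1) (uG_uni c x)
  have h3 : muT ψ W c μ θ (W g v) = psiN ψ (g * (uG c x)⁻¹) * (ψ (θ ⬝ᵥ x) * muT ψ W c μ θ v) := by
    conv_lhs => rw [e]
    rw [rep_mul, muT_N ψ W c μ hN _ h1, muT_U]
  rw [h3, h2, psiN_uG ψ c r hrc x]
  ring

lemma muT_bad (hψ : ψ.IsPrimitive) (hQ : QInv W c μ sd) (θ : Fin n → k) (i : Fin n) (hi : i < c → sd i = sd c) (h0 : θ i ≠ 0) :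
    muT ψ W c μ θ = 0 := by
  obtain ⟨t, ht⟩ := psi_nt ψ hψ
  set y : Fin n → k := Pi.single i ((θ i)⁻¹ * t) with hy
  have hy2 : θ ⬝ᵥ y = t := by rw [hy, dotProduct_single, mul_inv_cancel_left₀ h0]
  have hyQ : InP (pQ sd c) (uG c y) := by
    refine Y_Q sd c _ (uG_inQ sd c y fun j hj hne => ?_)
    have : j ≠ i := fun e => hne (by rw [e]; exact hi (e ▸ hj))
    rw [hy, Pi.single_eq_of_ne this]
  ext v
  have h1 := muT_U ψ W c μ θ y v
  have h2 : muT ψ W c μ θ (W (uG c y) v) = muT ψ W c μ θ v := by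
    rw [muT_apply, muT_apply]
    refine Finset.sum_congr rfl fun x _ => ?_
    rw [← rep_mul, uG_comm, rep_mul, hQ _ hyQ]
  rw [h2, hy2] at h1
  rw [LinearMap.zero_apply]
  by_contra h
  exact ht (mul_right_cancel₀ h (by rw [one_mul, ← h1]))

lemma muT_zero (r : Fin n) (hrc : (r : ℕ) + 1 = c) (hW : Cusp W) (hN : NEq ψ W c μ) : muT ψ W c μ 0 = 0 := by
  refine hW c (by omega) c.2 _ fun g hg v => ?_
  have hgN : InP (pN r) g := by
    intro i j h
    refine hg i j fun h2 => h ⟨?_, ?_⟩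
    · rw [Fin.lt_def]; omega
    · rw [Fin.lt_def]; omega
  have h1 := muT_Nr ψ W c μ r hrc hN g hgN 0 v
  rw [psiN, sdg_UR r c hrc g hg, zero_dotProduct, AddChar.map_zero_eq_one, mul_one] at h1
  exact mul_left_cancel₀ (psi_ne ψ _) h1

end fourier

lemma exists_row (sd : Fin n → Bool) (r : Fin n) (θ : Fin n → k) (h0 : θ ≠ 0) (h : ∀ i, ¬ (i ≤ r ∧ sd i = sd r) → θ i = 0) :
    ∃ g : GLn n k, InP (pH sd r) g ∧ (g : Matrix (Fin n) (Fin n) k) r = θ := by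
  obtain ⟨i, hi⟩ := Function.ne_iff.1 h0
  have hir : i ≤ r ∧ sd i = sd r := by by_contra h2; exact hi (h i h2)
  have hdet : (Matrix.updateRow (1 : Matrix (Fin n) (Fin n) k) i θ).det = θ i := by
    have e : Matrix.updateRow (1 : Matrix (Fin n) (Fin n) k) i θ = Matrix.updateRow 1 i (Matrix.vecMul θ 1) := by rw [Matrix.vecMul_one]
    rw [e, Matrix.vecMul_eq_sum, Matrix.det_updateRow_sum]
    simp
  let M : GLn n k := Matrix.GeneralLinearGroup.mkOfDetNeZero (Matrix.updateRow (1 : Matrix (Fin n) (Fin n) k) i θ) (by rw [hdet]; exact hi)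
  have hM : (M : Matrix (Fin n) (Fin n) k) = Matrix.updateRow (1 : Matrix (Fin n) (Fin n) k) i θ := rfl
  refine ⟨Pm k (Equiv.swap r i) * M, inP_mul _ (tH sd r) _ _ ?_ ?_, ?_⟩
  · intro a b hab
    rw [Pm_val, PmM_apply]
    by_cases hb : b = r ∨ b = i
    · have hb1 : sd b = sd r ∧ b ≤ r := by
        rcases hb with rfl | rfl
        · exact ⟨rfl, le_rfl⟩
        · exact ⟨hir.2, hir.1⟩
      have hc : ∀ c, c = r ∨ c = i → a ≠ c := by
        rintro c hc rfl
        apply hab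
        have : sd a = sd r ∧ a ≤ r := by
          rcases hc with rfl | rfl
          · exact ⟨rfl, le_rfl⟩
          · exact ⟨hir.2, hir.1⟩
        exact ⟨by rw [this.1, hb1.1], this.2, hb1.2⟩
      rw [Matrix.one_apply_ne (hc b hb), Matrix.one_apply_ne (hc _ ?_)]
      rcases hb with rfl | rfl
      · right; simp
      · left; simp
    · push Not at hb
      rw [Equiv.swap_apply_of_ne_of_ne hb.1 hb.2]
  · intro a b hab
    rw [hM]
    by_cases ha : a = i
    · subst ha
      rw [Matrix.updateRow_self]
      have hb : ¬ (b ≤ r ∧ sd b = sd r) := fun hb => hab ⟨by rw [hir.2, hb.2], hir.1, hb.1⟩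
      rw [h b hb, Matrix.one_apply_ne]
      rintro rfl
      exact hb hir
    · rw [Matrix.updateRow_ne ha]
  · ext b
    rw [Units.val_mul, Pm_val, PmM_mul_apply, hM]
    rw [show (Equiv.swap r i)⁻¹ r = i by simp, Matrix.updateRow_self]

lemma row_valid (sd : Fin n → Bool) (r : Fin n) (g : GLn n k) (hg : InP (pH sd r) g) :
    (g : Matrix (Fin n) (Fin n) k) r ≠ 0 ∧ ∀ i, ¬ (i ≤ r ∧ sd i = sd r) → (g : Matrix (Fin n) (Fin n) k) r i = 0 := by
  constructor
  · intro h
    have h1 : (g : Matrix (Fin n) (Fin n) k) * ((g⁻¹ : GLn n k) : Matrix (Fin n) (Fin n) k) = 1 := Units.mul_inv g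
    have h2 := congrFun (congrFun h1 r) r
    rw [Matrix.mul_apply, Matrix.one_apply_eq] at h2
    simp only [h, Pi.zero_apply, zero_mul, Finset.sum_const_zero] at h2
    exact zero_ne_one h2
  · intro i hi
    rw [hg r i (fun h => hi ⟨h.2.2, h.1.symm⟩), Matrix.one_apply_ne]
    rintro rfl
    exact hi ⟨le_rfl, rfl⟩

lemma Q_row (sd : Fin n → Bool) (r : Fin n) (g : GLn n k) : InP (pQ sd r) g ↔ InP (pH sd r) g ∧ (g : Matrix (Fin n) (Fin n) k) r = (1 : Matrix (Fin n) (Fin n) k) r := by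
  constructor
  · intro h
    exact ⟨Q_H sd r g h, funext fun j => h r j fun h2 => lt_irrefl r h2.2.1⟩
  · rintro ⟨h1, h2⟩ i j h
    by_cases hi : i = r
    · subst hi; exact congrFun h2 j
    · refine h1 i j fun h3 => h ⟨h3.1, lt_of_le_of_ne h3.2.1 hi, h3.2.2⟩

lemma mul_row (r : Fin n) (g h : GLn n k) (hg : (g : Matrix (Fin n) (Fin n) k) r = (1 : Matrix (Fin n) (Fin n) k) r) :
    ((g * h : GLn n k) : Matrix (Fin n) (Fin n) k) r = (h : Matrix (Fin n) (Fin n) k) r := by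
  ext j
  have e : (h : Matrix (Fin n) (Fin n) k) = 1 * (h : Matrix (Fin n) (Fin n) k) := (one_mul _).symm
  conv_rhs => rw [e]
  rw [Units.val_mul, Matrix.mul_apply, Matrix.mul_apply, hg]

lemma row_sum (sd : Fin n → Bool) (r : Fin n) (g0 : GLn n k) (hg0 : InP (pH sd r) g0) (F : GLn n k → R) :
    ∑ h : PS k (pH sd r) (tH sd r), (if ((h : GLn n k) : Matrix (Fin n) (Fin n) k) r = (g0 : Matrix (Fin n) (Fin n) k) r then F h else 0)
      = ∑ g : PS k (pQ sd r) (tQ sd r), F (g * g0) := by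
  rw [← Finset.sum_filter]
  symm
  refine Finset.sum_bij (fun g _ => (⟨g * g0, inP_mul _ (tH sd r) _ _ (Q_H sd r _ g.2) hg0⟩ : PS k (pH sd r) (tH sd r))) ?_ ?_ ?_ ?_
  · intro g _
    rw [Finset.mem_filter]
    exact ⟨Finset.mem_univ _, mul_row r (g : GLn n k) g0 ((Q_row sd r (g : GLn n k)).1 g.2).2⟩
  · intro a _ b _ hab
    exact Subtype.ext (mul_right_cancel (Subtype.ext_iff.1 hab))
  · intro h hh
    rw [Finset.mem_filter] at hh
    refine ⟨⟨h * g0⁻¹, (Q_row sd r _).2 ⟨inP_mul _ (tH sd r) _ _ h.2 (inP_inv _ (tH sd r) _ hg0), ?_⟩⟩, Finset.mem_univ _, ?_⟩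
    · have e : ((g0 * g0⁻¹ : GLn n k) : Matrix (Fin n) (Fin n) k) r = (1 : Matrix (Fin n) (Fin n) k) r := by rw [mul_inv_cancel]; rfl
      rw [← e]
      ext j
      rw [Units.val_mul, Units.val_mul, Matrix.mul_apply, Matrix.mul_apply, hh.2]
    · apply Subtype.ext; simp
  · intro g _; rfl

end St14
end
end

section
open scoped Classical
open scoped TensorProduct

noncomputable section

namespace St14

set_option linter.unusedSectionVars false
set_option linter.unusedSimpArgs false
set_option linter.unusedVariables false

variable {n : ℕ} {k : Type} [Field k] [Fintype k] {R : Type} [Field R]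
variable {VW : Type} [AddCommGroup VW] [Module R VW]

lemma H_col (sd : Fin n → Bool) (r c : Fin n) (hrc : (r : ℕ) + 1 = c) (y g : GLn n k) (hg : InP (pH sd r) g) (i : Fin n) :
    ((y * g : GLn n k) : Matrix (Fin n) (Fin n) k) i c = (y : Matrix (Fin n) (Fin n) k) i c := by
  have : ∀ a, (g : Matrix (Fin n) (Fin n) k) a c = (1 : Matrix (Fin n) (Fin n) k) a c := by
    intro a
    refine hg a c fun h => ?_
    have := h.2.2; rw [Fin.le_def] at this; omega
  rw [Units.val_mul, Matrix.mul_apply]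
  simp only [this]
  simp [Matrix.one_apply]

lemma YH_bij (sd : Fin n → Bool) (r c : Fin n) (hrc : (r : ℕ) + 1 = c) :
    Function.Bijective (fun z : PS k (pY sd c) (tY sd c) × PS k (pH sd r) (tH sd r) =>
      (⟨(z.1 : GLn n k) * z.2, inP_mul _ (tQ sd c) _ _ (Y_Q sd c _ z.1.2) (H_Q sd r c hrc _ z.2.2)⟩ : PS k (pQ sd c) (tQ sd c))) := by
  constructor
  · rintro ⟨y, g⟩ ⟨y', g'⟩ h
    have h1 : (y : GLn n k) * g = y' * g' := Subtype.ext_iff.1 h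
    have h2 : (y : GLn n k) = y' := by
      apply Units.ext
      ext i j
      by_cases hj : j = c
      · subst hj
        rw [← H_col sd r j hrc (y : GLn n k) g g.2, ← H_col sd r j hrc (y' : GLn n k) g' g'.2, h1]
      · rw [y.2 i j (fun h => hj h.2.2), y'.2 i j (fun h => hj h.2.2)]
    rw [h2] at h1
    exact Prod.ext (Subtype.ext h2) (Subtype.ext (mul_left_cancel h1))
  · intro h
    set x : Fin n → k := fun i => ((h : GLn n k) : Matrix (Fin n) (Fin n) k) i c with hx
    have hy : InP (pY sd c) (uG c x) := by
      refine uG_inQ sd c x fun i hi hne => ?_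
      rw [hx]
      exact (h.2 i c (fun h => hne h.1)).trans (Matrix.one_apply_ne (ne_of_lt hi))
    have hcol : ∀ a, ((h : GLn n k) : Matrix (Fin n) (Fin n) k) a c = (uG c x : Matrix (Fin n) (Fin n) k) a c := by
      intro a
      rw [uG_apply]
      by_cases ha : a < c
      · rw [if_pos ⟨ha, rfl⟩, Matrix.one_apply_ne (ne_of_lt ha), zero_add]
      · rw [if_neg (fun h => ha h.1), add_zero]
        exact h.2 a c fun h => ha h.2.1
    have hg : InP (pH sd r) ((uG c x)⁻¹ * (h : GLn n k)) := by
      intro i j hij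
      by_cases hQ : pQ sd c i j
      · have hjc : j = c := by
          by_contra hne
          apply hij
          refine ⟨hQ.1, ?_, ?_⟩
          · have := hQ.2.1; rw [Fin.lt_def] at this; rw [Fin.le_def]; omega
          · have := hQ.2.2; rw [Fin.le_def] at this ⊢
            have : (j : ℕ) ≠ c := fun e => hne (Fin.ext e)
            omega
        subst hjc
        have e : (((uG j x)⁻¹ * uG j x : GLn n k) : Matrix (Fin n) (Fin n) k) i j = (1 : Matrix (Fin n) (Fin n) k) i j := by
          rw [inv_mul_cancel]; rfl
        rw [← e, Units.val_mul, Units.val_mul, Matrix.mul_apply, Matrix.mul_apply]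
        simp only [hcol]
      · exact inP_mul _ (tQ sd c) _ _ (inP_inv _ (tQ sd c) _ (Y_Q sd c _ hy)) h.2 i j hQ
    refine ⟨(⟨uG c x, hy⟩, ⟨(uG c x)⁻¹ * (h : GLn n k), hg⟩), ?_⟩
    apply Subtype.ext
    simp

variable (ψ : AddChar k R) (W : Representation R (GLn n k) VW) (sd : Fin n → Bool) (l : VW →ₗ[R] R)

def SQ (a : Fin n) : VW →ₗ[R] R := ∑ g : PS k (pQ sd a) (tQ sd a), l ∘ₗ W (g : GLn n k)

lemma SQ_apply (a : Fin n) (v : VW) : SQ W sd l a v = ∑ g : PS k (pQ sd a) (tQ sd a), l (W (g : GLn n k) v) := by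
  rw [SQ, LinearMap.sum_apply]; rfl

def Claim (a : Fin n) : Prop := ∀ μ : VW →ₗ[R] R, QInv W a μ sd → NEq ψ W a μ → ∃ t : R, μ = t • SQ W sd l a

lemma claim_step (hψ : ψ.IsPrimitive) (hqR : (Fintype.card k : R) ≠ 0) (hW : Cusp W) (r c : Fin n) (hrc : (r : ℕ) + 1 = c)
    (hsd : sd r ≠ sd c) (ih : Claim ψ W sd l r) : Claim ψ W sd l c := by
  intro μ hQ hN
  obtain ⟨t, ht⟩ := ih (muT ψ W c μ (Pi.single r 1)) (by
      intro g hg v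
      rw [muT_H ψ W c μ sd r hrc hQ g (Q_H sd r g hg)]
      congr 2
      rw [Matrix.single_one_vecMul]
      ext j
      rw [Matrix.row_apply, congrFun ((Q_row sd r g).1 hg).2 j, Matrix.one_apply, Pi.single_apply]
      simp only [eq_comm]) (by
      intro g hg v
      have h1 := muT_Nr ψ W c μ r hrc hN g hg (Pi.single r 1) v
      rw [single_one_dotProduct] at h1
      apply mul_left_cancel₀ (psi_ne ψ ((g : Matrix (Fin n) (Fin n) k) r c))
      rw [h1]; ring)
  have key : ∀ (θ : Fin n → k) (v : VW), muT ψ W c μ θ v = t * ∑ h : PS k (pH sd r) (tH sd r),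
      (if ((h : GLn n k) : Matrix (Fin n) (Fin n) k) r = θ then l (W (h : GLn n k) v) else 0) := by
    intro θ v
    by_cases hval : θ ≠ 0 ∧ ∀ i, ¬ (i ≤ r ∧ sd i = sd r) → θ i = 0
    · obtain ⟨g0, hg0, rfl⟩ := exists_row sd r θ hval.1 hval.2
      rw [row_sum sd r g0 hg0 (fun h => l (W h v))]
      have h1 := muT_H ψ W c μ sd r hrc hQ g0 hg0 (Pi.single r 1) v
      rw [Matrix.single_one_vecMul] at h1
      change _ = muT ψ W c μ ((g0 : Matrix (Fin n) (Fin n) k) r) v at h1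
      rw [← h1, ht, LinearMap.smul_apply, smul_eq_mul, SQ_apply]
      simp only [rep_mul]
    · rw [Finset.sum_eq_zero, mul_zero]
      · by_cases h0 : θ = 0
        · rw [h0, muT_zero ψ W c μ r hrc hW hN, LinearMap.zero_apply]
        · have : ∃ i, ¬ (i ≤ r ∧ sd i = sd r) ∧ θ i ≠ 0 := by
            by_contra h2
            push Not at h2
            exact hval ⟨h0, fun i hi => h2 i (fun h3 h4 => hi ⟨h3, h4⟩)⟩
          obtain ⟨i, hi, hi0⟩ := this
          rw [muT_bad ψ W c μ sd hψ hQ θ i ?_ hi0, LinearMap.zero_apply]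
          intro hic
          have hle : i ≤ r := by rw [Fin.lt_def] at hic; rw [Fin.le_def]; omega
          have hne : sd i ≠ sd r := fun e => hi ⟨hle, e⟩
          revert hne hsd
          cases sd i <;> cases sd r <;> cases sd c <;> simp
      · intro h _
        rw [if_neg]
        rintro rfl
        exact hval (row_valid sd r (h : GLn n k) h.2)
  have h2 : ∀ v, (Fintype.card k : R) ^ n * μ v = t * ∑ h : PS k (pH sd r) (tH sd r), l (W (h : GLn n k) v) := by
    intro v
    rw [← muT_sum ψ W c μ hψ v]
    simp only [key]
    rw [← Finset.mul_sum, Finset.sum_comm]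
    congr 1
    refine Finset.sum_congr rfl fun h _ => ?_
    rw [Finset.sum_ite_eq]
    simp
  have hY : (Fintype.card (PS k (pY sd c) (tY sd c)) : R) ≠ 0 := by
    refine card_unip hqR _ fun g hg => ?_
    exact (inP_uni g).1 (inP_mono _ _ (fun i j h => by rw [h.2.2]; exact h.2.1) g hg)
  have h3 : ∀ v, (Fintype.card (PS k (pY sd c) (tY sd c)) : R) * ((Fintype.card k : R) ^ n * μ v) = t * SQ W sd l c v := by
    intro v
    have e1 : (Fintype.card (PS k (pY sd c) (tY sd c)) : R) * ((Fintype.card k : R) ^ n * μ v)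
        = ∑ y : PS k (pY sd c) (tY sd c), (Fintype.card k : R) ^ n * μ (W ((y : GLn n k)⁻¹) v) := by
      rw [← nsmul_eq_mul, ← Finset.card_univ, ← Finset.sum_const]
      refine Finset.sum_congr rfl fun y _ => ?_
      rw [hQ _ (inP_inv _ (tQ sd c) _ (Y_Q sd c _ y.2))]
    rw [e1, Finset.sum_congr rfl (fun y _ => h2 _), ← Finset.mul_sum, SQ_apply]
    congr 1
    rw [← Equiv.sum_comp (Equiv.inv (PS k (pQ sd c) (tQ sd c)))]
    rw [← Function.Bijective.sum_comp (YH_bij sd r c hrc), Fintype.sum_prod_type]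
    refine Finset.sum_congr rfl fun y _ => ?_
    rw [← Equiv.sum_comp (Equiv.inv (PS k (pH sd r) (tH sd r)))]
    refine Finset.sum_congr rfl fun g _ => ?_
    rw [← rep_mul]
    congr 2
  refine ⟨t / ((Fintype.card (PS k (pY sd c) (tY sd c)) : R) * (Fintype.card k : R) ^ n), LinearMap.ext fun v => ?_⟩
  have hq := q_ne hqR n
  rw [LinearMap.smul_apply, smul_eq_mul, div_mul_eq_mul_div, eq_div_iff (mul_ne_zero hY hq), ← h3 v]
  ring

lemma claim_base (hl : ∀ l', Whit ψ W l' → ∃ t : R, l' = t • l) (a : Fin n) (ha : (a : ℕ) = 0) : Claim ψ W sd l a := by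
  intro μ hQ hN
  obtain ⟨t, ht⟩ := hl μ (by
    intro m hm v
    refine hN m (inP_mono _ _ (fun i j h => ⟨h, ?_⟩) m ((inP_uni m).2 hm)) v
    rw [Fin.lt_def] at h ⊢; omega)
  refine ⟨t, ?_⟩
  rw [ht]
  congr 1
  ext v
  rw [SQ_apply, Finset.sum_eq_single 1]
  · simp
  · intro g _ hg
    exfalso; apply hg
    apply Subtype.ext
    apply Units.ext
    ext i j
    refine g.2 i j fun h => ?_
    have := h.2.1; rw [Fin.lt_def] at this; omega
  · intro h; exact absurd (Finset.mem_univ _) h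

lemma claim_all (hψ : ψ.IsPrimitive) (hqR : (Fintype.card k : R) ≠ 0) (hW : Cusp W)
    (hsd : ∀ r c : Fin n, (r : ℕ) + 1 = c → sd r ≠ sd c)
    (hl : ∀ l', Whit ψ W l' → ∃ t : R, l' = t • l) : ∀ (a : ℕ) (ha : a < n), Claim ψ W sd l ⟨a, ha⟩ := by
  intro a
  induction a with
  | zero => intro ha; exact claim_base ψ W sd l hl _ rfl
  | succ a ih => 
    intro ha
    exact claim_step ψ W sd l hψ hqR hW ⟨a, by omega⟩ ⟨a + 1, ha⟩ rfl (hsd _ _ rfl) (ih (by omega))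

/-- final form of the descent -/
lemma final_form (hψ : ψ.IsPrimitive) (hqR : (Fintype.card k : R) ≠ 0) (hW : Cusp W)
    (hsd : ∀ r c : Fin n, (r : ℕ) + 1 = c → sd r ≠ sd c)
    (hl : ∀ l', Whit ψ W l' → ∃ t : R, l' = t • l) (a : Fin n) (ha : (a : ℕ) + 1 = n)
    (μ : VW →ₗ[R] R) (hμ : ∀ g, IsH sd g → ∀ v, μ (W g v) = μ v) :
    ∃ t : R, μ = t • SQ W sd l a ∧ ∀ v, (∑ θ : Fin n → k, if θ ≠ 0 ∧ ∀ i, sd i ≠ sd a → θ i = 0 then (1:R) else 0) * μ v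
       = t * ∑ h : Hs k sd, l (W (h : GLn n k) v) := by
  have hle : ∀ i : Fin n, i ≤ a := fun i => by rw [Fin.le_def]; omega
  have hHH : ∀ g : GLn n k, InP (pH sd a) g ↔ IsH sd g := by
    intro g
    constructor
    · intro h i j hij
      rw [h i j (fun h => hij h.1), Matrix.one_apply_ne]
      rintro rfl; exact hij rfl
    · intro h i j hij
      have : sd i ≠ sd j := fun e => hij ⟨e, hle i, hle j⟩
      rw [h i j this, Matrix.one_apply_ne]
      rintro rfl; exact this rfl
  obtain ⟨t, ht⟩ := claim_all ψ W sd l hψ hqR hW hsd hl a a.2 μ (by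
      intro g hg v
      exact hμ g ((hHH g).1 (Q_H sd a g hg)) v) (by
      intro g hg v
      have : g = 1 := by
        apply Units.ext
        ext i j
        exact hg i j fun h => absurd h.2 (not_lt.2 (hle j))
      rw [this, psiN_one, one_mul, map_one]; rfl)
  refine ⟨t, ht, fun v => ?_⟩
  have e0 : ∑ h : Hs k sd, l (W (h : GLn n k) v) = ∑ h : PS k (pH sd a) (tH sd a), l (W (h : GLn n k) v) := by
    refine Fintype.sum_equiv (Equiv.subtypeEquivRight fun g => (hHH g).symm) _ _ fun h => rfl
  have e1 : ∑ h : PS k (pH sd a) (tH sd a), l (W (h : GLn n k) v) = ∑ θ : Fin n → k, ∑ h : PS k (pH sd a) (tH sd a),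
      (if ((h : GLn n k) : Matrix (Fin n) (Fin n) k) a = θ then l (W (h : GLn n k) v) else 0) := by
    rw [Finset.sum_comm]
    refine Finset.sum_congr rfl fun h _ => ?_
    rw [Finset.sum_ite_eq]
    simp
  rw [e0, e1, Finset.sum_mul, Finset.mul_sum]
  refine Finset.sum_congr rfl fun θ _ => ?_
  split_ifs with hval
  · obtain ⟨g0, hg0, rfl⟩ := exists_row sd a θ hval.1 (fun i hi => hval.2 i fun e => hi ⟨hle i, e⟩)
    rw [row_sum sd a g0 hg0 (fun h => l (W h v)), one_mul, ← hμ g0 ((hHH g0).1 hg0) v, ht, LinearMap.smul_apply, smul_eq_mul]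
    congr 1
    rw [SQ_apply]
    simp only [rep_mul]
  · rw [Finset.sum_eq_zero, mul_zero, zero_mul]
    intro h _
    rw [if_neg]
    rintro rfl
    have := row_valid sd a (h : GLn n k) h.2
    exact hval ⟨this.1, fun i hi => this.2 i fun h => hi h.2⟩

end St14
end
end

section
open scoped Classical
open scoped TensorProduct

noncomputable section

namespace St14

set_option linter.unusedSectionVars false
set_option linter.unusedSimpArgs false
set_option linter.unusedVariables false

variable {n : ℕ} {k : Type} [Field k] [Fintype k] {R : Type} [Field R]
variable {VW : Type} [AddCommGroup VW] [Module R VW]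

lemma gs_sq (ψ : AddChar k R) (hψ : ψ.IsPrimitive) (ϱ : kˣ →* Rˣ) (h2 : ϱ * ϱ = 1) (h1 : ϱ ≠ 1) :
    gs ψ ϱ ^ 2 = ((ϱ (-1) : Rˣ) : R) * (Fintype.card k : R) := by
  have e : gs ψ ϱ = gaussSum (MulChar.ofUnitHom ϱ) ψ := by
    rw [gaussSum, ← Finset.add_sum_erase _ _ (Finset.mem_univ (0:k)), MulChar.map_zero, zero_mul, zero_add, gs]
    rw [Finset.sum_subtype (p := fun a : k => a ≠ 0) _ (by simp) (fun x => (MulChar.ofUnitHom ϱ) x * ψ x)]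
    rw [← Equiv.sum_comp unitsEquivNeZero]
    refine Finset.sum_congr rfl fun a _ => ?_
    have : (MulChar.ofUnitHom ϱ) ((unitsEquivNeZero a : {a : k // a ≠ 0}) : k) = (ϱ a : R) := MulChar.ofUnitHom_coe ϱ a
    rw [this, mul_comm]; rfl
  have hne : MulChar.ofUnitHom ϱ ≠ 1 := by
    intro h
    apply h1
    ext a
    have := MulChar.ofUnitHom_coe ϱ a
    rw [h, MulChar.one_apply_coe] at this
    rw [← this]; rfl
  have hq : (MulChar.ofUnitHom ϱ).IsQuadratic := by
    intro a
    by_cases ha : a = 0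
    · left; rw [ha, MulChar.map_zero]
    · right
      have h3 := MulChar.ofUnitHom_coe ϱ (Units.mk0 a ha)
      rw [Units.val_mk0] at h3
      rw [h3]
      have h4 : ϱ (Units.mk0 a ha) * ϱ (Units.mk0 a ha) = 1 := by
        have := DFunLike.congr_fun h2 (Units.mk0 a ha); simpa using this
      have h5 : ((ϱ (Units.mk0 a ha) : Rˣ) : R) * (ϱ (Units.mk0 a ha) : Rˣ) = 1 := by
        rw [← Units.val_mul, h4, Units.val_one]
      exact mul_self_eq_one_iff.1 h5
  rw [e, gaussSum_sq hne hq hψ]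
  congr 1
  have := MulChar.ofUnitHom_coe ϱ (-1 : kˣ)
  rw [← this]; simp

lemma rho_neg_one (ϱ : kˣ →* Rˣ) (h2 : ϱ * ϱ = 1) (h1 : ϱ ≠ 1) (hodd : Odd (Fintype.card k)) :
    ((ϱ (-1) : Rˣ) : R) = (-1) ^ ((Fintype.card k - 1) / 2) := by
  obtain ⟨m, hm⟩ := hodd
  obtain ⟨g, hg⟩ := IsCyclic.exists_generator (α := kˣ)
  have hcard : Fintype.card kˣ = 2 * m := by rw [Fintype.card_units, hm]; rfl
  have hm2 : (Fintype.card k - 1) / 2 = m := by omega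
  have hmpos : 0 < m := by
    have : 0 < Fintype.card kˣ := Fintype.card_pos
    omega
  have hog : orderOf g = 2 * m := by
    rw [orderOf_eq_card_of_forall_mem_zpowers hg, Nat.card_eq_fintype_card, hcard]
  have hgm : g ^ m = -1 := by
    have h3 : g ^ m * g ^ m = 1 := by
      rw [← pow_add, ← two_mul, ← hog, pow_orderOf_eq_one]
    have h4 : g ^ m ≠ 1 := by
      intro h
      have := orderOf_dvd_of_pow_eq_one h
      rw [hog] at this
      have := Nat.le_of_dvd hmpos this
      omega
    have h5 : ((g ^ m : kˣ) : k) * ((g ^ m : kˣ) : k) = 1 := by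
      rw [← Units.val_mul, h3, Units.val_one]
    rcases mul_self_eq_one_iff.1 h5 with h | h
    · exact absurd (Units.ext h) h4
    · exact Units.ext (by rw [h]; simp)
  have hrg : ((ϱ g : Rˣ) : R) = -1 := by
    have h4 : ϱ g * ϱ g = 1 := by
      have := DFunLike.congr_fun h2 g; simpa using this
    have h5 : ((ϱ g : Rˣ) : R) * (ϱ g : Rˣ) = 1 := by
      rw [← Units.val_mul, h4, Units.val_one]
    rcases mul_self_eq_one_iff.1 h5 with h | h
    · exfalso
      apply h1
      have h6 : ϱ g = 1 := Units.ext h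
      refine MonoidHom.ext fun x => ?_
      obtain ⟨z, hz⟩ := Subgroup.mem_zpowers_iff.1 (hg x)
      rw [← hz, map_zpow, h6, one_zpow, MonoidHom.one_apply]
    · exact h
  rw [hm2, ← hgm, map_pow, Units.val_pow_eq_pow_val, hrg]

lemma kappa (ψ : AddChar k R) (hψ : ψ.IsPrimitive) (ϱ : kˣ →* Rˣ) (h2 : ϱ * ϱ = 1) (hodd : Odd (Fintype.card k))
    (u : ℕ) (hu : 1 ≤ u) (hn : n = 2 * u) (hq : (Fintype.card k : R) ^ u = -1) (D : ℕ) (hD : 2 * D = n * n) (c : R)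
    (hc1 : ϱ = 1 → c = -1)
    (hc2 : ϱ ≠ 1 → c = (-1 : R) ^ (u * (Fintype.card k - 1) / 2)) :
    gam ψ n ϱ * c = (Fintype.card k : R) ^ D ∧ c * c = 1 := by
  have hPR := card_PR n
  set q : R := (Fintype.card k : R)
  have hDe : D = u * (2 * u) := by subst hn; nlinarith
  have hPe : Fintype.card (PR n) + u = D := by omega
  by_cases h1 : ϱ = 1
  · rw [hc1 h1]
    refine ⟨?_, by ring⟩
    have h3 : q ^ D = 1 := by
      rw [hDe, pow_mul, hq, pow_mul]; simp
    have h4 : q ^ Fintype.card (PR n) * q ^ u = 1 := by rw [← pow_add, hPe, h3]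
    rw [hq] at h4
    rw [gam, h1, gs_one ψ hψ, hn, pow_mul (-1 : R), h3]
    rw [← hn]
    simpa using h4
  · have hr := rho_neg_one ϱ h2 h1 hodd
    have hc : c = ((ϱ (-1) : Rˣ) : R) ^ u := by
      rw [hc2 h1, hr, ← pow_mul]
      congr 1
      obtain ⟨m, hm⟩ := hodd
      rw [hm, Nat.add_sub_cancel, show u * (2 * m) = 2 * (u * m) by ring, Nat.mul_div_cancel_left _ (by norm_num),
        Nat.mul_div_cancel_left _ (by norm_num), mul_comm]
    have hcc : c * c = 1 := by
      rw [hc, ← mul_pow, hr, ← mul_pow]; simp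
    refine ⟨?_, hcc⟩
    have : gs ψ ϱ ^ n = c * q ^ u := by
      rw [hn, pow_mul, gs_sq ψ hψ ϱ h2 h1, mul_pow, hc]
    rw [gam, this, ← hPe, pow_add]
    linear_combination (q ^ Fintype.card (PR n) * q ^ u) * hcc

lemma count_aux (q : R) (u : ℕ) : ∏ i : Fin (2 * u), (if (i : ℕ) % 2 = 1 then q else 1) = q ^ u := by
  rw [Fin.prod_univ_eq_prod_range (fun i => if i % 2 = 1 then q else 1)]
  induction u with
  | zero => simp
  | succ m ih =>
    rw [show 2 * (m + 1) = 2 * m + 1 + 1 by ring, Finset.prod_range_succ, Finset.prod_range_succ, ih,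
      if_neg (by omega), if_pos (by omega), mul_one, pow_succ]

lemma count_th (u : ℕ) (hn : n = 2 * u) (sd : Fin n → Bool) (hsd : ∀ i, sd i = decide ((i : ℕ) % 2 = 1)) (a : Fin n)
    (ha : (a : ℕ) + 1 = n) :
    (∑ θ : Fin n → k, if θ ≠ 0 ∧ ∀ i, sd i ≠ sd a → θ i = 0 then (1:R) else 0) = (Fintype.card k : R) ^ u - 1 := by
  have hsa : sd a = true := by rw [hsd]; simp; omega
  have h1 : (∑ θ : Fin n → k, if ∀ i, sd i ≠ sd a → θ i = 0 then (1:R) else 0) = (Fintype.card k : R) ^ u := by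
    have e : ∀ θ : Fin n → k, (if ∀ i, sd i ≠ sd a → θ i = 0 then (1:R) else 0) = ∏ i, (if sd i ≠ sd a → θ i = 0 then (1:R) else 0) := by
      intro θ
      rw [Finset.prod_ite_zero]; simp
    rw [Finset.sum_congr rfl (fun θ _ => e θ), sum_prod_pi (fun i b => (if sd i ≠ sd a → b = 0 then (1:R) else 0))]
    subst hn
    rw [← count_aux]
    refine Finset.prod_congr rfl fun i _ => ?_
    have hi' := hsd i
    by_cases hi : (i : ℕ) % 2 = 1
    · simp [hi, hi', hsa]
    · simp [hi, hi', hsa]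
  rw [← h1, ← Finset.add_sum_erase _ _ (Finset.mem_univ (0 : Fin n → k)),
    ← Finset.add_sum_erase (a := (0 : Fin n → k)) (f := fun θ => if ∀ i, sd i ≠ sd a → θ i = 0 then (1:R) else 0) _ (Finset.mem_univ _)]
  rw [if_neg (fun h => h.1 rfl), if_pos (fun i _ => show (0 : Fin n → k) i = 0 from rfl), zero_add, add_sub_cancel_left]
  refine Finset.sum_congr rfl fun θ hθ => ?_
  have := Finset.ne_of_mem_erase hθ
  simp [this]

lemma core (ψ : AddChar k R) (hψ : ψ.IsPrimitive) (hqR : (Fintype.card k : R) ≠ 0) (ϱ : kˣ →* Rˣ) (h2 : ϱ * ϱ = 1)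
    (hodd : Odd (Fintype.card k)) (W : Representation R (GLn n k) VW)
    (hs : Sub ϱ W) (hirr : IsIrreducibleRep W) (hW : Cusp W)
    (l : VW →ₗ[R] R) (hl : Whit ψ W l) (hl0 : l ≠ 0) (u : ℕ) (hu : 1 ≤ u) (hn : n = 2 * u)
    (c : R) (hc1 : ϱ = 1 → c = -1)
    (hc2 : ϱ ≠ 1 → c = (-1 : R) ^ (u * (Fintype.card k - 1) / 2))
    (sd : Fin n → Bool) (hsd : ∀ i, sd i = decide ((i : ℕ) % 2 = 1))
    (σ : Equiv.Perm (Fin n)) (hσ : ∀ i, sd (σ i) = !(sd i)) (hσ2 : σ * σ = 1)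
    (μ : VW →ₗ[R] R) (hμ : ∀ g, IsH sd g → ∀ v, μ (W g v) = μ v) (v : VW) :
    μ (W (Pm k σ) v) = c * μ v := by
  have hq := q_pow ψ hψ hqR ϱ W hs hirr hW l hl hl0 u hu hn
  obtain ⟨hk, hcc⟩ := kappa ψ hψ ϱ h2 hodd u hu hn hq _ (card_DP sd σ hσ) c hc1 hc2
  have hsd' : ∀ r c : Fin n, (r : ℕ) + 1 = c → sd r ≠ sd c := by
    intro r c h
    rw [hsd, hsd, ← h]
    intro e
    have := decide_eq_decide.1 e
    omega
  obtain ⟨a, ha⟩ : ∃ a : Fin n, (a : ℕ) + 1 = n := ⟨⟨n - 1, by omega⟩, by simp; omega⟩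
  have ff := final_form ψ W sd l hψ hqR hW hsd' (fun l' hl' => mult_one ψ hψ hqR ϱ W hs l hl hl0 l' hl') a ha
  obtain ⟨t, ht, ht2⟩ := ff μ hμ
  rw [count_th u hn sd hsd a ha, hq] at ht2
  have hpo := congrArg l (poisson ψ hψ hqR (by omega) ϱ W hs hW sd σ hσ v)
  simp only [map_smul, map_sum, rep_mul, smul_eq_mul] at hpo
  have hg0 : gam ψ n ϱ ≠ 0 := by
    intro h
    rw [h, zero_mul] at hk
    exact q_ne hqR _ hk.symm
  have key : gam ψ n ϱ * (2 * (μ (W (Pm k σ) v) - c * μ v)) = 0 := by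
    have e1 := ht2 v
    have e2 := ht2 (W (Pm k σ) v)
    rw [← hk] at hpo
    linear_combination gam ψ n ϱ * (c * e1 - e2) + t * hpo
  rcases mul_eq_zero.1 key with h | h
  · exact absurd h hg0
  rcases mul_eq_zero.1 h with h | h
  swap
  · exact sub_eq_zero.1 h
  have hneg : (-1 : R) = 1 := by linear_combination -h
  have sq1 : ∀ x : R, x * x = 1 → x = 1 := by
    intro x hx
    rcases mul_self_eq_one_iff.1 hx with h | h
    · exact h
    · rw [h, hneg]
  rw [sq1 c hcc, one_mul]
  have hσi : σ⁻¹ = σ := by rw [inv_eq_iff_mul_eq_one, hσ2]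
  obtain ⟨t', ht', -⟩ := ff (μ ∘ₗ W (Pm k σ)) (by
    intro g hg w
    rw [LinearMap.comp_apply, LinearMap.comp_apply, ← rep_mul]
    have : Pm k σ * g = (Pm k σ * g * Pm k σ⁻¹) * Pm k σ := by
      rw [mul_assoc _ (Pm k σ⁻¹), ← Pm_mul, inv_mul_cancel, Pm_one, mul_one]
    rw [this, rep_mul]
    apply hμ
    intro i j hij
    rw [Units.val_mul, Units.val_mul, Pm_val, Pm_val, mul_PmM_apply, PmM_mul_apply, hσi]
    apply hg
    rw [hσ, hσ]
    simpa using hij)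
  by_cases h0 : t = 0
  · rw [h0, zero_smul] at ht
    rw [ht]; simp
  have hd : ∀ w, μ (W (Pm k σ) w) = (t' / t) * μ w := by
    intro w
    have := LinearMap.congr_fun ht' w
    rw [LinearMap.comp_apply, LinearMap.smul_apply, smul_eq_mul] at this
    have h3 := LinearMap.congr_fun ht w
    rw [LinearMap.smul_apply, smul_eq_mul] at h3
    rw [this, h3]; field_simp
  have hdd := hd (W (Pm k σ) v)
  rw [← rep_mul, ← Pm_mul, hσ2, Pm_one, map_one, Module.End.one_apply, hd v, ← mul_assoc] at hdd
  by_cases hv : μ v = 0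
  · rw [hd v, hv, mul_zero]
  · have : t' / t * (t' / t) = 1 := by
      apply mul_right_cancel₀ hv
      rw [← hdd, one_mul]
    rw [hd v, sq1 _ this, one_mul]

def piE (u : ℕ) (hn : n = 2 * u) : Equiv.Perm (Fin n) where
  toFun i := ⟨if (i : ℕ) < u then 2 * i else 2 * (i - u) + 1, by have := i.2; split_ifs <;> omega⟩
  invFun j := ⟨if (j : ℕ) % 2 = 0 then j / 2 else u + j / 2, by have := j.2; split_ifs <;> omega⟩
  left_inv i := by
    ext
    have := i.2
    dsimp only
    split_ifs <;> omega
  right_inv j := by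
    ext
    have := j.2
    dsimp only
    split_ifs <;> omega

def tauE (u : ℕ) (hn : n = 2 * u) : Equiv.Perm (Fin n) where
  toFun i := ⟨if (i : ℕ) < u then i + u else i - u, by have := i.2; split_ifs <;> omega⟩
  invFun i := ⟨if (i : ℕ) < u then i + u else i - u, by have := i.2; split_ifs <;> omega⟩
  left_inv i := by
    ext
    have := i.2
    dsimp only
    split_ifs <;> omega
  right_inv j := by
    ext
    have := j.2
    dsimp only
    split_ifs <;> omega

lemma core2 (ψ : AddChar k R) (hψ : ψ.IsPrimitive) (hqR : (Fintype.card k : R) ≠ 0) (ϱ : kˣ →* Rˣ) (h2 : ϱ * ϱ = 1)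
    (hodd : Odd (Fintype.card k)) (W : Representation R (GLn n k) VW)
    (hs : Sub ϱ W) (hirr : IsIrreducibleRep W) (hW : Cusp W)
    (l : VW →ₗ[R] R) (hl : Whit ψ W l) (hl0 : l ≠ 0) (u : ℕ) (hu : 1 ≤ u) (hn : n = 2 * u)
    (c : R) (hc1 : ϱ = 1 → c = -1)
    (hc2 : ϱ ≠ 1 → c = (-1 : R) ^ (u * (Fintype.card k - 1) / 2))
    (s : GLn n k)
    (hss : (s : Matrix (Fin n) (Fin n) k) = Matrix.of fun i j : Fin n =>
      if (i : ℕ) + u = (j : ℕ) ∨ (j : ℕ) + u = (i : ℕ) then (1 : k) else 0)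
    (Λ : VW →ₗ[R] R)
    (hΛ : ∀ h ∈ blockLeviSet k n u, ∀ v : VW, Λ (W h v) = Λ v) (v : VW) : Λ (W s v) = c * Λ v := by
  set π := piE u hn with hπ
  set τ := tauE u hn with hτ
  have hττ : τ * τ = 1 := by
    have : τ⁻¹ = τ := rfl
    calc τ * τ = τ⁻¹ * τ := by rw [this]
      _ = 1 := inv_mul_cancel τ
  have hsτ : s = Pm k τ := by
    apply Units.ext
    rw [hss, Pm_val]
    ext i j
    rw [PmM_apply, Matrix.of_apply, Matrix.one_apply]
    refine if_congr ?_ rfl rfl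
    rw [Fin.ext_iff]
    have h1 : ((τ j : Fin n) : ℕ) = if (j : ℕ) < u then (j : ℕ) + u else (j : ℕ) - u := rfl
    rw [h1]
    have := i.2
    have := j.2
    split_ifs <;> omega
  set sd : Fin n → Bool := fun i => decide ((i : ℕ) % 2 = 1) with hsd
  have hsp : ∀ j, sd (π j) = decide (u ≤ (j : ℕ)) := by
    intro j
    have h1 : ((π j : Fin n) : ℕ) = if (j : ℕ) < u then 2 * (j : ℕ) else 2 * ((j : ℕ) - u) + 1 := rfl
    rw [hsd]
    dsimp only
    rw [h1, decide_eq_decide]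
    split_ifs <;> omega
  have hst : ∀ j, sd (π (τ j)) = !(sd (π j)) := by
    intro j
    have h1 : ((τ j : Fin n) : ℕ) = if (j : ℕ) < u then (j : ℕ) + u else (j : ℕ) - u := rfl
    rw [hsp, hsp, h1, ← decide_not, decide_eq_decide]
    have := j.2
    split_ifs <;> omega
  set σ := π * τ * π⁻¹ with hσ
  have hc := core ψ hψ hqR ϱ h2 hodd W hs hirr hW l hl hl0 u hu hn c hc1 hc2 sd (fun i => rfl) σ
    (by
      intro i
      have := hst (π⁻¹ i)
      rw [hσ, Equiv.Perm.mul_apply, Equiv.Perm.mul_apply, this, ← Equiv.Perm.mul_apply, mul_inv_cancel, Equiv.Perm.one_apply])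
    (by
      rw [hσ]
      calc π * τ * π⁻¹ * (π * τ * π⁻¹) = π * (τ * τ) * π⁻¹ := by group
        _ = 1 := by rw [hττ]; simp)
    (Λ ∘ₗ W (Pm k π⁻¹)) (by
      intro g hg w
      rw [LinearMap.comp_apply, LinearMap.comp_apply, ← rep_mul]
      have : Pm k π⁻¹ * g = (Pm k π⁻¹ * g * Pm k π) * Pm k π⁻¹ := by
        rw [mul_assoc _ (Pm k π), ← Pm_mul, mul_inv_cancel, Pm_one, mul_one]
      rw [this, rep_mul]
      apply hΛ
      intro i j hij
      rw [Units.val_mul, Units.val_mul, Pm_val, Pm_val, mul_PmM_apply, PmM_mul_apply, inv_inv]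
      apply hg
      rw [hsp, hsp]
      intro e
      have := decide_eq_decide.1 e
      omega)
    (W (Pm k π) v)
  rw [LinearMap.comp_apply, LinearMap.comp_apply, ← rep_mul, ← rep_mul, ← rep_mul, ← Pm_mul, ← Pm_mul, ← Pm_mul,
    inv_mul_cancel, Pm_one, map_one, Module.End.one_apply] at hc
  rw [← hc, hsτ, hσ]
  congr 4
  group

end St14
end
end

section
open scoped Classical
open scoped TensorProduct

noncomputable section

namespace St14

set_option linter.unusedSectionVars false
set_option linter.unusedSimpArgs false
set_option linter.unusedVariables false

variable {n : ℕ} {k : Type} [Field k] [Fintype k] {R : Type} [Field R]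
variable {VW : Type} [AddCommGroup VW] [Module R VW]

lemma sub_of (ϱ : kˣ →* Rˣ) (hsum : (∑ _i : Fin n, 1) = n) (W : Representation R (GLn n k) VW)
    (hsub : IsSubquotientOf
        (V := hcSubmodule k R (fun _ : Fin n => 1) hsum (fun _ => R) (fun _ => charRep k R ϱ)) W
      (hcInd k R (fun _ : Fin n => 1) hsum (fun _ => R) (fun _ => charRep k R ϱ))) : Sub ϱ W := by
  obtain ⟨qs, hq, φ, hsurj, heq⟩ := hsub
  set e : (⨂[R] (_ : Fin n), R) ≃ₗ[R] R := (PiTensorProduct.constantBaseRingEquiv (Fin n) R).toLinearEquiv with he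
  have he1 : ∀ x : Fin n → R, e (PiTensorProduct.tprod R x) = ∏ i, x i := fun x =>
    PiTensorProduct.constantBaseRingEquiv_tprod x
  set T : hcSubmodule k R (fun _ : Fin n => 1) hsum (fun _ => R) (fun _ => charRep k R ϱ) →ₗ[R] (GLn n k → R) :=
    (LinearMap.compLeft (e : (⨂[R] (_ : Fin n), R) →ₗ[R] R) (GLn n k)) ∘ₗ Submodule.subtype _ with hT
  have hTa : ∀ f x, T f x = e ((f : GLn n k → ⨂[R] (_ : Fin n), R) x) := fun f x => rfl
  have hinj : Function.Injective T := by
    intro f g h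
    apply Subtype.ext
    funext x
    exact e.injective (congrFun h x)
  have hreg : ∀ g f, regRep R (GLn n k) g (T f) = T (hcInd k R (fun _ : Fin n => 1) hsum (fun _ => R) (fun _ => charRep k R ϱ) g f) :=
    fun g f => rfl
  have hq' : ∀ g, ∀ f ∈ qs.map T, regRep R (GLn n k) g f ∈ qs.map T := by
    rintro g _ ⟨f, hf, rfl⟩
    exact ⟨_, hq g f hf, (hreg g f).symm⟩
  have hsy : ∀ (f : qs) (h : T f ∈ qs.map T), (Submodule.equivMapOfInjective T hinj qs).symm ⟨T f, h⟩ = f := by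
    intro f h
    rw [LinearEquiv.symm_apply_eq]
    rfl
  refine ⟨qs.map T, hq', φ ∘ₗ ((Submodule.equivMapOfInjective T hinj qs).symm : qs.map T →ₗ[R] qs), ?_, ?_, ?_⟩
  · exact hsurj.comp (Submodule.equivMapOfInjective T hinj qs).symm.surjective
  · rintro g ⟨_, ⟨f, hf, rfl⟩⟩
    have h1 := hsy ⟨f, hf⟩ ⟨f, hf, rfl⟩
    have h2 := hsy ⟨_, hq g f hf⟩ ⟨_, hq g f hf, rfl⟩
    exact (congrArg φ h2).trans ((heq g ⟨f, hf⟩).trans (congrArg (fun z => W g (φ z)) h1.symm))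
  · rintro _ ⟨f, hf, rfl⟩ b hb g
    have hidx : ∀ (i : Fin n) (x : Fin 1), blockIdx (fun _ : Fin n => 1) hsum ⟨i, x⟩ = i := by
      intro i x
      apply Fin.ext
      have hx : (x : ℕ) = 0 := by omega
      show (∑ j ∈ Finset.univ.filter (fun j => j < i), 1) + (x : ℕ) = i
      rw [hx, add_zero, ← Finset.card_eq_sum_ones]
      have : Finset.univ.filter (fun j => j < i) = Finset.Iio i := by ext; simp
      rw [this, Fin.card_Iio]
    have hBU : IsBlockUpper k (fun _ : Fin n => 1) hsum (b : Matrix (Fin n) (Fin n) k) := by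
      rintro ⟨i, x⟩ ⟨j, y⟩ h
      rw [hidx, hidx]
      exact hb i j h
    have hdet : ∀ i, (diagBlock k (fun _ : Fin n => 1) hsum (b : Matrix (Fin n) (Fin n) k) i).det = (b : Matrix (Fin n) (Fin n) k) i i := by
      intro i
      refine (Matrix.det_fin_one _).trans ?_
      show (b : Matrix (Fin n) (Fin n) k) (blockIdx (fun _ : Fin n => 1) hsum ⟨i, 0⟩) (blockIdx (fun _ : Fin n => 1) hsum ⟨i, 0⟩) = _
      rw [hidx]
    set δ : ∀ i : Fin n, Matrix.GeneralLinearGroup (Fin 1) k := fun i =>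
      Matrix.GeneralLinearGroup.mkOfDetNeZero (diagBlock k (fun _ : Fin n => 1) hsum (b : Matrix (Fin n) (Fin n) k) i)
        (by rw [hdet]; exact up_diag_ne b hb i) with hδ
    have key := f.2 b hBU δ (fun i => rfl) g
    rw [hTa, hTa, key]
    have hm : ∀ z : ⨂[R] (_ : Fin n), R, e (PiTensorProduct.map (fun i => charRep k R ϱ (δ i)) z) = dch ϱ b * e z := by
      have hch : ∀ i (r : R), charRep k R ϱ (δ i) r = ((ϱ (Units.map Matrix.detMonoidHom (δ i)) : Rˣ) : R) * r := fun i r => rfl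
      have hd : dch ϱ b = ∏ i, ((ϱ (Units.map Matrix.detMonoidHom (δ i)) : Rˣ) : R) := by
        rw [← Units.coe_prod, ← map_prod, dch]
        congr 2
        apply Units.ext
        rw [Units.coe_prod, Matrix.GeneralLinearGroup.val_det_apply, up_det b hb]
        refine Finset.prod_congr rfl fun i _ => ?_
        exact (hdet i).symm
      intro z
      have : (e : (⨂[R] (_ : Fin n), R) →ₗ[R] R) ∘ₗ PiTensorProduct.map (fun i => charRep k R ϱ (δ i)) = dch ϱ b • (e : (⨂[R] (_ : Fin n), R) →ₗ[R] R) := by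
        apply PiTensorProduct.ext
        refine MultilinearMap.ext fun x => ?_
        simp only [LinearMap.compMultilinearMap_apply, LinearMap.comp_apply, PiTensorProduct.map_tprod, LinearMap.smul_apply, LinearEquiv.coe_coe]
        rw [he1, he1, hd, smul_eq_mul, ← Finset.prod_mul_distrib]
        exact Finset.prod_congr rfl fun i _ => hch i (x i)
      exact LinearMap.congr_fun this z
    exact hm _

lemma whit_of (W : Representation R (GLn n k) VW) (hgen : IsGeneric k R W) :
    ∃ ψ : AddChar k R, ψ.IsPrimitive ∧ ∃ l : VW →ₗ[R] R, l ≠ 0 ∧ Whit ψ W l := by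
  obtain ⟨ψ, ⟨a, ha⟩, l, hl0, hl⟩ := hgen
  refine ⟨(Units.coeHom R).compAddChar ψ, ?_, l, hl0, ?_⟩
  · apply AddChar.IsPrimitive.of_ne_one
    intro h
    apply ha
    have := DFunLike.congr_fun h a
    exact Units.ext this
  · intro m hm v
    have := hl m ⟨fun i j h => hm.1 i j h, hm.2⟩ v
    rw [this, Units.smul_def, smul_eq_mul]
    rfl

end St14
end
end

/-- Let `k` be a finite field of odd characteristic `p` with `q = |k|` elements, let `ℓ`
be a prime different from `p`, and let `R` be an algebraically closed field of
characteristic `ℓ`. Let `n = 2u` with `u ≥ 1`, let `ϱ : kˣ → Rˣ` be a character with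
`ϱ² = 1`, and let `W` be an irreducible subquotient of the `n`-fold Harish-Chandra
induction `ϱ × ⋯ × ϱ` to `GL_n(k)` which is generic, cuspidal and isomorphic to its dual.
Let `H = GL_u(k) × GL_u(k)` (block-diagonally in `GL_n(k)`), and let `s ∈ GL_n(k)` be the
block matrix `[[0, Id_u],[Id_u, 0]]`, which normalizes `H`. Assume `W` is
`H`-distinguished. Then every `H`-invariant linear form `Λ` on `W` satisfies
`Λ ∘ W(s) = c·Λ`, where `c = −1` if `ϱ` is trivial and `c = (−1)^{u(q−1)/2}` if `ϱ` is
nontrivial. -/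
theorem stmt_14
    (p ℓ : ℕ) [Fact p.Prime] (hp : Odd p) (hℓ : ℓ.Prime) (hℓp : ℓ ≠ p)
    (k : Type) [Field k] [Fintype k] [CharP k p]
    (R : Type) [Field R] [IsAlgClosed R] [CharP R ℓ]
    (u : ℕ) (hu : 1 ≤ u) (n : ℕ) (hn : n = 2 * u)
    (ϱ : kˣ →* Rˣ) (hϱ2 : ϱ * ϱ = 1)
    (hsum : (∑ _i : Fin n, 1) = n)
    (VW : Type) [AddCommGroup VW] [Module R VW]
    (W : Representation R (Matrix.GeneralLinearGroup (Fin n) k) VW)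
    (hsub : IsSubquotientOf
        (V := hcSubmodule k R (fun _ : Fin n => 1) hsum (fun _ => R) (fun _ => charRep k R ϱ)) W
      (hcInd k R (fun _ : Fin n => 1) hsum (fun _ => R) (fun _ => charRep k R ϱ)))
    (hgen : IsGeneric k R W) (hcusp : IsCuspidal k R W)
    (hselfdual : ∃ e : VW ≃ₗ[R] Module.Dual R VW,
      ∀ g v, e (W g v) = Representation.dual W g (e v))
    (hdist : IsDistinguishedBy k R W (blockLeviSet k n u))
    (s : Matrix.GeneralLinearGroup (Fin n) k)
    (hs : (s : Matrix (Fin n) (Fin n) k) = Matrix.of fun i j : Fin n =>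
      if (i : ℕ) + u = (j : ℕ) ∨ (j : ℕ) + u = (i : ℕ) then (1 : k) else 0)
    (c : R)
    (hc1 : ϱ = 1 → c = -1)
    (hc2 : ϱ ≠ 1 → c = (-1 : R) ^ (u * (Fintype.card k - 1) / 2))
    (Λ : VW →ₗ[R] R)
    (hΛ : ∀ h ∈ blockLeviSet k n u, ∀ v : VW, Λ (W h v) = Λ v) :
    ∀ v : VW, Λ (W s v) = c * Λ v := by
  haveI : Fact ℓ.Prime := ⟨hℓ⟩
  obtain ⟨ψ, hψ, l, hl0, hl⟩ := St14.whit_of W hgen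
  obtain ⟨m, -, hcard⟩ := FiniteField.card k p
  have hqR : (Fintype.card k : R) ≠ 0 := by
    rw [hcard, Nat.cast_pow]
    apply pow_ne_zero
    intro h
    rw [CharP.cast_eq_zero_iff R ℓ] at h
    exact hℓp ((Nat.prime_dvd_prime_iff_eq hℓ Fact.out).1 h)
  have hodd : Odd (Fintype.card k) := by
    rw [hcard]
    exact hp.pow
  intro v
  exact St14.core2 ψ hψ hqR ϱ hϱ2 hodd W (St14.sub_of ϱ hsum W hsub) hcusp.1
    (fun r h0 h1 μ hμ => St14.cusp_lemma W hcusp r h0 h1 μ hμ) l hl hl0 u hu hn c hc1 hc2 s hs Λ hΛ v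
end
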